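/- Assume in addition ∫_ℝ (1+|x|²) J(x) dx < ∞. Let 1 < q < 2, φ ∈ L¹(ℝ), λ ≥ 1 and 0 < μ ≤ 1, and let u = u^μ_λ be the classical solution of the rescaled regularized problem. Then there exists a constant C = C(‖φ‖_{L¹(ℝ)}, J, q) > 0, independent of λ and μ, such that for all t > 0 and R > 0: ∫_{|x|>2R} |u(t,x)| dx ≤ ∫_{|x|>R} |φ(x)| dx + C·( t/R² + t^{1/q}/R ). -/

import Mathlib

open MeasureTheory Filter ENNReal

/-- `u` is a classical solution of the rescaled regularized problem
`u_t + |u|^{q-1} u_x = λ^q (J_λ ∗ u - u) + μ u_xx` with initial datum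
`φ_λ(x) = λ φ(λ x)`, where `J_λ(x) = λ J(λ x)`. -/
def IsRescaledSol (J : ℝ → ℝ) (q lam μ : ℝ) (φ : ℝ → ℝ) (u : ℝ → ℝ → ℝ) : Prop :=
  (∀ t : ℝ, 0 ≤ t → Integrable (u t)) ∧
  (∀ t₀ : ℝ, 0 ≤ t₀ →
    Tendsto (fun t => ∫ x, |u t x - u t₀ x|) (nhdsWithin t₀ (Set.Ici 0)) (nhds 0)) ∧
  (∀ t : ℝ, 0 < t → ContDiff ℝ 2 (u t)) ∧
  (∀ x : ℝ, ContDiffOn ℝ 1 (fun s => u s x) (Set.Ioi 0)) ∧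
  (∀ t : ℝ, 0 < t → ∀ x : ℝ,
    deriv (fun s => u s x) t + |u t x| ^ (q - 1) * deriv (u t) x
      = lam ^ q * ((∫ y, lam * J (lam * (x - y)) * u t y) - u t x)
        + μ * deriv (deriv (u t)) x) ∧
  (u 0 =ᵐ[volume] fun x => lam * φ (lam * x))

open Topology

/-- smooth bump on `(0,1)` with integral one -/
noncomputable def kbump : ContDiffBump (1/2 : ℝ) := ⟨1/4, 1/2, by norm_num, by norm_num⟩
noncomputable def kk : ℝ → ℝ := kbump.normed volume
noncomputable def pp (x : ℝ) : ℝ := ∫ t in (0:ℝ)..x, kk t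
noncomputable def HH (x : ℝ) : ℝ := ∫ t in (0:ℝ)..x, pp t

lemma kk_contDiff (n : ℕ∞) : ContDiff ℝ n kk := kbump.contDiff_normed
lemma kk_cont : Continuous kk := (kk_contDiff 0).continuous
lemma kk_nonneg (x : ℝ) : 0 ≤ kk x := kbump.nonneg_normed x
lemma kk_zero_left {x : ℝ} (h : x ≤ 0) : kk x = 0 := by
  have : x ∉ Function.support kk := by
    unfold kk; rw [kbump.support_normed_eq]
    simp only [Metric.mem_ball, Real.dist_eq, kbump, not_lt]
    rw [abs_of_nonpos (by linarith)]; linarith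
  simpa using this
lemma kk_zero_right {x : ℝ} (h : 1 ≤ x) : kk x = 0 := by
  have : x ∉ Function.support kk := by
    unfold kk; rw [kbump.support_normed_eq]
    simp only [Metric.mem_ball, Real.dist_eq, kbump, not_lt]
    rw [abs_of_nonneg (by linarith)]; linarith
  simpa using this
lemma kk_hasCompactSupport : HasCompactSupport kk := kbump.hasCompactSupport_normed
lemma kk_integral : ∫ t in (0:ℝ)..1, kk t = 1 := by
  rw [intervalIntegral.integral_of_le zero_le_one]
  rw [setIntegral_eq_integral_of_forall_compl_eq_zero]
  · exact kbump.integral_normed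
  · intro x hx
    simp only [Set.mem_Ioc, not_and_or, not_lt, not_le] at hx
    rcases hx with h | h
    · exact kk_zero_left h
    · exact kk_zero_right h.le
lemma kk_bound : ∃ C : ℝ, 0 < C ∧ (∀ x, kk x ≤ C) ∧ (∀ x, |deriv kk x| ≤ C) := by
  obtain ⟨C, hC⟩ := kk_hasCompactSupport.exists_bound_of_continuous kk_cont
  obtain ⟨D, hD⟩ := (kk_hasCompactSupport.deriv).exists_bound_of_continuous
    ((kk_contDiff 1).continuous_deriv le_rfl)
  refine ⟨max (max C D) 1, by positivity, fun x => ?_, fun x => ?_⟩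
  · exact (le_abs_self _).trans ((hC x).trans ((le_max_left _ _).trans (le_max_left _ _)))
  · exact (hD x).trans ((le_max_right _ _).trans (le_max_left _ _))
lemma pp_deriv (x : ℝ) : HasDerivAt pp (kk x) x :=
  intervalIntegral.integral_hasDerivAt_right (kk_cont.intervalIntegrable _ _)
    (kk_cont.stronglyMeasurableAtFilter _ _) kk_cont.continuousAt
lemma pp_cont : Continuous pp := continuous_iff_continuousAt.2 fun x => (pp_deriv x).continuousAt
lemma pp_mono : Monotone pp := monotone_of_deriv_nonneg (fun x => (pp_deriv x).differentiableAt)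
  (fun x => by rw [(pp_deriv x).deriv]; exact kk_nonneg x)
lemma pp_zero {x : ℝ} (h : x ≤ 0) : pp x = 0 := by
  unfold pp
  rw [intervalIntegral.integral_symm, neg_eq_zero]
  apply intervalIntegral.integral_zero_ae
  refine Eventually.of_forall fun t ht => kk_zero_left ?_
  rw [Set.uIoc_of_le h] at ht; exact ht.2
lemma pp_one {x : ℝ} (h : 1 ≤ x) : pp x = 1 := by
  unfold pp
  rw [← intervalIntegral.integral_add_adjacent_intervals (b := 1)
    (kk_cont.intervalIntegrable _ _) (kk_cont.intervalIntegrable _ _), kk_integral]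
  simp only [add_eq_left]
  apply intervalIntegral.integral_zero_ae
  refine Eventually.of_forall fun t ht => kk_zero_right ?_
  rw [Set.uIoc_of_le h] at ht; exact ht.1.le
lemma pp_nonneg (x : ℝ) : 0 ≤ pp x := by
  rcases le_total x 0 with h | h
  · rw [pp_zero h]
  · rw [← pp_zero le_rfl]; exact pp_mono h
lemma pp_le_one (x : ℝ) : pp x ≤ 1 := by
  rcases le_total x 1 with h | h
  · rw [← pp_one le_rfl]; exact pp_mono h
  · rw [pp_one h]
lemma HH_deriv (x : ℝ) : HasDerivAt HH (pp x) x :=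
  intervalIntegral.integral_hasDerivAt_right (pp_cont.intervalIntegrable _ _)
    (pp_cont.stronglyMeasurableAtFilter _ _) pp_cont.continuousAt
lemma HH_cont : Continuous HH := continuous_iff_continuousAt.2 fun x => (HH_deriv x).continuousAt
lemma HH_mono : Monotone HH := monotone_of_deriv_nonneg (fun x => (HH_deriv x).differentiableAt)
  (fun x => by rw [(HH_deriv x).deriv]; exact pp_nonneg x)
lemma HH_zero {x : ℝ} (h : x ≤ 0) : HH x = 0 := by
  unfold HH
  rw [intervalIntegral.integral_symm, neg_eq_zero]
  apply intervalIntegral.integral_zero_ae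
  refine Eventually.of_forall fun t ht => pp_zero ?_
  rw [Set.uIoc_of_le h] at ht; exact ht.2
lemma HH_nonneg (x : ℝ) : 0 ≤ HH x := by
  rcases le_total x 0 with h | h
  · rw [HH_zero h]
  · rw [← HH_zero le_rfl]; exact HH_mono h
lemma HH_lip (x y : ℝ) : |HH x - HH y| ≤ |x - y| := by
  have := Convex.norm_image_sub_le_of_norm_deriv_le (f := HH) (C := 1) (s := Set.univ) (x := y)
    (y := x) (fun x _ => (HH_deriv x).differentiableAt)
    (fun x _ => by
      rw [(HH_deriv x).deriv, Real.norm_eq_abs, abs_of_nonneg (pp_nonneg x)]; exact pp_le_one x)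
    convex_univ trivial trivial
  simpa using this
lemma HH_le {x : ℝ} (h : 0 ≤ x) : HH x ≤ x := by
  have := HH_lip x 0
  rw [HH_zero le_rfl, sub_zero, sub_zero, abs_of_nonneg h] at this
  exact (le_abs_self _).trans this
lemma HH_ge (x : ℝ) : x - 1 ≤ HH x := by
  rcases le_total x 1 with h | h
  · exact (by linarith : x - 1 ≤ 0).trans (HH_nonneg x)
  · have h1 : HH x = HH 1 + (x - 1) := by
      unfold HH
      rw [← intervalIntegral.integral_add_adjacent_intervals (a := 0) (b := 1) (c := x)
        (pp_cont.intervalIntegrable _ _) (pp_cont.intervalIntegrable _ _)]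
      congr 1
      rw [intervalIntegral.integral_congr (g := fun _ => (1:ℝ))]
      · simp
      · intro t ht; rw [Set.uIcc_of_le h] at ht; exact pp_one ht.1
    rw [h1]; linarith [HH_nonneg 1]

lemma ftc_le {α β c : ℝ} (hab : α ≤ β) {f B B' : ℝ → ℝ}
    (hB : ∀ x, HasDerivAt B (B' x) x) (hB' : Continuous B') (hf : Continuous f)
    (h : ∀ x ∈ Set.Icc α β, f x ≤ B' x + c) :
    ∫ x in α..β, f x ≤ B β - B α + c * (β - α) := by
  have h1 : ∫ x in α..β, f x ≤ ∫ x in α..β, (B' x + c) :=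
    intervalIntegral.integral_mono_on hab (hf.intervalIntegrable _ _)
      ((hB'.add continuous_const).intervalIntegrable _ _) h
  rw [intervalIntegral.integral_add (hB'.intervalIntegrable _ _) (by simp),
    intervalIntegral.integral_eq_sub_of_hasDerivAt (fun x _ => hB x)
      (hB'.intervalIntegrable _ _), intervalIntegral.integral_const, smul_eq_mul] at h1
  linarith

lemma absrpow_cont {p : ℝ} (hp : 0 < p) : Continuous (fun v : ℝ => |v| ^ p) :=
  continuous_abs.rpow_const (fun _ => Or.inr hp.le)

/-- flux-type primitive -/
noncomputable def prim (a : ℝ → ℝ) (v : ℝ) : ℝ := ∫ s in (0:ℝ)..v, a s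

lemma prim_deriv {a : ℝ → ℝ} (ha : Continuous a) (v : ℝ) : HasDerivAt (prim a) (a v) v :=
  intervalIntegral.integral_hasDerivAt_right (ha.intervalIntegrable _ _)
    (ha.stronglyMeasurableAtFilter _ _) ha.continuousAt

lemma prim_cont {a : ℝ → ℝ} (ha : Continuous a) : Continuous (prim a) :=
  continuous_iff_continuousAt.2 fun x => (prim_deriv ha x).continuousAt

lemma prim_sub_le {a : ℝ → ℝ} (ha : Continuous a) {N A x y : ℝ}
    (hA : ∀ s, |s| ≤ N → |a s| ≤ A) (hx : |x| ≤ N) (hy : |y| ≤ N) :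
    |prim a x - prim a y| ≤ A * |x - y| := by
  have : prim a x - prim a y = ∫ s in y..x, a s := by
    unfold prim
    rw [intervalIntegral.integral_interval_sub_left (ha.intervalIntegrable _ _)
      (ha.intervalIntegrable _ _)]
  rw [this, ← Real.norm_eq_abs]
  refine (intervalIntegral.norm_integral_le_of_norm_le_const (C := A) ?_)
  intro s hs
  apply hA
  have hs' := Set.uIoc_subset_uIcc hs
  rw [Set.mem_uIcc] at hs'
  rw [abs_le] at *
  rcases hs' with h | h <;> constructor <;> linarith [h.1, h.2]

lemma rpow_abs_le {p N s : ℝ} (hp : 0 < p) (h : |s| ≤ N) : |s| ^ p ≤ N ^ p :=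
  Real.rpow_le_rpow (abs_nonneg _) h hp.le

lemma lemG {q μ n Γ α β : ℝ} (hq : 1 < q) (hμ : 0 < μ) (hn : 0 ≤ n) (hΓ : 0 ≤ Γ)
    (hab : α ≤ β) : ∃ C : ℝ, 0 ≤ C ∧ ∀ v v1 v2 w w1 w2 : ℝ → ℝ,
      (∀ x, HasDerivAt v (v1 x) x) → (∀ x, HasDerivAt v1 (v2 x) x) → Continuous v2 →
      (∀ x, HasDerivAt w (w1 x) x) → (∀ x, HasDerivAt w1 (w2 x) x) → Continuous w2 →
      (∀ x ∈ Set.Icc α β, |w x| ≤ n ∧ |w1 x| ≤ n ∧ |w2 x| ≤ n) →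
      ∀ γ ∈ Set.Icc 0 Γ, ∀ δ ∈ Set.Ioc (0:ℝ) 1, v α - w α - γ ≤ 0 → v β - w β - γ ≤ 0 →
      ∫ x in α..β, pp ((v x - w x - γ) / δ) * (μ * v2 x - |v x| ^ (q - 1) * v1 x) ≤ C := by
  obtain ⟨Ck, hCk, hk, -⟩ := kk_bound
  have hp : 0 < q - 1 := by linarith
  set A : ℝ := (n + Γ + 1) ^ (q - 1) with hA
  have hA0 : 0 ≤ A := by positivity
  refine ⟨(Ck * A ^ 2 / (4 * μ) + μ * n + A * n) * (β - α),
    mul_nonneg (by positivity) (by linarith), ?_⟩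
  intro v v1 v2 w w1 w2 hv hv1 hv2c hw hw1 hw2c hbd γ hγ δ hδ hα hβ
  have hvc : Continuous v := continuous_iff_continuousAt.2 fun x => (hv x).continuousAt
  have hv1c : Continuous v1 := continuous_iff_continuousAt.2 fun x => (hv1 x).continuousAt
  have hwc : Continuous w := continuous_iff_continuousAt.2 fun x => (hw x).continuousAt
  have hw1c : Continuous w1 := continuous_iff_continuousAt.2 fun x => (hw1 x).continuousAt
  have hac := absrpow_cont hp
  set a : ℝ → ℝ := fun v => |v| ^ (q - 1) with ha
  set F := prim a with hF
  have hFc : Continuous F := prim_cont hac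
  have hkc := kk_cont
  have hpc := pp_cont
  have hδ0 := hδ.1
  have hmain := ftc_le (α := α) (β := β) (c := Ck * A ^ 2 / (4 * μ) + μ * n + A * n) hab
    (f := fun x => pp ((v x - w x - γ) / δ) * (μ * v2 x - a (v x) * v1 x))
    (B := fun x => pp ((v x - w x - γ) / δ) * (μ * (v1 x - w1 x) - (F (v x) - F (w x + γ))))
    (B' := fun x => (kk ((v x - w x - γ) / δ) * ((v1 x - w1 x) / δ)) *
        (μ * (v1 x - w1 x) - (F (v x) - F (w x + γ))) +
        pp ((v x - w x - γ) / δ) *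
          (μ * (v2 x - w2 x) - (a (v x) * v1 x - a (w x + γ) * w1 x)))
    ?_ ?_ ?_ ?_
  · refine hmain.trans (le_of_eq ?_)
    have h1 : pp ((v α - w α - γ) / δ) = 0 := pp_zero (div_nonpos_of_nonpos_of_nonneg hα hδ0.le)
    have h2 : pp ((v β - w β - γ) / δ) = 0 := pp_zero (div_nonpos_of_nonpos_of_nonneg hβ hδ0.le)
    simp only [h1, h2]; ring
  · intro x
    have e1 : HasDerivAt (fun x => pp ((v x - w x - γ) / δ))
        (kk ((v x - w x - γ) / δ) * ((v1 x - w1 x) / δ)) x :=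
      (pp_deriv _).comp x ((((hv x).sub (hw x)).sub_const γ).div_const δ)
    have e2 : HasDerivAt (fun x => F (v x)) (a (v x) * v1 x) x :=
      (prim_deriv hac _).comp x (hv x)
    have e3 : HasDerivAt (fun x => F (w x + γ)) (a (w x + γ) * w1 x) x :=
      (prim_deriv hac _).comp x ((hw x).add_const γ)
    exact e1.mul ((((hv1 x).sub (hw1 x)).const_mul μ).sub (e2.sub e3))
  · fun_prop
  · fun_prop
  · intro x hx
    obtain ⟨b0, b1, b2⟩ := hbd x hx
    set Z := v x - w x - γ with hZ
    set D := F (v x) - F (w x + γ) with hD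
    set y := v1 x - w1 x with hy
    have hP0 := pp_nonneg (Z / δ)
    have hP1 := pp_le_one (Z / δ)
    have key1 : - (kk (Z / δ) * (y / δ) * (μ * y - D)) ≤ Ck * A ^ 2 / (4 * μ) := by
      by_cases hz : 0 < Z ∧ Z < δ
      · have hDb : |D| ≤ A * δ := by
          have hvw : v x - (w x + γ) = Z := by rw [hZ]; ring
          have := prim_sub_le hac (N := n + Γ + 1) (A := A) (x := v x) (y := w x + γ) ?_ ?_ ?_
          · rw [hvw, abs_of_pos hz.1] at this
            exact this.trans (mul_le_mul_of_nonneg_left hz.2.le hA0)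
          · intro s hs
            rw [abs_of_nonneg (by positivity)]
            exact rpow_abs_le hp hs
          · have : v x = Z + (w x + γ) := by rw [hZ]; ring
            rw [this, abs_le]
            rw [abs_le] at b0
            constructor <;> linarith [hγ.1, hγ.2, hδ.2, b0.1, b0.2]
          · rw [abs_le] at b0 ⊢
            constructor <;> linarith [hγ.1, hγ.2, hδ.2, b0.1, b0.2]
        have hD2 : D ^ 2 ≤ (A * δ) ^ 2 := sq_le_sq' (by linarith [neg_abs_le D]) (by linarith [le_abs_self D])
        have hq1 : -(y * (μ * y - D)) ≤ D ^ 2 / (4 * μ) := by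
          rw [le_div_iff₀ (by positivity)]
          nlinarith [sq_nonneg (2 * μ * y - D)]
        calc - (kk (Z / δ) * (y / δ) * (μ * y - D)) = kk (Z / δ) / δ * (-(y * (μ * y - D))) := by ring
          _ ≤ kk (Z / δ) / δ * ((A * δ) ^ 2 / (4 * μ)) := by
              apply mul_le_mul_of_nonneg_left _ (div_nonneg (kk_nonneg _) hδ0.le)
              exact hq1.trans (by gcongr)
          _ = kk (Z / δ) * δ * (A ^ 2 / (4 * μ)) := by field_simp
          _ ≤ Ck * 1 * (A ^ 2 / (4 * μ)) := by
              have := hk (Z / δ); have := hδ.2; have := kk_nonneg (Z / δ)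
              gcongr
          _ = _ := by ring
      · have : kk (Z / δ) = 0 := by
          rw [not_and_or, not_lt, not_lt] at hz
          rcases hz with h | h
          · exact kk_zero_left (div_nonpos_of_nonpos_of_nonneg h hδ0.le)
          · exact kk_zero_right (by rwa [le_div_iff₀ hδ0, one_mul])
        rw [this]; simp; positivity
    have hab' : a (w x + γ) ≤ A := by
      apply rpow_abs_le hp
      rw [abs_le] at b0 ⊢
      constructor <;> linarith [hγ.1, hγ.2, b0.1, b0.2]
    have ha0 : 0 ≤ a (w x + γ) := by simp only [ha]; positivity
    have key2 : pp (Z / δ) * (μ * w2 x - a (w x + γ) * w1 x) ≤ μ * n + A * n := by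
      have h1 : μ * w2 x - a (w x + γ) * w1 x ≤ μ * n + A * n := by
        have i1 : μ * w2 x ≤ μ * n := mul_le_mul_of_nonneg_left ((le_abs_self _).trans b2) hμ.le
        have i2 : -(a (w x + γ) * w1 x) ≤ A * n := by
          calc -(a (w x + γ) * w1 x) = a (w x + γ) * (- w1 x) := by ring
            _ ≤ a (w x + γ) * n := mul_le_mul_of_nonneg_left ((neg_le_abs _).trans b1) ha0
            _ ≤ A * n := mul_le_mul_of_nonneg_right hab' hn
        linarith
      have h2 : 0 ≤ μ * n + A * n := by positivity
      nlinarith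
    have : pp (Z / δ) * (μ * v2 x - a (v x) * v1 x) =
      (kk (Z / δ) * (y / δ) * (μ * y - D) +
        pp (Z / δ) * (μ * (v2 x - w2 x) - (a (v x) * v1 x - a (w x + γ) * w1 x)))
      + (- (kk (Z / δ) * (y / δ) * (μ * y - D))
      + pp (Z / δ) * (μ * w2 x - a (w x + γ) * w1 x)) := by ring
    linarith

lemma lemBfix {q μ M α β : ℝ} (hq : 1 < q) (hab : α < β) {e j v v1 v2 : ℝ → ℝ}
    (he : ∀ x, HasDerivAt e (j x) x) (hj : Continuous j) (hj0 : ∀ x, 0 ≤ j x) (hj1 : ∀ x, j x ≤ 1)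
    (heM : ∀ x, |x| ≤ M → e x = 0)
    (hv : ∀ x, HasDerivAt v (v1 x) x) (hv1 : ∀ x, HasDerivAt v1 (v2 x) x) (hv2c : Continuous v2)
    (hα : |v α| ≤ M) (hβ : |v β| ≤ M) :
    (∫ x in α..β, e (v x) * (μ * v2 x - |v x| ^ (q - 1) * v1 x)
      ≤ - μ * ∫ x in α..β, j (v x) * v1 x ^ 2) ∧
    ∀ x ∈ Set.Icc α β, (e (v x)) ^ 2 ≤ (β - α) * ∫ x in α..β, j (v x) * v1 x ^ 2 := by
  have hp : 0 < q - 1 := by linarith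
  have hvc : Continuous v := continuous_iff_continuousAt.2 fun x => (hv x).continuousAt
  have hv1c : Continuous v1 := continuous_iff_continuousAt.2 fun x => (hv1 x).continuousAt
  have hec : Continuous e := continuous_iff_continuousAt.2 fun x => (he x).continuousAt
  have hac := absrpow_cont hp
  set a : ℝ → ℝ := fun v => |v| ^ (q - 1) with ha
  have hQc : Continuous fun s => e s * a s := hec.mul hac
  set Q := prim (fun s => e s * a s) with hQ
  have hI0 : 0 ≤ ∫ x in α..β, j (v x) * v1 x ^ 2 :=
    intervalIntegral.integral_nonneg hab.le fun x _ => mul_nonneg (hj0 _) (sq_nonneg _)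
  have hQ0 : ∀ x, |x| ≤ M → Q x = 0 := by
    intro x hx
    have := prim_sub_le hQc (N := M) (A := 0) (x := x) (y := 0) ?_ hx
      (by simpa using (abs_nonneg x).trans hx)
    · simp only [zero_mul, abs_nonpos_iff] at this
      rw [hQ, ← sub_zero (prim _ x)]
      simpa [prim] using this
    · intro s hs; simp [heM s hs]
  constructor
  · have hmain := ftc_le (α := α) (β := β) (c := 0) hab.le
      (f := fun x => e (v x) * (μ * v2 x - a (v x) * v1 x) + μ * (j (v x) * v1 x ^ 2))
      (B := fun x => μ * (e (v x) * v1 x) - Q (v x))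
      (B' := fun x => μ * (j (v x) * v1 x * v1 x + e (v x) * v2 x) - e (v x) * a (v x) * v1 x)
      ?_ ?_ ?_ ?_
    · rw [intervalIntegral.integral_add, intervalIntegral.integral_const_mul] at hmain
      · simp only [heM _ hα, heM _ hβ, hQ0 _ hα, hQ0 _ hβ] at hmain
        linarith
      · apply Continuous.intervalIntegrable; fun_prop
      · apply Continuous.intervalIntegrable; fun_prop
    · intro x
      have e1 : HasDerivAt (fun x => e (v x)) (j (v x) * v1 x) x := (he _).comp x (hv x)
      have e2 : HasDerivAt (fun x => Q (v x)) (e (v x) * a (v x) * v1 x) x :=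
        (prim_deriv hQc _).comp x (hv x)
      exact ((e1.mul (hv1 x)).const_mul μ).sub e2
    · fun_prop
    · fun_prop
    · intro x _; apply le_of_eq; ring
  · intro x hx
    set I := ∫ x in α..β, j (v x) * v1 x ^ 2 with hI
    set S := |e (v x)| with hS
    have hS0 : 0 ≤ S := abs_nonneg _
    have hb : ∀ τ : ℝ, 0 < τ → S ≤ τ / 2 * (β - α) + I / (2 * τ) := by
      intro τ hτ
      have hftc : ∫ y in α..x, j (v y) * v1 y = e (v x) := by
        rw [intervalIntegral.integral_eq_sub_of_hasDerivAt (f := fun x => e (v x))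
          (fun y _ => (he _).comp y (hv y)), heM _ hα, sub_zero]
        apply Continuous.intervalIntegrable; fun_prop
      rw [hS, ← hftc]
      calc |∫ y in α..x, j (v y) * v1 y| ≤ ∫ y in α..x, |j (v y) * v1 y| :=
            intervalIntegral.abs_integral_le_integral_abs hx.1
        _ ≤ ∫ y in α..x, (τ / 2 + 1 / (2 * τ) * (j (v y) * v1 y ^ 2)) := by
            apply intervalIntegral.integral_mono_on hx.1
            · apply Continuous.intervalIntegrable; fun_prop
            · apply Continuous.intervalIntegrable; fun_prop
            · intro y _
              have h0 := hj0 (v y); have h1 := hj1 (v y)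
              rw [abs_mul, abs_of_nonneg h0, ← sq_abs (v1 y)]
              have e1 : τ / 2 + 1 / (2 * τ) * (j (v y) * |v1 y| ^ 2) - j (v y) * |v1 y| =
                ((τ - j (v y) * |v1 y|) ^ 2 + (j (v y) - j (v y) ^ 2) * |v1 y| ^ 2) / (2 * τ) := by
                field_simp; ring
              have e2 : 0 ≤ ((τ - j (v y) * |v1 y|) ^ 2 + (j (v y) - j (v y) ^ 2) * |v1 y| ^ 2) / (2 * τ) := by
                have : 0 ≤ j (v y) - j (v y) ^ 2 := by nlinarith
                positivity
              linarith
        _ ≤ ∫ y in α..β, (τ / 2 + 1 / (2 * τ) * (j (v y) * v1 y ^ 2)) := by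
            apply intervalIntegral.integral_mono_interval le_rfl hx.1 hx.2
            · refine Eventually.of_forall fun y => ?_
              have h0 := hj0 (v y)
              simp only [Pi.zero_apply]; positivity
            · apply Continuous.intervalIntegrable; fun_prop
        _ = τ / 2 * (β - α) + I / (2 * τ) := by
            rw [intervalIntegral.integral_add (by simp)
              (by apply Continuous.intervalIntegrable; fun_prop),
              intervalIntegral.integral_const_mul, ← hI]
            simp; ring
    rw [← sq_abs, ← hS]
    rcases hS0.eq_or_lt with h | h
    · rw [← h]; simp; exact mul_nonneg (by linarith) hI0
    · have hl : 0 < β - α := by linarith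
      have := hb (S / (β - α)) (by positivity)
      have e1 : S / (β - α) / 2 * (β - α) = S / 2 := by field_simp
      have e2 : I / (2 * (S / (β - α))) = (β - α) * I / (2 * S) := by field_simp
      rw [e1, e2] at this
      have h3 : S / 2 ≤ (β - α) * I / (2 * S) := by linarith
      rw [le_div_iff₀ (by positivity)] at h3
      nlinarith

lemma lemCfix {q μ α β : ℝ} (hq : 1 < q) (hμ : 0 < μ) (hab : α ≤ β) {e j η v v1 v2 Ψ Ψ1 Ψ2 : ℝ → ℝ}
    (hη : ∀ x, HasDerivAt η (e x) x)
    (he : ∀ x, HasDerivAt e (j x) x) (hj : Continuous j) (hj0 : ∀ x, 0 ≤ j x)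
    (hv : ∀ x, HasDerivAt v (v1 x) x) (hv1 : ∀ x, HasDerivAt v1 (v2 x) x) (hv2c : Continuous v2)
    (hΨ : ∀ x, HasDerivAt Ψ (Ψ1 x) x) (hΨ1 : ∀ x, HasDerivAt Ψ1 (Ψ2 x) x) (hΨ2c : Continuous Ψ2)
    (hΨ0 : ∀ x, 0 ≤ Ψ x)
    (h1 : Ψ α = 0) (h2 : Ψ β = 0) (h3 : Ψ1 α = 0) (h4 : Ψ1 β = 0) :
    ∫ x in α..β, e (v x) * Ψ x * (μ * v2 x - |v x| ^ (q - 1) * v1 x)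
      ≤ ∫ x in α..β, (μ * (η (v x) * Ψ2 x) + prim (fun s => e s * |s| ^ (q - 1)) (v x) * Ψ1 x) := by
  have hp : 0 < q - 1 := by linarith
  have hvc : Continuous v := continuous_iff_continuousAt.2 fun x => (hv x).continuousAt
  have hv1c : Continuous v1 := continuous_iff_continuousAt.2 fun x => (hv1 x).continuousAt
  have hec : Continuous e := continuous_iff_continuousAt.2 fun x => (he x).continuousAt
  have hηc : Continuous η := continuous_iff_continuousAt.2 fun x => (hη x).continuousAt
  have hΨc : Continuous Ψ := continuous_iff_continuousAt.2 fun x => (hΨ x).continuousAt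
  have hΨ1c : Continuous Ψ1 := continuous_iff_continuousAt.2 fun x => (hΨ1 x).continuousAt
  have hac := absrpow_cont hp
  set a : ℝ → ℝ := fun v => |v| ^ (q - 1) with ha
  have hQc : Continuous fun s => e s * a s := hec.mul hac
  set Q := prim (fun s => e s * a s) with hQ
  have hQQ : Continuous Q := prim_cont hQc
  have hmain := ftc_le (α := α) (β := β) (c := 0) hab
      (f := fun x => e (v x) * Ψ x * (μ * v2 x - a (v x) * v1 x) - (μ * (η (v x) * Ψ2 x) + Q (v x) * Ψ1 x))
      (B := fun x => μ * (e (v x) * v1 x * Ψ x - η (v x) * Ψ1 x) - Q (v x) * Ψ x)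
      (B' := fun x => μ * (((j (v x) * v1 x * v1 x + e (v x) * v2 x) * Ψ x + e (v x) * v1 x * Ψ1 x)
         - (e (v x) * v1 x * Ψ1 x + η (v x) * Ψ2 x)) - (e (v x) * a (v x) * v1 x * Ψ x + Q (v x) * Ψ1 x))
      ?_ ?_ ?_ ?_
  · rw [intervalIntegral.integral_sub] at hmain
    · simp only [h1, h2, h3, h4] at hmain
      linarith
    · apply Continuous.intervalIntegrable; fun_prop
    · apply Continuous.intervalIntegrable; fun_prop
  · intro x
    have e1 : HasDerivAt (fun x => e (v x)) (j (v x) * v1 x) x := (he _).comp x (hv x)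
    have e3 : HasDerivAt (fun x => η (v x)) (e (v x) * v1 x) x := (hη _).comp x (hv x)
    have e2 : HasDerivAt (fun x => Q (v x)) (e (v x) * a (v x) * v1 x) x :=
        (prim_deriv hQc _).comp x (hv x)
    exact ((((e1.mul (hv1 x)).mul (hΨ x)).sub (e3.mul (hΨ1 x))).const_mul μ).sub (e2.mul (hΨ x))
  · fun_prop
  · fun_prop
  · intro x _
    have : 0 ≤ μ * (j (v x) * v1 x ^ 2 * Ψ x) :=
      mul_nonneg hμ.le (mul_nonneg (mul_nonneg (hj0 _) (sq_nonneg _)) (hΨ0 x))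
    nlinarith

/-- abstract regularized solution with source `g` -/
structure Sol (q μ : ℝ) (u g : ℝ → ℝ → ℝ) : Prop where
  int : ∀ t, 0 < t → Integrable (u t)
  l1 : ∀ t₀, 0 < t₀ → Tendsto (fun t => ∫ x, |u t x - u t₀ x|) (𝓝 t₀) (𝓝 0)
  c2 : ∀ t, 0 < t → ContDiff ℝ 2 (u t)
  c1 : ∀ x, ContDiffOn ℝ 1 (fun s => u s x) (Set.Ioi 0)
  pde : ∀ t, 0 < t → ∀ x, deriv (fun s => u s x) t =
    (μ * deriv (deriv (u t)) x - |u t x| ^ (q - 1) * deriv (u t) x) + g t x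
  gi : ∀ t, 0 < t → Integrable (g t)
  gb : ∀ s t, 0 < s → ∃ C, 0 ≤ C ∧ ∀ r ∈ Set.Icc s t, ∫ x, |g r x| ≤ C

structure Adm (u h : ℝ → ℝ → ℝ) (L : ℝ) : Prop where
  L0 : 0 ≤ L
  c1 : ∀ x, ContDiffOn ℝ 1 (fun r => h r x) (Set.Ioi 0)
  co : ∀ r, 0 < r → Continuous (h r)
  lip : ∀ r, 0 < r → ∀ r', 0 < r' → ∀ x, |h r x - h r' x| ≤ L * (|r - r'| + |u r x - u r' x|)

/-- the claim on a time interval -/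
def Cl (u : ℝ → ℝ → ℝ) (α β s t : ℝ) : Prop :=
  ∀ h L, Adm u h L → ∀ G : ℝ → ℝ, IntegrableOn G (Set.Icc s t) →
    (∀ r ∈ Set.Icc s t, ∫ x in Set.Icc α β, deriv (fun r => h r x) r ≤ G r) →
    (∫ x in Set.Icc α β, h t x) - ∫ x in Set.Icc α β, h s x ≤ ∫ r in s..t, G r

lemma c1_hasDeriv {f : ℝ → ℝ} (hf : ContDiffOn ℝ 1 f (Set.Ioi 0)) {r : ℝ} (hr : 0 < r) :
    HasDerivAt f (deriv f r) r :=
  ((hf.differentiableOn (by norm_num)).differentiableAt (Ioi_mem_nhds hr)).hasDerivAt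

lemma c1_contDeriv {f : ℝ → ℝ} (hf : ContDiffOn ℝ 1 f (Set.Ioi 0)) :
    ContinuousOn (deriv f) (Set.Ioi 0) :=
  hf.continuousOn_deriv_of_isOpen isOpen_Ioi le_rfl

lemma Sol.neg {q μ : ℝ} {u g : ℝ → ℝ → ℝ} (h : Sol q μ u g) :
    Sol q μ (fun t x => - u t x) (fun t x => - g t x) where
  int := fun t ht => (h.int t ht).neg
  l1 := fun t ht => by
    have := h.l1 t ht
    refine this.congr fun s => ?_
    congr 1; ext x; rw [← abs_neg]; congr 1; ring
  c2 := fun t ht => (h.c2 t ht).neg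
  c1 := fun x => (h.c1 x).neg
  pde := fun t ht x => by
    have e1 : deriv (fun s => - u s x) t = - deriv (fun s => u s x) t := deriv.fun_neg
    have e2 : deriv (fun x => - u t x) = fun x => - deriv (u t) x := by ext y; exact deriv.fun_neg
    have e3 : deriv (deriv (fun x => - u t x)) x = - deriv (deriv (u t)) x := by
      rw [e2]; exact deriv.fun_neg
    rw [e1, e3, e2, h.pde t ht x, abs_neg]; ring
  gi := fun t ht => (h.gi t ht).neg
  gb := fun s t hs => by
    obtain ⟨C, hC, h1⟩ := h.gb s t hs
    exact ⟨C, hC, fun r hr => by simpa using h1 r hr⟩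

lemma Adm.neg_iff {u h : ℝ → ℝ → ℝ} {L : ℝ} (a : Adm (fun t x => - u t x) h L) : Adm u h L where
  L0 := a.L0
  c1 := a.c1
  co := a.co
  lip := fun r hr r' hr' x => by
    have := a.lip r hr r' hr' x
    rwa [show - u r x - - u r' x = -(u r x - u r' x) by ring, abs_neg] at this

lemma Cl.neg {u : ℝ → ℝ → ℝ} {α β s t : ℝ} (h : Cl u α β s t) : Cl (fun t x => - u t x) α β s t :=
  fun h' L a => h h' L a.neg_iff

lemma prim_contOn {G : ℝ → ℝ} {a b : ℝ} (h : a ≤ b) (hG : IntegrableOn G (Set.Icc a b)) :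
    ContinuousOn (fun r => ∫ τ in a..r, G τ) (Set.Icc a b) := by
  rw [← Set.uIcc_of_le h] at hG ⊢
  exact intervalIntegral.continuousOn_primitive_interval hG

section
variable {q μ : ℝ} {u g : ℝ → ℝ → ℝ} {α β : ℝ}

lemma Sol.cont (S : Sol q μ u g) {t : ℝ} (ht : 0 < t) : Continuous (u t) := (S.c2 t ht).continuous

lemma Adm.intOn {h : ℝ → ℝ → ℝ} {L : ℝ} (A : Adm u h L) {r : ℝ} (hr : 0 < r) :
    IntegrableOn (h r) (Set.Icc α β) := (A.co r hr).integrableOn_Icc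

lemma Adm.l1diff (S : Sol q μ u g) {h : ℝ → ℝ → ℝ} {L : ℝ} (A : Adm u h L) (hab : α ≤ β)
    {r r' : ℝ} (hr : 0 < r) (hr' : 0 < r') :
    ∫ x in Set.Icc α β, |h r x - h r' x| ≤
      L * (|r - r'| * (β - α) + ∫ x in Set.Icc α β, |u r x - u r' x|) := by
  have c1 : Continuous fun x => |u r x - u r' x| := ((S.cont hr).sub (S.cont hr')).abs
  calc ∫ x in Set.Icc α β, |h r x - h r' x|
      ≤ ∫ x in Set.Icc α β, L * (|r - r'| + |u r x - u r' x|) := by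
        apply setIntegral_mono
        · exact (((A.co r hr).sub (A.co r' hr')).abs).integrableOn_Icc
        · exact (continuous_const.mul (continuous_const.add c1)).integrableOn_Icc
        · intro x; exact A.lip r hr r' hr' x
    _ = _ := by
        rw [integral_const_mul, integral_add (continuous_const.integrableOn_Icc) c1.integrableOn_Icc]
        simp [hab, mul_comm]

lemma Adm.phidiff (S : Sol q μ u g) {h : ℝ → ℝ → ℝ} {L : ℝ} (A : Adm u h L) (hab : α ≤ β)
    {r r' : ℝ} (hr : 0 < r) (hr' : 0 < r') :
    |(∫ x in Set.Icc α β, h r x) - ∫ x in Set.Icc α β, h r' x| ≤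
      L * (|r - r'| * (β - α) + ∫ x in Set.Icc α β, |u r x - u r' x|) := by
  rw [← integral_sub (A.intOn hr) (A.intOn hr')]
  exact abs_integral_le_integral_abs.trans (A.l1diff S hab hr hr')

lemma Adm.phicont (S : Sol q μ u g) {h : ℝ → ℝ → ℝ} {L : ℝ} (A : Adm u h L) (hab : α ≤ β)
    {r : ℝ} (hr : 0 < r) : ContinuousAt (fun r => ∫ x in Set.Icc α β, h r x) r := by
  unfold ContinuousAt
  rw [tendsto_iff_norm_sub_tendsto_zero]
  have lim : Tendsto (fun r' => L * (|r' - r| * (β - α) + ∫ x, |u r' x - u r x|)) (𝓝 r) (𝓝 0) := by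
    have h1 : Tendsto (fun r' => |r' - r| * (β - α)) (𝓝 r) (𝓝 0) := by
      have : Continuous (fun r' => |r' - r| * (β - α)) := by fun_prop
      simpa using this.tendsto r
    simpa using (h1.add (S.l1 r hr)).const_mul L
  refine squeeze_zero' (Eventually.of_forall fun _ => norm_nonneg _) ?_ lim
  filter_upwards [Ioi_mem_nhds hr] with r' hr'
  refine (A.phidiff S hab hr' hr).trans ?_
  have := A.L0
  have h3 : ∫ x in Set.Icc α β, |u r' x - u r x| ≤ ∫ x, |u r' x - u r x| :=
    setIntegral_le_integral ((S.int r' hr').sub (S.int r hr)).abs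
    (Eventually.of_forall fun _ => abs_nonneg _)
  gcongr

lemma Cl.trans {s m t : ℝ} (hsm : s ≤ m) (hmt : m ≤ t) (h1 : Cl u α β s m) (h2 : Cl u α β m t) :
    Cl u α β s t := by
  intro h L A G hG hD
  have i1 : IntegrableOn G (Set.Icc s m) := hG.mono_set (Set.Icc_subset_Icc le_rfl hmt)
  have i2 : IntegrableOn G (Set.Icc m t) := hG.mono_set (Set.Icc_subset_Icc hsm le_rfl)
  have a1 := h1 h L A G i1 (fun r hr => hD r ⟨hr.1, hr.2.trans hmt⟩)
  have a2 := h2 h L A G i2 (fun r hr => hD r ⟨hsm.trans hr.1, hr.2⟩)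
  have : (∫ r in s..t, G r) = (∫ r in s..m, G r) + ∫ r in m..t, G r := by
    rw [intervalIntegral.integral_add_adjacent_intervals]
    · rw [intervalIntegrable_iff_integrableOn_Icc_of_le hsm]; exact i1
    · rw [intervalIntegrable_iff_integrableOn_Icc_of_le hmt]; exact i2
  linarith

lemma Cl.refl (s : ℝ) : Cl u α β s s := by
  intro h L A G hG hD; simp

def Good (u : ℝ → ℝ → ℝ) (α β t : ℝ) : Prop :=
  ∃ δ > 0, ∀ s' t', 0 < s' → t - δ < s' → s' ≤ t' → t' < t + δ → Cl u α β s' t'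

lemma cl_of_good_aux (S : Sol q μ u g) (hab : α ≤ β) {a b : ℝ} (ha : 0 < a) (hlt : a ≤ b)
    (hg : ∀ r ∈ Set.Ico a b, Good u α β r) : Cl u α β a b := by
  intro h L A G hG hD
  set Φ := fun r => ∫ x in Set.Icc α β, h r x with hΦ
  set H := fun r => Φ r - ∫ τ in a..r, G τ with hH
  have hHc : ContinuousOn H (Set.Icc a b) := by
    apply ContinuousOn.sub
    · intro r hr; exact (A.phicont S hab (ha.trans_le hr.1)).continuousWithinAt
    · exact prim_contOn hlt hG
  have key : Set.Icc a b ⊆ {r | H r ≤ H a} := by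
    apply IsClosed.Icc_subset_of_forall_exists_gt
    · have := hHc.preimage_isClosed_of_isClosed isClosed_Icc (isClosed_Iic (a := H a))
      rwa [Set.inter_comm] at this
    · simp
    · rintro r ⟨hr1, hr2⟩ y hy
      obtain ⟨δ, hδ, hgood⟩ := hg r hr2
      set r' := min (min y b) (r + δ / 2) with hr'
      have h1 : r < r' := by
        rw [hr', lt_min_iff, lt_min_iff]; exact ⟨⟨hy, hr2.2⟩, by linarith⟩
      have h2 : r' ≤ y := (min_le_left _ _).trans (min_le_left _ _)
      have h3 : r' ≤ b := (min_le_left _ _).trans (min_le_right _ _)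
      have h4 : r' ≤ r + δ / 2 := min_le_right _ _
      refine ⟨r', ?_, h1, h2⟩
      have hc := hgood r r' (ha.trans_le hr2.1) (by linarith) h1.le (by linarith) h L A G
        (hG.mono_set (Set.Icc_subset_Icc hr2.1 h3))
        (fun τ hτ => hD τ ⟨hr2.1.trans hτ.1, hτ.2.trans h3⟩)
      have : (∫ τ in a..r', G τ) = (∫ τ in a..r, G τ) + ∫ τ in r..r', G τ := by
        rw [intervalIntegral.integral_add_adjacent_intervals]
        · rw [intervalIntegrable_iff_integrableOn_Icc_of_le hr2.1]
          exact hG.mono_set (Set.Icc_subset_Icc le_rfl hr2.2.le)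
        · rw [intervalIntegrable_iff_integrableOn_Icc_of_le h1.le]
          exact hG.mono_set (Set.Icc_subset_Icc hr2.1 h3)
      simp only [Set.mem_ofPred_eq, hH] at hr1 ⊢
      rw [this]
      simp only [hΦ] at hr1 ⊢
      linarith
  have := key (Set.right_mem_Icc.2 hlt)
  simp only [Set.mem_ofPred_eq, hH, intervalIntegral.integral_same, hΦ] at this
  linarith

lemma cl_of_good (S : Sol q μ u g) (hab : α ≤ β) {a b : ℝ} (ha : 0 < a) (hlt : a ≤ b)
    (hg : ∀ r ∈ Set.Ioo a b, Good u α β r) : Cl u α β a b := by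
  rcases hlt.eq_or_lt with rfl | hlt
  · exact Cl.refl _
  intro h L A G hG hD
  set Φ := fun r => ∫ x in Set.Icc α β, h r x with hΦ
  have hle : ∀ s ∈ Set.Ioc a b, Φ b - Φ s ≤ (∫ r in a..b, G r) - ∫ r in a..s, G r := by
    intro s hs
    have := cl_of_good_aux S hab (ha.trans hs.1) hs.2 (fun r hr => hg r ⟨hs.1.trans_le hr.1, hr.2⟩)
      h L A G (hG.mono_set (Set.Icc_subset_Icc hs.1.le le_rfl))
        (fun τ hτ => hD τ ⟨hs.1.le.trans hτ.1, hτ.2⟩)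
    have e : (∫ τ in a..b, G τ) = (∫ τ in a..s, G τ) + ∫ τ in s..b, G τ := by
      rw [intervalIntegral.integral_add_adjacent_intervals]
      · rw [intervalIntegrable_iff_integrableOn_Icc_of_le hs.1.le]
        exact hG.mono_set (Set.Icc_subset_Icc le_rfl hs.2)
      · rw [intervalIntegrable_iff_integrableOn_Icc_of_le hs.2]
        exact hG.mono_set (Set.Icc_subset_Icc hs.1.le le_rfl)
    rw [e]; simp only [hΦ]; linarith
  have hsub : 𝓝[Set.Ioc a b] a = 𝓝[>] a := nhdsWithin_Ioc_eq_nhdsGT hlt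
  have t1 : Tendsto (fun s => Φ b - Φ s) (𝓝[Set.Ioc a b] a) (𝓝 (Φ b - Φ a)) :=
    tendsto_const_nhds.sub ((A.phicont S hab ha).tendsto.mono_left nhdsWithin_le_nhds)
  have t2 : Tendsto (fun s => (∫ r in a..b, G r) - ∫ r in a..s, G r) (𝓝[Set.Ioc a b] a)
      (𝓝 ((∫ r in a..b, G r) - ∫ r in a..a, G r)) := by
    refine tendsto_const_nhds.sub ?_
    have := prim_contOn hlt.le hG a (Set.left_mem_Icc.2 hlt.le)
    exact this.tendsto.mono_left (nhdsWithin_mono _ Set.Ioc_subset_Icc_self)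
  have : NeBot (𝓝[Set.Ioc a b] a) := by rw [hsub]; infer_instance
  have := le_of_tendsto_of_tendsto t1 t2 (by filter_upwards [self_mem_nhdsWithin] with s hs using hle s hs)
  simpa [hΦ] using this
end

section
variable {q μ : ℝ} {u g : ℝ → ℝ → ℝ} {α β : ℝ}

lemma Sol.d1 (S : Sol q μ u g) {t : ℝ} (ht : 0 < t) (x : ℝ) : HasDerivAt (u t) (deriv (u t) x) x :=
  ((S.c2 t ht).differentiable (by norm_num) x).hasDerivAt

lemma Sol.c1' (S : Sol q μ u g) {t : ℝ} (ht : 0 < t) : ContDiff ℝ 1 (deriv (u t)) :=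
  (((contDiff_succ_iff_deriv (n := 1)).1 (S.c2 t ht)).2.2)

lemma Sol.d2 (S : Sol q μ u g) {t : ℝ} (ht : 0 < t) (x : ℝ) :
    HasDerivAt (deriv (u t)) (deriv (deriv (u t)) x) x :=
  ((S.c1' ht).differentiable (by norm_num) x).hasDerivAt

lemma Sol.d2c (S : Sol q μ u g) {t : ℝ} (ht : 0 < t) : Continuous (deriv (deriv (u t))) :=
  (S.c1' ht).continuous_deriv le_rfl

lemma Sol.dt (S : Sol q μ u g) {t : ℝ} (ht : 0 < t) (x : ℝ) :
    HasDerivAt (fun r => u r x) (deriv (fun r => u r x) t) t := c1_hasDeriv (S.c1 x) ht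

lemma Sol.rhsc (S : Sol q μ u g) (hq : 1 < q) {t : ℝ} (ht : 0 < t) :
    Continuous fun x => μ * deriv (deriv (u t)) x - |u t x| ^ (q - 1) * deriv (u t) x := by
  have h1 := S.d2c ht
  have h2 := (S.c1' ht).continuous
  have h3 := S.cont ht
  have h4 := (absrpow_cont (p := q - 1) (by linarith)).comp h3
  exact (continuous_const.mul h1).sub (h4.mul h2)

lemma Sol.utint (S : Sol q μ u g) (hq : 1 < q) {t : ℝ} (ht : 0 < t) :
    IntegrableOn (fun x => deriv (fun r => u r x) t) (Set.Icc α β) := by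
  have : (fun x => deriv (fun r => u r x) t) = fun x =>
    (μ * deriv (deriv (u t)) x - |u t x| ^ (q - 1) * deriv (u t) x) + g t x := by
    ext x; exact S.pde t ht x
  rw [this]
  exact (S.rhsc hq ht).integrableOn_Icc.add (S.gi t ht).integrableOn

lemma Sol.timeLip (S : Sol q μ u g) {τ0 τ1 : ℝ} (h0 : 0 < τ0) (x : ℝ) :
    ∃ Λ : ℝ, 0 ≤ Λ ∧ ∀ r ∈ Set.Icc τ0 τ1, ∀ r' ∈ Set.Icc τ0 τ1,
      |u r x - u r' x| ≤ Λ * |r - r'| := by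
  have hsub : Set.Icc τ0 τ1 ⊆ Set.Ioi 0 := fun r hr => h0.trans_le hr.1
  obtain ⟨C, hC⟩ := isCompact_Icc.exists_bound_of_continuousOn ((c1_contDeriv (S.c1 x)).mono hsub)
  refine ⟨max C 0, le_max_right _ _, fun r hr r' hr' => ?_⟩
  have := Convex.norm_image_sub_le_of_norm_deriv_le (f := fun r => u r x) (C := max C 0)
    (s := Set.Icc τ0 τ1) (x := r') (y := r)
    (fun y hy => (S.dt (hsub hy) x).differentiableAt)
    (fun y hy => (hC y hy).trans (le_max_left _ _)) (convex_Icc _ _) hr' hr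
  simpa using this

lemma int_Icc_eq (hab : α ≤ β) (f : ℝ → ℝ) : ∫ x in Set.Icc α β, f x = ∫ x in α..β, f x := by
  rw [integral_Icc_eq_integral_Ioc, intervalIntegral.integral_of_le hab]

lemma gap_half (S : Sol q μ u g) (hq : 1 < q) (hμ : 0 < μ) (hab : α ≤ β) {τ0 τ1 n : ℝ}
    (h0 : 0 < τ0) (hn : 0 ≤ n) :
    ∃ C : ℝ, 0 ≤ C ∧ ∀ a b, τ0 ≤ a → a ≤ b → b ≤ τ1 →
      (∀ x ∈ Set.Icc α β, |u a x| ≤ n ∧ |deriv (u a) x| ≤ n ∧ |deriv (deriv (u a)) x| ≤ n) →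
      Cl u α β a b → ∫ x in Set.Icc α β, max (u b x - u a x) 0 ≤ C * (b - a) := by
  obtain ⟨Λ1, hΛ1, hl1⟩ := S.timeLip (τ1 := τ1) h0 α
  obtain ⟨Λ2, hΛ2, hl2⟩ := S.timeLip (τ1 := τ1) h0 β
  set Λ := Λ1 + Λ2 with hΛ
  have hΛ0 : 0 ≤ Λ := by positivity
  obtain ⟨Cg, hCg, hg⟩ := S.gb τ0 τ1 h0
  obtain ⟨CG, hCG, hG⟩ := lemG (q := q) (μ := μ) (n := n) (Γ := Λ * |τ1 - τ0|) hq hμ hn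
    (by positivity) hab
  have hba : 0 ≤ β - α := by linarith
  refine ⟨CG + Cg + Λ * (β - α), by positivity, ?_⟩
  intro a b ha hlt hb hw hcl
  have ha0 : 0 < a := h0.trans_le ha
  have hb0 : 0 < b := ha0.trans_le hlt
  have step : ∀ δ ∈ Set.Ioc (0:ℝ) 1, ∫ x in Set.Icc α β, max (u b x - u a x) 0 ≤
      (CG + Cg + Λ * (β - α)) * (b - a) + δ * (β - α) := by
    intro δ hδ
    have hδ0 := hδ.1
    set h : ℝ → ℝ → ℝ := fun r x => δ * HH ((u r x - u a x - Λ * (r - a)) / δ) with hh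
    have hderiv : ∀ r, 0 < r → ∀ x, HasDerivAt (fun r => h r x)
        (pp ((u r x - u a x - Λ * (r - a)) / δ) * (deriv (fun r => u r x) r - Λ)) r := by
      intro r hr x
      have e1 : HasDerivAt (fun r => (u r x - u a x - Λ * (r - a)) / δ)
          ((deriv (fun r => u r x) r - Λ * 1) / δ) r :=
        (((S.dt hr x).sub_const _).sub (((hasDerivAt_id r).sub_const a).const_mul Λ)).div_const δ
      have e2 := ((HH_deriv _).comp r e1).const_mul δ
      refine e2.congr_deriv ?_
      field_simp
    have hA : Adm u h (1 + Λ) := by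
      refine ⟨by positivity, fun x => ?_, fun r hr => ?_, fun r hr r' hr' x => ?_⟩
      · rw [show (1 : WithTop ℕ∞) = 0 + 1 by norm_num, contDiffOn_succ_iff_deriv_of_isOpen isOpen_Ioi]
        refine ⟨fun r hr => (hderiv r hr x).differentiableAt.differentiableWithinAt, by simp, ?_⟩
        rw [contDiffOn_zero]
        have hu : ContinuousOn (fun r => u r x) (Set.Ioi 0) := (S.c1 x).continuousOn
        have hu' := c1_contDeriv (S.c1 x)
        have : ContinuousOn (fun r => pp ((u r x - u a x - Λ * (r - a)) / δ) * (deriv (fun r => u r x) r - Λ))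
            (Set.Ioi 0) := by
          refine ContinuousOn.mul (pp_cont.comp_continuousOn ?_) (hu'.sub continuousOn_const)
          exact ((hu.sub continuousOn_const).sub (by fun_prop)).div_const δ
        exact this.congr fun r hr => (hderiv r hr x).deriv
      · have h1 := S.cont hr
        have h2 := S.cont ha0
        have h3 := HH_cont
        simp only [hh]; fun_prop
      · simp only [hh]
        rw [← mul_sub, abs_mul, abs_of_pos hδ0]
        calc δ * |HH ((u r x - u a x - Λ * (r - a)) / δ) - HH ((u r' x - u a x - Λ * (r' - a)) / δ)|
            ≤ δ * |(u r x - u a x - Λ * (r - a)) / δ - (u r' x - u a x - Λ * (r' - a)) / δ| := by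
              exact mul_le_mul_of_nonneg_left (HH_lip _ _) hδ0.le
          _ = |(u r x - u r' x) - Λ * (r - r')| := by
              rw [← abs_of_pos hδ0, ← abs_mul, abs_of_pos hδ0]; congr 1; field_simp; ring
          _ ≤ |u r x - u r' x| + |Λ * (r - r')| := abs_sub _ _
          _ = |u r x - u r' x| + Λ * |r - r'| := by rw [abs_mul, abs_of_nonneg hΛ0]
          _ ≤ _ := by nlinarith [abs_nonneg (u r x - u r' x), abs_nonneg (r - r')]
    have hD : ∀ r ∈ Set.Icc a b, ∫ x in Set.Icc α β, deriv (fun r => h r x) r ≤ CG + Cg := by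
      intro r hr
      have hr0 : 0 < r := ha0.trans_le hr.1
      have hrI : r ∈ Set.Icc τ0 τ1 := ⟨ha.trans hr.1, hr.2.trans hb⟩
      have haI : a ∈ Set.Icc τ0 τ1 := ⟨ha, hlt.trans hb⟩
      have hppc : Continuous fun x => pp ((u r x - u a x - Λ * (r - a)) / δ) := by
        have h1 := S.cont hr0
        have h2 := S.cont ha0
        have h3 := pp_cont
        fun_prop
      have hRc := S.rhsc hq hr0
      calc ∫ x in Set.Icc α β, deriv (fun r => h r x) r
          = ∫ x in Set.Icc α β, pp ((u r x - u a x - Λ * (r - a)) / δ) * (deriv (fun r => u r x) r - Λ) := by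
            congr 1; ext x; exact (hderiv r hr0 x).deriv
        _ ≤ ∫ x in Set.Icc α β, (pp ((u r x - u a x - Λ * (r - a)) / δ) *
              (μ * deriv (deriv (u r)) x - |u r x| ^ (q - 1) * deriv (u r) x) + |g r x|) := by
            apply setIntegral_mono
            · exact IntegrableOn.continuousOn_mul hppc.continuousOn
                ((S.utint hq hr0).sub (continuous_const.integrableOn_Icc)) isCompact_Icc
            · exact (hppc.mul hRc).integrableOn_Icc.add (S.gi r hr0).abs.integrableOn
            · intro x
              simp only
              rw [S.pde r hr0 x]
              have p0 := pp_nonneg ((u r x - u a x - Λ * (r - a)) / δ)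
              have p1 := pp_le_one ((u r x - u a x - Λ * (r - a)) / δ)
              have i1 : pp ((u r x - u a x - Λ * (r - a)) / δ) * g r x ≤ |g r x| := by
                refine (le_abs_self _).trans ?_
                rw [abs_mul, abs_of_nonneg p0]
                exact mul_le_of_le_one_left (abs_nonneg _) p1
              nlinarith [mul_nonneg p0 hΛ0]
        _ = (∫ x in Set.Icc α β, (pp ((u r x - u a x - Λ * (r - a)) / δ) *
              (μ * deriv (deriv (u r)) x - |u r x| ^ (q - 1) * deriv (u r) x)))
              + ∫ x in Set.Icc α β, |g r x| :=
            integral_add (hppc.mul hRc).integrableOn_Icc (S.gi r hr0).abs.integrableOn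
        _ ≤ CG + Cg := by
            apply add_le_add
            · rw [int_Icc_eq hab]
              apply hG (u r) (deriv (u r)) (deriv (deriv (u r))) (u a) (deriv (u a))
                (deriv (deriv (u a))) (S.d1 hr0) (S.d2 hr0) (S.d2c hr0) (S.d1 ha0) (S.d2 ha0)
                (S.d2c ha0) hw _ _ δ hδ
              · have := hl1 r hrI a haI
                rw [abs_of_nonneg (by linarith [hr.1] : 0 ≤ r - a)] at this
                nlinarith [le_abs_self (u r α - u a α), hr.1]
              · have := hl2 r hrI a haI
                rw [abs_of_nonneg (by linarith [hr.1] : 0 ≤ r - a)] at this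
                nlinarith [le_abs_self (u r β - u a β), hr.1]
              · constructor
                · exact mul_nonneg hΛ0 (by linarith [hr.1])
                · apply mul_le_mul_of_nonneg_left _ hΛ0
                  exact le_trans (by linarith [hrI.2]) (le_abs_self (τ1 - τ0))
            · exact (setIntegral_le_integral (S.gi r hr0).abs
                (Eventually.of_forall fun _ => abs_nonneg _)).trans (hg r hrI)
    have hfin := hcl h (1 + Λ) hA (fun _ => CG + Cg) (continuous_const.integrableOn_Icc) hD
    have ha' : ∫ x in Set.Icc α β, h a x = 0 := by
      simp [hh, HH_zero]
    rw [ha', intervalIntegral.integral_const, smul_eq_mul, sub_zero] at hfin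
    have hZ : ∫ x in Set.Icc α β, max (u b x - u a x) 0 ≤
        ∫ x in Set.Icc α β, (h b x + (δ + Λ * (b - a))) := by
      apply setIntegral_mono
      · exact (((S.cont hb0).sub (S.cont ha0)).max continuous_const).integrableOn_Icc
      · exact (hA.intOn hb0).add continuous_const.integrableOn_Icc
      · intro x
        have hp1 := HH_ge ((u b x - u a x - Λ * (b - a)) / δ)
        have hp0 := HH_nonneg ((u b x - u a x - Λ * (b - a)) / δ)
        have hL : 0 ≤ Λ * (b - a) := mul_nonneg hΛ0 (by linarith)
        simp only [hh]
        have i1 : u b x - u a x - Λ * (b - a) - δ ≤ δ * HH ((u b x - u a x - Λ * (b - a)) / δ) := by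
          have := mul_le_mul_of_nonneg_left hp1 hδ0.le
          rw [mul_sub, mul_div_cancel₀ _ hδ0.ne', mul_one] at this
          exact this
        apply max_le
        · linarith
        · positivity
    have e : ∫ x in Set.Icc α β, (h b x + (δ + Λ * (b - a))) =
        (∫ x in Set.Icc α β, h b x) + (δ + Λ * (b - a)) * (β - α) := by
      rw [integral_add (hA.intOn hb0) continuous_const.integrableOn_Icc]
      simp [hab, mul_comm]
    rw [e] at hZ
    nlinarith
  apply _root_.le_of_forall_pos_le_add
  intro ε hε
  set δ := min 1 (ε / (β - α + 1)) with hδ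
  have h2 : δ ≤ ε / (β - α + 1) := min_le_right _ _
  have h1 := step δ ⟨by positivity, min_le_left _ _⟩
  have h3 : δ * (β - α + 1) ≤ ε := by rwa [le_div_iff₀ (by positivity)] at h2
  have h4 : 0 < δ := by positivity
  nlinarith

lemma gap_est (S : Sol q μ u g) (hq : 1 < q) (hμ : 0 < μ) (hab : α ≤ β) {τ0 τ1 n : ℝ}
    (h0 : 0 < τ0) (hn : 0 ≤ n) :
    ∃ C : ℝ, 0 ≤ C ∧ ∀ a b, τ0 ≤ a → a ≤ b → b ≤ τ1 →
      (∀ x ∈ Set.Icc α β, |u a x| ≤ n ∧ |deriv (u a) x| ≤ n ∧ |deriv (deriv (u a)) x| ≤ n) →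
      Cl u α β a b → ∫ x in Set.Icc α β, |u b x - u a x| ≤ C * (b - a) := by
  obtain ⟨C1, hC1, h1⟩ := gap_half S hq hμ hab (τ1 := τ1) h0 hn
  obtain ⟨C2, hC2, h2⟩ := gap_half S.neg hq hμ hab (τ1 := τ1) h0 hn
  refine ⟨C1 + C2, by positivity, fun a b ha hlt hb hw hcl => ?_⟩
  have ha0 : 0 < a := h0.trans_le ha
  have hb0 : 0 < b := ha0.trans_le hlt
  have i1 := h1 a b ha hlt hb hw hcl
  have i2 := h2 a b ha hlt hb (fun x hx => by
    have e2 : deriv (fun x => - u a x) = fun x => - deriv (u a) x := by ext y; exact deriv.fun_neg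
    have e3 : deriv (deriv (fun x => - u a x)) x = - deriv (deriv (u a)) x := by
      rw [e2]; exact deriv.fun_neg
    rw [e3, e2, abs_neg, abs_neg, abs_neg]; exact hw x hx) hcl.neg
  have e : (fun x => |u b x - u a x|) = fun x =>
      max (u b x - u a x) 0 + max (- u b x - - u a x) 0 := by
    ext x
    rw [show - u b x - - u a x = -(u b x - u a x) by ring]
    rcases le_total 0 (u b x - u a x) with h | h
    · rw [abs_of_nonneg h, max_eq_left h, max_eq_right (by linarith)]; ring
    · rw [abs_of_nonpos h, max_eq_right h, max_eq_left (by linarith)]; ring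
  rw [e, integral_add]
  · linarith
  · exact (((S.cont hb0).sub (S.cont ha0)).max continuous_const).integrableOn_Icc
  · exact (((S.cont hb0).neg.sub (S.cont ha0).neg).max continuous_const).integrableOn_Icc
end

/-- gaps of a closed set -/
def gaps (K : Set ℝ) : Set (ℝ × ℝ) :=
  {p | p.1 ∈ K ∧ p.2 ∈ K ∧ p.1 < p.2 ∧ ∀ z ∈ Set.Ioo p.1 p.2, z ∉ K}

lemma gaps_disj (K : Set ℝ) : (gaps K).PairwiseDisjoint (fun p => Set.Ioo p.1 p.2) := by
  rintro ⟨a, b⟩ ⟨ha, hb, hab, h⟩ ⟨a', b'⟩ ⟨ha', hb', hab', h'⟩ hne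
  rw [Function.onFun, Set.disjoint_left]
  rintro z ⟨h1, h2⟩ ⟨h3, h4⟩
  simp only at *
  apply hne
  have e1 : a = a' := by
    rcases lt_trichotomy a a' with hh | hh | hh
    · exact absurd ha' (h a' ⟨hh, h3.trans h2⟩)
    · exact hh
    · exact absurd ha (h' a ⟨hh, h1.trans h4⟩)
  have e2 : b = b' := by
    rcases lt_trichotomy b b' with hh | hh | hh
    · exact absurd hb (h' b ⟨h3.trans h2, hh⟩)
    · exact hh
    · exact absurd hb' (h b' ⟨h1.trans h4, hh⟩)
  rw [e1, e2]

lemma gaps_countable (K : Set ℝ) : (gaps K).Countable :=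
  (gaps_disj K).countable_of_isOpen (fun _ _ => isOpen_Ioo)
    (fun _ hp => Set.nonempty_Ioo.2 hp.2.2.1)

lemma gaps_union {K : Set ℝ} (hK : IsClosed K) {s t : ℝ} (hsub : K ⊆ Set.Icc s t) (hs : s ∈ K)
    (ht : t ∈ K) : (⋃ p : gaps K, Set.Ioo p.1.1 p.1.2) = Set.Icc s t \ K := by
  ext z
  simp only [Set.mem_iUnion, Set.mem_sdiff]
  constructor
  · rintro ⟨⟨⟨a, b⟩, hp⟩, hz⟩
    exact ⟨⟨(hsub hp.1).1.trans hz.1.le, hz.2.le.trans (hsub hp.2.1).2⟩, hp.2.2.2 z hz⟩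
  · rintro ⟨hz, hzK⟩
    have c1 : IsClosed (K ∩ Set.Iic z) := hK.inter isClosed_Iic
    have c2 : IsClosed (K ∩ Set.Ici z) := hK.inter isClosed_Ici
    have b1 : BddAbove (K ∩ Set.Iic z) := ⟨z, fun y hy => hy.2⟩
    have b2 : BddBelow (K ∩ Set.Ici z) := ⟨z, fun y hy => hy.2⟩
    have ha := c1.csSup_mem ⟨s, hs, hz.1⟩ b1
    have hb := c2.csInf_mem ⟨t, ht, hz.2⟩ b2
    set a := sSup (K ∩ Set.Iic z)
    set b := sInf (K ∩ Set.Ici z)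
    have h1 : a < z := lt_of_le_of_ne ha.2 (fun h => hzK (h ▸ ha.1))
    have h2 : z < b := lt_of_le_of_ne hb.2 (fun h => hzK (h ▸ hb.1))
    refine ⟨⟨(a, b), ha.1, hb.1, h1.trans h2, ?_⟩, h1, h2⟩
    rintro y ⟨hy1, hy2⟩ hyK
    simp only at hy1 hy2
    rcases le_total y z with h | h
    · exact absurd (le_csSup b1 ⟨hyK, h⟩) (not_le.2 hy1)
    · exact absurd (csInf_le b2 ⟨hyK, h⟩) (not_le.2 hy2)

lemma gaps_hasSum {K : Set ℝ} (hK : IsClosed K) {s t : ℝ} (hsub : K ⊆ Set.Icc s t) (hs : s ∈ K)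
    (ht : t ∈ K) {f : ℝ → ℝ} (hf : IntegrableOn f (Set.Icc s t)) :
    HasSum (fun p : gaps K => ∫ r in p.1.1..p.1.2, f r) ((∫ r in s..t, f r) - ∫ r in K, f r) := by
  have hst : s ≤ t := (hsub ht).1
  have : Countable (gaps K) := (gaps_countable K).to_subtype
  have hu := gaps_union hK hsub hs ht
  have h := hasSum_integral_iUnion (μ := volume) (f := f) (s := fun p : gaps K => Set.Ioo p.1.1 p.1.2)
    (fun p => measurableSet_Ioo) ((gaps_disj K).subtype _ _)
    (by rw [hu]; exact hf.mono_set Set.sdiff_subset)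
  rw [hu, setIntegral_sdiff hK.measurableSet hf hsub, int_Icc_eq hst] at h
  have e : (fun p : gaps K => ∫ r in p.1.1..p.1.2, f r) =
      fun p : gaps K => ∫ r in Set.Ioo p.1.1 p.1.2, f r := by
    ext p
    rw [intervalIntegral.integral_of_le p.2.2.2.1.le, integral_Ioc_eq_integral_Ioo]
  rw [e]
  exact h

lemma Adm.dbound {q μ : ℝ} {u g : ℝ → ℝ → ℝ} (S : Sol q μ u g) {h : ℝ → ℝ → ℝ} {L : ℝ}
    (A : Adm u h L) {r : ℝ} (hr : 0 < r) (x : ℝ) :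
    |deriv (fun r => h r x) r| ≤ L * (1 + |deriv (fun r => u r x) r|) := by
  have h1 := (c1_hasDeriv (A.c1 x) hr).tendsto_slope.abs
  have h2 := ((S.dt hr x).tendsto_slope.abs.const_add 1).const_mul L
  refine le_of_tendsto_of_tendsto h1 h2 ?_
  filter_upwards [self_mem_nhdsWithin, mem_nhdsWithin_of_mem_nhds (Ioi_mem_nhds hr)] with r' hne hr'
  have hpos : 0 < |r' - r| := abs_pos.2 (sub_ne_zero.2 hne)
  simp only [slope, vsub_eq_sub, smul_eq_mul, abs_mul, abs_inv]
  have := A.lip r' hr' r hr x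
  calc |r' - r|⁻¹ * |h r' x - h r x| ≤ |r' - r|⁻¹ * (L * (|r' - r| + |u r' x - u r x|)) := by gcongr
    _ = _ := by field_simp

lemma Adm.dmeas {u : ℝ → ℝ → ℝ} {h : ℝ → ℝ → ℝ} {L : ℝ} (A : Adm u h L) {s : ℝ} (hs : 0 < s)
    {K I : Set ℝ} (hKm : MeasurableSet K) (hIm : MeasurableSet I) (hK : K ⊆ Set.Ici s) :
    AEStronglyMeasurable (Function.uncurry fun r x => deriv (fun r => h r x) r)
      ((volume.restrict K).prod (volume.restrict I)) := by
  have hm : ∀ c : ℝ, Measurable (Function.uncurry fun r x => h (max (r + c) s) x) := by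
    intro c
    apply measurable_uncurry_of_continuous_of_measurable
    · intro x
      exact (A.c1 x).continuousOn.comp_continuous (by fun_prop)
        (fun r => hs.trans_le (le_max_right _ _))
    · intro r; exact (A.co _ (hs.trans_le (le_max_right _ _))).measurable
  refine aestronglyMeasurable_of_tendsto_ae atTop
    (f := fun (k : ℕ) p => ((1 : ℝ) / (k + 1))⁻¹ *
      (Function.uncurry (fun r x => h (max (r + 1 / (k + 1)) s) x) p -
       Function.uncurry (fun r x => h (max (r + 0) s) x) p))
    (fun k => (measurable_const.mul ((hm _).sub (hm _))).aestronglyMeasurable) ?_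
  rw [Measure.prod_restrict]
  filter_upwards [ae_restrict_mem (hKm.prod hIm)] with p hp
  obtain ⟨r, x⟩ := p
  have hrs : s ≤ r := hK hp.1
  have hd := (c1_hasDeriv (A.c1 x) (hs.trans_le hrs)).tendsto_slope
  have hseq : Tendsto (fun k : ℕ => r + 1 / ((k : ℝ) + 1)) atTop (𝓝[≠] r) := by
    rw [tendsto_nhdsWithin_iff]
    constructor
    · simpa using (tendsto_one_div_add_atTop_nhds_zero_nat (𝕜 := ℝ)).const_add r
    · refine Eventually.of_forall fun k => ?_
      have : (0:ℝ) < 1 / ((k : ℝ) + 1) := by positivity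
      simp only [Set.mem_compl_iff, Set.mem_singleton_iff]
      linarith
  refine (hd.comp hseq).congr fun k => ?_
  have : (0:ℝ) < 1 / ((k : ℝ) + 1) := by positivity
  simp only [Function.comp, slope, vsub_eq_sub, smul_eq_mul, Function.uncurry, add_sub_cancel_left,
    add_zero]
  rw [max_eq_left hrs, max_eq_left (by linarith)]

section
variable {q μ : ℝ} {u g : ℝ → ℝ → ℝ} {α β : ℝ}

lemma cl_of_closed (S : Sol q μ u g) (hq : 1 < q) (hμ : 0 < μ) (hab : α ≤ β) {s t n : ℝ}
    (hs0 : 0 < s) (hn : 0 ≤ n) {K : Set ℝ} (hK : IsClosed K) (hsub : K ⊆ Set.Icc s t) (hs : s ∈ K)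
    (ht : t ∈ K)
    (hbd : ∀ a ∈ K, a < t → ∀ x ∈ Set.Icc α β,
      |u a x| ≤ n ∧ |deriv (u a) x| ≤ n ∧ |deriv (deriv (u a)) x| ≤ n)
    (hgap : ∀ p ∈ gaps K, Cl u α β p.1 p.2) : Cl u α β s t := by
  intro h L A G hG hD
  have hst : s ≤ t := (hsub ht).1
  have hcount : Countable (gaps K) := (gaps_countable K).to_subtype
  have hba : 0 ≤ β - α := by linarith
  obtain ⟨C, hC, hest⟩ := gap_est S hq hμ hab (τ1 := t) hs0 hn
  obtain ⟨Cg, hCg, hg⟩ := S.gb s t hs0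
  have hsum1 := gaps_hasSum hK hsub hs ht (f := fun _ => (1:ℝ)) continuous_const.integrableOn_Icc
  have hsumG := gaps_hasSum hK hsub hs ht hG
  have hL0 := A.L0
  have hpos : ∀ p : gaps K, 0 < p.1.1 ∧ 0 < p.1.2 := fun p =>
    ⟨hs0.trans_le (hsub p.2.1).1, hs0.trans_le (hsub p.2.2.1).1⟩
  -- pointwise sum
  have hsumx : ∀ x, HasSum (fun p : gaps K => h p.1.2 x - h p.1.1 x)
      (h t x - h s x - ∫ r in K, deriv (fun r => h r x) r) := by
    intro x
    have hcd : ContinuousOn (deriv fun r => h r x) (Set.Ioi 0) := c1_contDeriv (A.c1 x)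
    have hftc : ∀ a b, 0 < a → a ≤ b → ∫ r in a..b, deriv (fun r => h r x) r = h b x - h a x := by
      intro a b ha hlt
      have hss : Set.uIcc a b ⊆ Set.Ioi 0 := by
        rw [Set.uIcc_of_le hlt]; exact fun r hr => ha.trans_le hr.1
      exact intervalIntegral.integral_eq_sub_of_hasDerivAt (f := fun r => h r x)
        (fun r hr => c1_hasDeriv (A.c1 x) (hss hr)) (hcd.mono hss).intervalIntegrable
    have := gaps_hasSum hK hsub hs ht (f := deriv fun r => h r x)
      ((hcd.mono (fun r hr => hs0.trans_le hr.1)).integrableOn_Icc)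
    rw [hftc s t hs0 hst] at this
    convert this using 2 with p
    rw [hftc _ _ (hpos p).1 p.2.2.2.1.le]
  -- Fubini
  have hprod : Integrable (Function.uncurry fun r x => deriv (fun r => h r x) r)
      ((volume.restrict K).prod (volume.restrict (Set.Icc α β))) := by
    have hmeas := A.dmeas hs0 hK.measurableSet (measurableSet_Icc (a := α) (b := β))
      (fun r hr => (hsub hr).1)
    rw [integrable_prod_iff hmeas]
    have hfin : IsFiniteMeasure (volume.restrict K) :=
      ⟨by rw [Measure.restrict_apply_univ]; exact (measure_mono hsub).trans_lt measure_Icc_lt_top⟩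
    have hsecm : ∀ᵐ r ∂(volume.restrict K), AEStronglyMeasurable
        (fun x => deriv (fun r => h r x) r) (volume.restrict (Set.Icc α β)) := hmeas.prodMk_left
    have hdom : ∀ r, 0 < r → IntegrableOn (fun x => L * (1 + |deriv (fun r => u r x) r|))
        (Set.Icc α β) := fun r hr =>
      (continuous_const.integrableOn_Icc.add (S.utint hq hr).abs).const_mul L
    constructor
    · filter_upwards [hsecm, ae_restrict_mem hK.measurableSet] with r hr1 hr2
      have hr0 : 0 < r := hs0.trans_le (hsub hr2).1
      exact (hdom r hr0).mono' hr1 (Eventually.of_forall fun x => A.dbound S hr0 x)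
    · have hmm := hmeas.norm.integral_prod_right'
      refine Integrable.of_bound hmm (L * ((β - α) * (1 + (μ * n + n ^ (q - 1) * n)) + Cg)) ?_
      have hne : ∀ᵐ r ∂(volume.restrict K), r ≠ t :=
        ae_restrict_of_ae (Measure.ae_ne volume t)
      filter_upwards [hsecm, ae_restrict_mem hK.measurableSet, hne] with r hr1 hr2 hr3
      have hr0 : 0 < r := hs0.trans_le (hsub hr2).1
      have hb := hbd r hr2 (lt_of_le_of_ne (hsub hr2).2 hr3)
      rw [Real.norm_eq_abs, abs_of_nonneg (integral_nonneg fun x => norm_nonneg _)]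
      have i1 : IntegrableOn (fun x => deriv (fun r => h r x) r) (Set.Icc α β) :=
        (hdom r hr0).mono' hr1 (Eventually.of_forall fun x => A.dbound S hr0 x)
      calc ∫ x in Set.Icc α β, |deriv (fun r => h r x) r|
          ≤ ∫ x in Set.Icc α β, L * ((1 + (μ * n + n ^ (q - 1) * n)) + |g r x|) := by
            apply setIntegral_mono_on i1.abs _ measurableSet_Icc
            · intro x hx
              refine (A.dbound S hr0 x).trans ?_
              apply mul_le_mul_of_nonneg_left _ hL0
              rw [add_assoc]
              apply add_le_add_right
              rw [S.pde r hr0 x]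
              refine (abs_add_le _ _).trans ?_
              apply add_le_add_left
              obtain ⟨b0, b1, b2⟩ := hb x hx
              refine (abs_sub _ _).trans ?_
              rw [abs_mul, abs_mul, abs_of_pos hμ, abs_of_nonneg (by positivity : 0 ≤ |u r x| ^ (q-1))]
              have := rpow_abs_le (p := q - 1) (by linarith) b0
              gcongr
            · exact (continuous_const.integrableOn_Icc.add (S.gi r hr0).abs.integrableOn).const_mul L
        _ = L * ((β - α) * (1 + (μ * n + n ^ (q - 1) * n)) + ∫ x in Set.Icc α β, |g r x|) := by
            rw [integral_const_mul, integral_add continuous_const.integrableOn_Icc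
              (S.gi r hr0).abs.integrableOn]
            simp [hab]
        _ ≤ _ := by
            have : ∫ x in Set.Icc α β, |g r x| ≤ Cg := (setIntegral_le_integral (S.gi r hr0).abs
                (Eventually.of_forall fun _ => abs_nonneg _)).trans (hg r (hsub hr2))
            gcongr
  have hswap := integral_integral_swap hprod
  have hDint : IntegrableOn (fun r => ∫ x in Set.Icc α β, deriv (fun r => h r x) r) K :=
    hprod.integral_prod_left
  have hXint : IntegrableOn (fun x => ∫ r in K, deriv (fun r => h r x) r) (Set.Icc α β) :=
    hprod.integral_prod_right
  -- exchange
  have hex := hasSum_integral_of_summable_integral_norm (μ := volume.restrict (Set.Icc α β))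
    (F := fun (p : gaps K) x => h p.1.2 x - h p.1.1 x)
    (fun p => (A.intOn (hpos p).2).sub (A.intOn (hpos p).1)) (by
      have hs1 : Summable (fun p : gaps K => (L * ((β - α) + C)) * (p.1.2 - p.1.1)) := by
        apply Summable.mul_left
        simpa using hsum1.summable
      refine Summable.of_nonneg_of_le (fun p => integral_nonneg fun x => norm_nonneg _) (fun p => ?_) hs1
      have hp := p.2
      have hlt : p.1.1 < p.1.2 := hp.2.2.1
      have h1 := A.l1diff S hab (hpos p).2 (hpos p).1
      have h2 := hest p.1.1 p.1.2 (hsub hp.1).1 hlt.le (hsub hp.2.1).2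
        (hbd _ hp.1 (hlt.trans_le (hsub hp.2.1).2)) (hgap p.1 hp)
      rw [abs_of_pos (sub_pos.2 hlt)] at h1
      refine h1.trans ?_
      calc _ ≤ L * ((p.1.2 - p.1.1) * (β - α) + C * (p.1.2 - p.1.1)) := by gcongr
        _ = _ := by ring)
  have hfin : (∫ x in Set.Icc α β, ∑' p : gaps K, (h p.1.2 x - h p.1.1 x)) ≤
      (∫ r in s..t, G r) - ∫ r in K, G r := by
    refine hasSum_le (fun p => ?_) hex hsumG
    have hp := p.2
    rw [integral_sub (A.intOn (hpos p).2) (A.intOn (hpos p).1)]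
    have hcc : Set.Icc p.1.1 p.1.2 ⊆ Set.Icc s t :=
      Set.Icc_subset_Icc (hsub hp.1).1 (hsub hp.2.1).2
    exact hgap p.1 hp h L A G (hG.mono_set hcc) (fun r hr => hD r (hcc hr))
  have e1 : (∫ x in Set.Icc α β, ∑' p : gaps K, (h p.1.2 x - h p.1.1 x)) =
      (∫ x in Set.Icc α β, h t x) - (∫ x in Set.Icc α β, h s x) -
        ∫ x in Set.Icc α β, ∫ r in K, deriv (fun r => h r x) r := by
    have ht0 : 0 < t := hs0.trans_le hst
    rw [← integral_sub (A.intOn ht0) (A.intOn hs0), ← integral_sub _ hXint]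
    · congr 1; ext x; exact (hsumx x).tsum_eq
    · exact (A.intOn ht0).sub (A.intOn hs0)
  have e2 : ∫ r in K, (∫ x in Set.Icc α β, deriv (fun r => h r x) r) ≤ ∫ r in K, G r :=
    setIntegral_mono_on hDint (hG.mono_set hsub) hK.measurableSet (fun r hr => hD r (hsub hr))
  rw [e1] at hfin
  linarith
end

def Bd (u : ℝ → ℝ → ℝ) (α β n t : ℝ) : Prop :=
  (∀ x ∈ Set.Icc (α - 1) (β + 1), |u t x| ≤ n) ∧
  (∀ x ∈ Set.Icc (α - 1) (β + 1), ∀ y ∈ Set.Icc (α - 1) (β + 1), |u t x - u t y| ≤ n * |x - y|) ∧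
  (∀ x ∈ Set.Icc (α - 1) (β + 1), ∀ y ∈ Set.Icc (α - 1) (β + 1), ∀ c ∈ Set.Icc (-1:ℝ) 1,
    |(u t (x + c) - u t x) - (u t (y + c) - u t y)| ≤ n * |c| * |x - y|)

section
variable {q μ : ℝ} {u g : ℝ → ℝ → ℝ} {α β : ℝ}

lemma Bd.bounds (S : Sol q μ u g) {n t : ℝ} (hn : 0 ≤ n) (ht : 0 < t) (h : Bd u α β n t) :
    ∀ x ∈ Set.Icc α β, |u t x| ≤ n ∧ |deriv (u t) x| ≤ n ∧ |deriv (deriv (u t)) x| ≤ n := by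
  intro x hx
  have hsub : ∀ x ∈ Set.Icc α β, x ∈ Set.Icc (α - 1) (β + 1) := fun x hx =>
    ⟨by linarith [hx.1], by linarith [hx.2]⟩
  have hnb : ∀ᶠ y in 𝓝 x, y ∈ Set.Icc (α - 1) (β + 1) :=
    Icc_mem_nhds (by linarith [hx.1]) (by linarith [hx.2])
  refine ⟨h.1 x (hsub x hx), ?_, ?_⟩
  · refine (S.d1 ht x).le_of_lip' hn ?_
    filter_upwards [hnb] with y hy
    exact h.2.1 y hy x (hsub x hx)
  · refine (S.d2 ht x).le_of_lip' hn ?_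
    have hnb2 : ∀ᶠ y in 𝓝 x, y ∈ Set.Icc (x - 1) (x + 1) :=
      Icc_mem_nhds (by linarith [hx.1]) (by linarith [hx.2])
    filter_upwards [hnb2] with y hy
    have hd : HasDerivAt (fun z => u t (z + (y - x)) - u t z) (deriv (u t) y - deriv (u t) x) x := by
      refine HasDerivAt.sub ?_ (S.d1 ht x)
      have := S.d1 ht (x + (y - x))
      rw [show x + (y - x) = y by ring] at this
      have h2 : HasDerivAt (fun z => u t (z + (y - x))) (deriv (u t) y) x := by
        apply HasDerivAt.comp_add_const
        rw [show x + (y - x) = y by ring]; exact this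
      exact h2
    refine hd.le_of_lip' (by positivity) ?_
    filter_upwards [hnb] with z hz
    exact h.2.2 z hz x (hsub x hx) (y - x) ⟨by linarith [hy.1], by linarith [hy.2]⟩

lemma Bd.exists (S : Sol q μ u g) {t : ℝ} (ht : 0 < t) : ∃ n : ℕ, Bd u α β n t := by
  obtain ⟨M0, h0⟩ := (isCompact_Icc (a := α - 2) (b := β + 2)).exists_bound_of_continuousOn
    (S.cont ht).continuousOn
  obtain ⟨M1, h1⟩ := (isCompact_Icc (a := α - 2) (b := β + 2)).exists_bound_of_continuousOn
    (S.c1' ht).continuous.continuousOn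
  obtain ⟨M2, h2⟩ := (isCompact_Icc (a := α - 2) (b := β + 2)).exists_bound_of_continuousOn
    (S.d2c ht).continuousOn
  obtain ⟨n, hn⟩ := exists_nat_ge (max M0 (max M1 M2))
  have n0 : M0 ≤ n := (le_max_left _ _).trans hn
  have n1 : M1 ≤ n := (le_max_left _ _).trans ((le_max_right _ _).trans hn)
  have n2 : M2 ≤ n := (le_max_right _ _).trans ((le_max_right _ _).trans hn)
  have hsub : ∀ x ∈ Set.Icc (α - 1) (β + 1), x ∈ Set.Icc (α - 2) (β + 2) := fun x hx =>
    ⟨by linarith [hx.1], by linarith [hx.2]⟩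
  have lip1 : ∀ x ∈ Set.Icc (α - 2) (β + 2), ∀ y ∈ Set.Icc (α - 2) (β + 2),
      |deriv (u t) x - deriv (u t) y| ≤ n * |x - y| := fun x hx y hy =>
    Convex.norm_image_sub_le_of_norm_deriv_le (f := deriv (u t)) (s := Set.Icc (α - 2) (β + 2))
      (fun z _ => (S.d2 ht z).differentiableAt) (fun z hz => (h2 z hz).trans n2)
      (convex_Icc _ _) hy hx
  refine ⟨n, fun x hx => (h0 x (hsub x hx)).trans n0, fun x hx y hy => ?_, fun x hx y hy c hc => ?_⟩
  · exact Convex.norm_image_sub_le_of_norm_deriv_le (f := u t) (s := Set.Icc (α - 2) (β + 2))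
      (fun z _ => (S.d1 ht z).differentiableAt) (fun z hz => (h1 z hz).trans n1)
      (convex_Icc _ _) (hsub y hy) (hsub x hx)
  · have hd : ∀ z, HasDerivAt (fun z => u t (z + c) - u t z) (deriv (u t) (z + c) - deriv (u t) z) z :=
      fun z => HasDerivAt.sub ((S.d1 ht (z + c)).comp_add_const z c) (S.d1 ht z)
    refine Convex.norm_image_sub_le_of_norm_deriv_le (f := fun z => u t (z + c) - u t z)
      (s := Set.Icc (α - 1) (β + 1)) (fun z _ => (hd z).differentiableAt) (fun z hz => ?_)
      (convex_Icc _ _) hy hx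
    rw [(hd z).deriv]
    have := lip1 (z + c) ⟨by linarith [hz.1, hc.1], by linarith [hz.2, hc.2]⟩ z (hsub z hz)
    rwa [add_sub_cancel_left] at this

lemma Bd.isClosed (S : Sol q μ u g) (n : ℝ) (E : Set ℝ) (hE : ∀ t ∈ E, 0 < t) :
    IsClosed {t : E | Bd u α β n t} := by
  have hc : ∀ x, Continuous fun t : E => u t x := fun x =>
    (S.c1 x).continuousOn.comp_continuous continuous_subtype_val (fun t => hE t t.2)
  have e : {t : E | Bd u α β n t} =
    (⋂ x ∈ Set.Icc (α - 1) (β + 1), {t : E | |u t x| ≤ n}) ∩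
    ((⋂ x ∈ Set.Icc (α - 1) (β + 1), ⋂ y ∈ Set.Icc (α - 1) (β + 1),
      {t : E | |u t x - u t y| ≤ n * |x - y|}) ∩
    ⋂ x ∈ Set.Icc (α - 1) (β + 1), ⋂ y ∈ Set.Icc (α - 1) (β + 1), ⋂ c ∈ Set.Icc (-1:ℝ) 1,
      {t : E | |(u t (x + c) - u t x) - (u t (y + c) - u t y)| ≤ n * |c| * |x - y|}) := by
    ext t
    simp only [Set.mem_inter_iff, Set.mem_iInter, Set.mem_ofPred_eq, Bd]
  rw [e]
  refine IsClosed.inter ?_ (IsClosed.inter ?_ ?_)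
  · exact isClosed_iInter fun x => isClosed_iInter fun _ =>
      isClosed_le (hc x).abs continuous_const
  · exact isClosed_iInter fun x => isClosed_iInter fun _ => isClosed_iInter fun y =>
      isClosed_iInter fun _ => isClosed_le ((hc x).sub (hc y)).abs continuous_const
  · exact isClosed_iInter fun x => isClosed_iInter fun _ => isClosed_iInter fun y =>
      isClosed_iInter fun _ => isClosed_iInter fun c => isClosed_iInter fun _ =>
      isClosed_le (((hc _).sub (hc x)).sub ((hc _).sub (hc y))).abs continuous_const

lemma good_open : IsOpen {t | Good u α β t} := by
  rw [Metric.isOpen_iff]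
  rintro t ⟨δ, hδ, h⟩
  refine ⟨δ / 2, by linarith, fun t' ht' => ⟨δ / 2, by linarith, fun s' t'' h1 h2 h3 h4 => ?_⟩⟩
  rw [Metric.mem_ball, Real.dist_eq, abs_lt] at ht'
  exact h s' t'' h1 (by linarith) h3 (by linarith)

theorem propA (S : Sol q μ u g) (hq : 1 < q) (hμ : 0 < μ) (hab : α ≤ β) {s t : ℝ} (hs : 0 < s)
    (hst : s ≤ t) : Cl u α β s t := by
  suffices hgood : ∀ t, 0 < t → Good u α β t from
    cl_of_good S hab hs hst fun r hr => hgood r (hs.trans hr.1)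
  by_contra hcon
  push Not at hcon
  obtain ⟨t0, ht0, hbad⟩ := hcon
  set E : Set ℝ := Set.Ioi 0 ∩ {t | Good u α β t}ᶜ with hE
  have hlc : IsLocallyClosed E := isOpen_Ioi.isLocallyClosed.inter good_open.isClosed_compl.isLocallyClosed
  have : LocallyCompactSpace E := hlc.locallyCompactSpace
  have : Nonempty E := ⟨⟨t0, ht0, hbad⟩⟩
  obtain ⟨n, hn⟩ := nonempty_interior_of_iUnion_of_closed
    (f := fun n : ℕ => {t : E | Bd u α β n t}) (fun n => Bd.isClosed S n E (fun t ht => ht.1)) (by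
      rw [Set.eq_univ_iff_forall]
      intro t
      obtain ⟨n, hn⟩ := Bd.exists (α := α) (β := β) S t.2.1
      exact Set.mem_iUnion.2 ⟨n, hn⟩)
  obtain ⟨⟨ts, hts⟩, hint⟩ := hn
  rw [mem_interior_iff_mem_nhds, Metric.mem_nhds_iff] at hint
  obtain ⟨ρ, hρ, hball⟩ := hint
  have hBd : ∀ r ∈ E, |r - ts| < ρ → Bd u α β n r := by
    intro r hr hlt
    exact hball (show (⟨r, hr⟩ : E) ∈ Metric.ball _ ρ from hlt)
  apply hts.2
  refine ⟨ρ, hρ, fun s' t' hs' h1 h2 h3 => ?_⟩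
  have hnotE : ∀ r, 0 < r → r ∉ E → Good u α β r := by
    intro r hr hrE
    by_contra hg
    exact hrE ⟨hr, hg⟩
  by_cases hemp : (E ∩ Set.Icc s' t').Nonempty
  · have hEcl : ∀ a, 0 < a → IsClosed (E ∩ Set.Icc a t') := by
      intro a ha
      have : E ∩ Set.Icc a t' = {t | Good u α β t}ᶜ ∩ Set.Icc a t' := by
        ext r
        constructor
        · rintro ⟨hr, hr2⟩; exact ⟨hr.2, hr2⟩
        · rintro ⟨hr, hr2⟩; exact ⟨⟨ha.trans_le hr2.1, hr⟩, hr2⟩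
      rw [this]
      exact good_open.isClosed_compl.inter isClosed_Icc
    have hbb : BddBelow (E ∩ Set.Icc s' t') := ⟨s', fun r hr => hr.2.1⟩
    have hmem := (hEcl s' hs').csInf_mem hemp hbb
    set s1 := sInf (E ∩ Set.Icc s' t') with hs1
    have hs10 : 0 < s1 := hmem.1.1
    have c1 : Cl u α β s' s1 := cl_of_good S hab hs' hmem.2.1 fun r hr => by
      apply hnotE r (hs'.trans hr.1)
      intro hrE
      exact absurd (csInf_le hbb ⟨hrE, hr.1.le, hr.2.le.trans hmem.2.2⟩) (not_le.2 hr.2)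
    refine c1.trans hmem.2.1 hmem.2.2 ?_
    refine cl_of_closed S hq hμ hab (n := n) hs10 (Nat.cast_nonneg n)
      (K := (E ∩ Set.Icc s1 t') ∪ {t'}) ((hEcl s1 hs10).union isClosed_singleton) ?_ ?_ ?_ ?_ ?_
    · rintro r (hr | hr)
      · exact hr.2
      · rw [Set.mem_singleton_iff.1 hr]; exact ⟨hmem.2.2, le_rfl⟩
    · exact Or.inl ⟨hmem.1, le_rfl, hmem.2.2⟩
    · exact Or.inr rfl
    · rintro a (ha | ha) hlt
      · refine (hBd a ha.1 ?_).bounds S (Nat.cast_nonneg n) ha.1.1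
        rw [abs_lt]
        have := ha.2.1; have := ha.2.2; have := hmem.2.1
        constructor <;> linarith
      · exact absurd hlt (by rw [Set.mem_singleton_iff.1 ha]; exact lt_irrefl _)
    · rintro ⟨a, b⟩ ⟨ha, hb, hlt, hdis⟩
      have hK : (E ∩ Set.Icc s1 t') ∪ {t'} ⊆ Set.Icc s1 t' := by
        rintro r (hr | hr)
        · exact hr.2
        · rw [Set.mem_singleton_iff.1 hr]; exact ⟨hmem.2.2, le_rfl⟩
      have ha0 : 0 < a := hs10.trans_le (hK ha).1
      refine cl_of_good S hab ha0 hlt.le fun r hr => hnotE r (ha0.trans hr.1) fun hrE => ?_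
      exact hdis r hr (Or.inl ⟨hrE, (hK ha).1.trans hr.1.le, hr.2.le.trans (hK hb).2⟩)
  · refine cl_of_good S hab hs' h2 fun r hr => hnotE r (hs'.trans hr.1) fun hrE => ?_
    exact hemp ⟨r, hrE, hr.1.le, hr.2.le⟩
end

section
variable {q μ : ℝ} {u g : ℝ → ℝ → ℝ} {α β : ℝ}

lemma lip_of_deriv {η e : ℝ → ℝ} {A : ℝ} (hη : ∀ x, HasDerivAt η (e x) x) (hA : ∀ x, |e x| ≤ A)
    (x y : ℝ) : |η x - η y| ≤ A * |x - y| := by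
  have := Convex.norm_image_sub_le_of_norm_deriv_le (f := η) (C := A) (s := Set.univ) (x := y)
    (y := x) (fun x _ => (hη x).differentiableAt)
    (fun x _ => by rw [(hη x).deriv]; exact hA x) convex_univ trivial trivial
  simpa using this

lemma comp_hasDeriv (S : Sol q μ u g) {η e Ψ : ℝ → ℝ} (hη : ∀ x, HasDerivAt η (e x) x)
    {r : ℝ} (hr : 0 < r) (x : ℝ) : HasDerivAt (fun r => η (u r x) * Ψ x)
      (e (u r x) * Ψ x * deriv (fun r => u r x) r) r := by
  have := ((hη (u r x)).comp r (S.dt hr x)).mul_const (Ψ x)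
  exact this.congr_deriv (by ring)

lemma adm_comp (S : Sol q μ u g) {η e Ψ : ℝ → ℝ} {A : ℝ} (hA0 : 0 ≤ A)
    (hη : ∀ x, HasDerivAt η (e x) x) (he : Continuous e) (hA : ∀ x, |e x| ≤ A)
    (hΨc : Continuous Ψ) (hΨ : ∀ x, |Ψ x| ≤ 1) : Adm u (fun r x => η (u r x) * Ψ x) A := by
  have hηc : Continuous η := continuous_iff_continuousAt.2 fun x => (hη x).continuousAt
  refine ⟨hA0, fun x => ?_, fun r hr => ?_, fun r hr r' hr' x => ?_⟩
  · rw [show (1 : WithTop ℕ∞) = 0 + 1 by norm_num, contDiffOn_succ_iff_deriv_of_isOpen isOpen_Ioi]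
    refine ⟨fun r hr => (comp_hasDeriv S hη hr x).differentiableAt.differentiableWithinAt, by simp, ?_⟩
    rw [contDiffOn_zero]
    have hu : ContinuousOn (fun r => u r x) (Set.Ioi 0) := (S.c1 x).continuousOn
    have hu' := c1_contDeriv (S.c1 x)
    have : ContinuousOn (fun r => e (u r x) * Ψ x * deriv (fun r => u r x) r) (Set.Ioi 0) :=
      ((he.comp_continuousOn hu).mul continuousOn_const).mul hu'
    exact this.congr fun r hr => (comp_hasDeriv S hη hr x).deriv
  · exact (hηc.comp (S.cont hr)).mul hΨc
  · show |η (u r x) * Ψ x - η (u r' x) * Ψ x| ≤ _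
    rw [← sub_mul, abs_mul]
    have h1 := lip_of_deriv hη hA (u r x) (u r' x)
    calc |η (u r x) - η (u r' x)| * |Ψ x| ≤ (A * |u r x - u r' x|) * 1 :=
          mul_le_mul h1 (hΨ x) (abs_nonneg _) (by positivity)
      _ ≤ _ := by nlinarith [mul_nonneg hA0 (abs_nonneg (r - r'))]

/-- `Cl` for compositions -/
lemma cl_comp (S : Sol q μ u g) (hq : 1 < q) (hμ : 0 < μ) (hab : α ≤ β) {s t : ℝ} (hs : 0 < s)
    (hst : s ≤ t) {η e Ψ : ℝ → ℝ} {A : ℝ} (hA0 : 0 ≤ A)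
    (hη : ∀ x, HasDerivAt η (e x) x) (he : Continuous e) (hA : ∀ x, |e x| ≤ A)
    (hΨc : Continuous Ψ) (hΨ : ∀ x, |Ψ x| ≤ 1) {G : ℝ → ℝ} (hG : IntegrableOn G (Set.Icc s t))
    (hD : ∀ r ∈ Set.Icc s t, (∫ x in α..β, e (u r x) * Ψ x *
        (μ * deriv (deriv (u r)) x - |u r x| ^ (q - 1) * deriv (u r) x))
      + ∫ x in Set.Icc α β, e (u r x) * Ψ x * g r x ≤ G r) :
    (∫ x in Set.Icc α β, η (u t x) * Ψ x) - ∫ x in Set.Icc α β, η (u s x) * Ψ x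
      ≤ ∫ r in s..t, G r := by
  refine propA S hq hμ hab hs hst _ A (adm_comp S hA0 hη he hA hΨc hΨ) G hG fun r hr => ?_
  have hr0 : 0 < r := hs.trans_le hr.1
  refine le_trans (le_of_eq ?_) (hD r hr)
  have hc : Continuous fun x => e (u r x) * Ψ x := (he.comp (S.cont hr0)).mul hΨc
  rw [← int_Icc_eq hab, ← integral_add]
  · congr 1; ext x
    rw [(comp_hasDeriv S hη hr0 x).deriv, S.pde r hr0 x]; ring
  · exact (hc.mul (S.rhsc hq hr0)).integrableOn_Icc
  · exact IntegrableOn.continuousOn_mul hc.continuousOn (S.gi r hr0).integrableOn isCompact_Icc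

/-- spatial sup, with time clamp -/
noncomputable def sg (u : ℝ → ℝ → ℝ) (α β s r : ℝ) : ℝ := ⨆ x : Set.Icc α β, |u (max r s) x|

lemma sg_bdd (S : Sol q μ u g) {s : ℝ} (hs : 0 < s) (r : ℝ) :
    BddAbove (Set.range fun x : Set.Icc α β => |u (max r s) x|) := by
  obtain ⟨M, hM⟩ := (isCompact_Icc (a := α) (b := β)).exists_bound_of_continuousOn
    (S.cont (hs.trans_le (le_max_right r s))).continuousOn
  exact ⟨M, by rintro _ ⟨x, rfl⟩; exact hM x x.2⟩

lemma clamp_cont (S : Sol q μ u g) {s : ℝ} (hs : 0 < s) (x : ℝ) :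
    Continuous fun r => u (max r s) x :=
  (S.c1 x).continuousOn.comp_continuous (by fun_prop) (fun r => hs.trans_le (le_max_right _ _))

lemma sg_meas (S : Sol q μ u g) {s : ℝ} (hs : 0 < s) : Measurable (sg u α β s) := by
  apply LowerSemicontinuous.measurable
  exact lowerSemicontinuous_ciSup (fun r => sg_bdd S hs r)
    (fun x => (clamp_cont S hs x).abs.lowerSemicontinuous)

lemma le_sg (S : Sol q μ u g) {s : ℝ} (hs : 0 < s) {r : ℝ} (hr : s ≤ r) {x : ℝ}
    (hx : x ∈ Set.Icc α β) : |u r x| ≤ sg u α β s r := by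
  have := le_ciSup (sg_bdd (α := α) (β := β) S hs r) ⟨x, hx⟩
  simpa [sg, max_eq_left hr] using this

lemma sg_attained (S : Sol q μ u g) (hab : α ≤ β) {s : ℝ} (hs : 0 < s) {r : ℝ} (hr : s ≤ r) :
    ∃ x ∈ Set.Icc α β, sg u α β s r = |u r x| := by
  obtain ⟨x, hx, hmax⟩ := (isCompact_Icc (a := α) (b := β)).exists_isMaxOn ⟨α, le_rfl, hab⟩
    (S.cont (hs.trans_le hr)).abs.continuousOn
  refine ⟨x, hx, le_antisymm ?_ (le_sg S hs hr hx)⟩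
  have : Nonempty (Set.Icc α β) := ⟨⟨x, hx⟩⟩
  apply ciSup_le
  intro y
  rw [max_eq_left hr]
  exact hmax y.2

/-- soft threshold -/
noncomputable def kth (M y : ℝ) : ℝ := HH (y - M) - HH (-y - M)
lemma kth_deriv (M y : ℝ) : HasDerivAt (kth M) (pp (y - M) + pp (-y - M)) y := by
  have h1 := (HH_deriv (y - M)).comp y ((hasDerivAt_id y).sub_const M)
  have h2 := (HH_deriv (-y - M)).comp y ((hasDerivAt_id y).neg.sub_const M)
  exact (h1.sub h2).congr_deriv (by simp)
lemma kth_odd (M y : ℝ) : kth M (-y) = - kth M y := by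
  unfold kth; rw [neg_neg]; ring
lemma kth_zero {M y : ℝ} (h : |y| ≤ M) : kth M y = 0 := by
  rw [abs_le] at h
  unfold kth
  rw [HH_zero (by linarith), HH_zero (by linarith)]; simp
lemma kth_d0 (M y : ℝ) : 0 ≤ pp (y - M) + pp (-y - M) := add_nonneg (pp_nonneg _) (pp_nonneg _)
lemma kth_d1 {M : ℝ} (hM : 0 ≤ M) (y : ℝ) : pp (y - M) + pp (-y - M) ≤ 1 := by
  rcases le_total y 0 with h | h
  · rw [pp_zero (by linarith : y - M ≤ 0)]; linarith [pp_le_one (-y - M)]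
  · rw [pp_zero (by linarith : -y - M ≤ 0)]; linarith [pp_le_one (y - M)]
lemma kth_mono (M : ℝ) : Monotone (kth M) :=
  monotone_of_deriv_nonneg (fun x => (kth_deriv M x).differentiableAt)
    (fun x => by rw [(kth_deriv M x).deriv]; exact kth_d0 M x)
lemma kth_ge {M y : ℝ} (hM : 0 ≤ M) (hy : 0 ≤ y) : y - M - 1 ≤ kth M y := by
  unfold kth
  rw [HH_zero (by linarith : -y - M ≤ 0)]
  linarith [HH_ge (y - M)]

noncomputable def eN (N M y : ℝ) : ℝ := N * Real.arctan (kth M y / N)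
lemma eN_deriv {N : ℝ} (hN : 0 < N) (M y : ℝ) : HasDerivAt (eN N M)
    ((1 / (1 + (kth M y / N) ^ 2)) * (pp (y - M) + pp (-y - M))) y := by
  have h1 := (((kth_deriv M y).div_const N).arctan).const_mul N
  exact h1.congr_deriv (by field_simp)
lemma eN_jcont (N M : ℝ) : Continuous fun y =>
    (1 / (1 + (kth M y / N) ^ 2)) * (pp (y - M) + pp (-y - M)) := by
  have h1 : Continuous (kth M) := continuous_iff_continuousAt.2 fun x => (kth_deriv M x).continuousAt
  have h2 := pp_cont
  have h3 : ∀ y, 1 + (kth M y / N) ^ 2 ≠ 0 := fun y => by positivity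
  fun_prop (disch := assumption)
lemma eN_j0 (N M y : ℝ) : 0 ≤ (1 / (1 + (kth M y / N) ^ 2)) * (pp (y - M) + pp (-y - M)) :=
  mul_nonneg (by positivity) (kth_d0 M y)
lemma eN_j1 {N M : ℝ} (hM : 0 ≤ M) (y : ℝ) :
    (1 / (1 + (kth M y / N) ^ 2)) * (pp (y - M) + pp (-y - M)) ≤ 1 := by
  have h1 : 1 / (1 + (kth M y / N) ^ 2) ≤ 1 := by
    rw [div_le_one (by positivity)]; nlinarith [sq_nonneg (kth M y / N)]
  exact mul_le_one₀ h1 (kth_d0 M y) (kth_d1 hM y)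
lemma eN_zero {N M y : ℝ} (h : |y| ≤ M) : eN N M y = 0 := by simp [eN, kth_zero h]
lemma eN_odd (N M y : ℝ) : eN N M (-y) = - eN N M y := by
  simp [eN, kth_odd, neg_div, Real.arctan_neg]
lemma eN_mono {N : ℝ} (hN : 0 < N) (M : ℝ) : Monotone (eN N M) :=
  monotone_of_deriv_nonneg (fun x => (eN_deriv hN M x).differentiableAt)
    (fun x => by rw [(eN_deriv hN M x).deriv]; exact eN_j0 N M x)
lemma eN_bdd {N : ℝ} (hN : 0 < N) (M y : ℝ) : |eN N M y| ≤ 2 * N := by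
  unfold eN
  rw [abs_mul, abs_of_pos hN, mul_comm]
  gcongr
  have h1 := Real.arctan_lt_pi_div_two (kth M y / N)
  have h2 := Real.neg_pi_div_two_lt_arctan (kth M y / N)
  have h3 := Real.pi_lt_four
  rw [abs_le]; constructor <;> linarith
lemma eN_abs {N : ℝ} (hN : 0 < N) {M : ℝ} (hM : 0 ≤ M) (y : ℝ) : |eN N M y| = eN N M |y| := by
  have h0 : eN N M 0 = 0 := eN_zero (by simpa using hM)
  rcases le_total 0 y with h | h
  · rw [abs_of_nonneg h, abs_of_nonneg]; rw [← h0]; exact eN_mono hN M h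
  · rw [abs_of_nonpos h, eN_odd, abs_of_nonpos]; rw [← h0]; exact eN_mono hN M h
lemma eN_le {N : ℝ} (hN : 0 < N) {M : ℝ} (hM : 0 ≤ M) (y : ℝ) : |eN N M y| ≤ |y| := by
  have := lip_of_deriv (eN_deriv hN M) (A := 1) (fun x => by
    rw [abs_of_nonneg (eN_j0 N M x)]; exact eN_j1 hM x) y 0
  rw [eN_zero (by simpa using hM : |(0:ℝ)| ≤ M)] at this
  simpa using this
lemma eN_tendsto (M y : ℝ) : Tendsto (fun n : ℕ => eN ((n : ℝ) + 1) M y) atTop (𝓝 (kth M y)) := by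
  have hd : HasDerivAt (fun c => Real.arctan (kth M y * c)) (kth M y) 0 := by
    have := (((hasDerivAt_id (0:ℝ)).const_mul (kth M y))).arctan
    exact this.congr_deriv (by simp)
  have h1 := hd.tendsto_slope
  have hseq : Tendsto (fun k : ℕ => 1 / ((k : ℝ) + 1)) atTop (𝓝[≠] 0) := by
    rw [tendsto_nhdsWithin_iff]
    refine ⟨tendsto_one_div_add_atTop_nhds_zero_nat (𝕜 := ℝ), Eventually.of_forall fun k => ?_⟩
    have : (0:ℝ) < 1 / ((k : ℝ) + 1) := by positivity
    exact this.ne'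
  refine (h1.comp hseq).congr fun k => ?_
  simp [slope, eN, div_eq_mul_inv]
end

section
variable {q μ : ℝ} {u g : ℝ → ℝ → ℝ} {α β : ℝ}

lemma eN_cont {N : ℝ} (hN : 0 < N) (M : ℝ) : Continuous (eN N M) :=
  continuous_iff_continuousAt.2 fun x => (eN_deriv hN M x).continuousAt

lemma eN_prim_nonneg {N : ℝ} (hN : 0 < N) {M : ℝ} (hM : 0 ≤ M) (y : ℝ) :
    0 ≤ prim (eN N M) y := by
  have h0 : eN N M 0 = 0 := eN_zero (by simpa using hM)
  unfold prim
  rcases le_total 0 y with h | h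
  · exact intervalIntegral.integral_nonneg h fun x hx => by
      rw [← h0]; exact eN_mono hN M hx.1
  · rw [intervalIntegral.integral_symm]
    rw [← intervalIntegral.integral_neg]
    exact intervalIntegral.integral_nonneg h fun x hx => by
      have := eN_mono hN M hx.2
      rw [h0] at this; linarith

lemma eN_prim_le {N : ℝ} (hN : 0 < N) {M : ℝ} (hM : 0 ≤ M) (y : ℝ) :
    prim (eN N M) y ≤ y ^ 2 := by
  have := prim_sub_le (eN_cont hN M) (N := |y|) (A := |y|) (x := y) (y := 0)
    (fun s hs => (eN_le hN hM s).trans hs) le_rfl (by simp)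
  have h0 : prim (eN N M) 0 = 0 := by simp [prim]
  rw [h0, sub_zero, sub_zero, ← sq, sq_abs] at this
  exact (le_abs_self _).trans this

lemma lemB_unif (S : Sol q μ u g) (hq : 1 < q) (hμ : 0 < μ) (hab : α < β) {s T : ℝ} (hs : 0 < s)
    (hsT : s ≤ T) {M Cg : ℝ} (hM : 0 ≤ M) (hα : ∀ r ∈ Set.Icc s T, |u r α| ≤ M)
    (hβ : ∀ r ∈ Set.Icc s T, |u r β| ≤ M) (hCg0 : 0 ≤ Cg)
    (hCg : ∀ r ∈ Set.Icc s T, ∫ x, |g r x| ≤ Cg)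
    {N : ℝ} (hN : 0 < N) :
    IntegrableOn (fun r => (eN N M (sg u α β s r)) ^ 2) (Set.Icc s T) ∧
    (μ / (2 * (β - α))) * ∫ r in Set.Icc s T, (eN N M (sg u α β s r)) ^ 2 ≤
      (β - α) * Cg ^ 2 / (2 * μ) * (T - s) + ∫ x in Set.Icc α β, (u s x) ^ 2 := by
  have hl : 0 < β - α := by linarith
  have hI : IntegrableOn (fun r => (eN N M (sg u α β s r)) ^ 2) (Set.Icc s T) := by
    apply Measure.integrableOn_of_bounded (M := (2 * N) ^ 2) (by simp)
    · refine Eventually.of_forall fun r => ?_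
      rw [Real.norm_of_nonneg (sq_nonneg _), ← sq_abs]
      exact pow_le_pow_left₀ (abs_nonneg _) (eN_bdd hN M _) 2
    · exact (((eN_cont hN M).measurable.comp (sg_meas S hs)).pow_const 2).aestronglyMeasurable
  refine ⟨hI, ?_⟩
  have hmain := cl_comp S hq hμ hab.le hs hsT (η := prim (eN N M)) (e := eN N M) (Ψ := fun _ => 1)
    (A := 2 * N) (by positivity) (prim_deriv (eN_cont hN M)) (eN_cont hN M) (eN_bdd hN M)
    continuous_const (by simp)
    (G := fun r => (β - α) * Cg ^ 2 / (2 * μ) - (μ / (2 * (β - α))) * (eN N M (sg u α β s r)) ^ 2)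
    ((integrableOn_const (by simp)).sub (hI.const_mul _)) ?_
  · rw [← int_Icc_eq hsT, integral_sub (integrable_const _) (hI.const_mul _),
      integral_const_mul] at hmain
    simp only [mul_one, integral_const, MeasurableSet.univ, measureReal_restrict_apply,
      Set.univ_inter, Real.volume_real_Icc_of_le hsT, smul_eq_mul] at hmain
    have h1 : 0 ≤ ∫ x in Set.Icc α β, prim (eN N M) (u T x) :=
      integral_nonneg fun x => eN_prim_nonneg hN hM _
    have h2 : ∫ x in Set.Icc α β, prim (eN N M) (u s x) ≤ ∫ x in Set.Icc α β, (u s x) ^ 2 := by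
      apply setIntegral_mono
      · exact ((prim_cont (eN_cont hN M)).comp (S.cont hs)).integrableOn_Icc
      · exact ((S.cont hs).pow 2).integrableOn_Icc
      · exact fun x => eN_prim_le hN hM _
    linarith
  · intro r hr
    have hr0 : 0 < r := hs.trans_le hr.1
    obtain ⟨x0, hx0, hx0e⟩ := sg_attained S hab.le hs hr.1
    obtain ⟨b1, b2⟩ := lemBfix (μ := μ) hq hab (eN_deriv hN M) (eN_jcont N M) (eN_j0 N M)
      (eN_j1 hM) (fun x hx => eN_zero hx) (S.d1 hr0) (S.d2 hr0) (S.d2c hr0) (hα r hr) (hβ r hr)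
    have b3 := b2 x0 hx0
    set I := ∫ x in α..β, (1 / (1 + (kth M (u r x) / N) ^ 2)) *
      (pp (u r x - M) + pp (-u r x - M)) * (deriv (u r) x) ^ 2 with hIdef
    set E := eN N M (sg u α β s r) with hE
    have hEe : |eN N M (u r x0)| = E := by rw [eN_abs hN hM, hE, hx0e]
    have hE0 : 0 ≤ E := by rw [← hEe]; exact abs_nonneg _
    have b4 : E ^ 2 ≤ (β - α) * I := by rw [← hEe, sq_abs]; exact b3
    have b5 : ∫ x in Set.Icc α β, eN N M (u r x) * 1 * g r x ≤ E * Cg := by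
      have hgi := (S.gi r hr0)
      calc ∫ x in Set.Icc α β, eN N M (u r x) * 1 * g r x
          ≤ ∫ x in Set.Icc α β, E * |g r x| := by
            apply setIntegral_mono_on
            · exact IntegrableOn.continuousOn_mul
                (((eN_cont hN M).comp (S.cont hr0)).mul continuous_const).continuousOn
                hgi.integrableOn isCompact_Icc
            · exact (hgi.abs.const_mul E).integrableOn
            · exact measurableSet_Icc
            · intro x hx
              have : |eN N M (u r x)| ≤ E := by
                rw [eN_abs hN hM]; exact eN_mono hN M (le_sg S hs hr.1 hx)
              calc _ ≤ |eN N M (u r x) * 1 * g r x| := le_abs_self _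
                _ = |eN N M (u r x)| * |g r x| := by rw [mul_one, abs_mul]
                _ ≤ _ := mul_le_mul_of_nonneg_right this (abs_nonneg _)
        _ = E * ∫ x in Set.Icc α β, |g r x| := integral_const_mul _ _
        _ ≤ E * Cg := by
            apply mul_le_mul_of_nonneg_left _ hE0
            exact (setIntegral_le_integral hgi.abs
              (Eventually.of_forall fun _ => abs_nonneg _)).trans (hCg r hr)
    have b6 : (∫ x in α..β, eN N M (u r x) * 1 *
        (μ * deriv (deriv (u r)) x - |u r x| ^ (q - 1) * deriv (u r) x)) ≤ -μ * I := by
      simpa only [mul_one] using b1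
    have b7 : -μ * I ≤ - (μ / (β - α)) * E ^ 2 := by
      have : E ^ 2 / (β - α) ≤ I := by rw [div_le_iff₀ hl]; linarith
      have h8 : - (μ / (β - α)) * E ^ 2 = -μ * (E ^ 2 / (β - α)) := by ring
      rw [h8]; nlinarith
    have b8 : - (μ / (β - α)) * E ^ 2 + E * Cg ≤
        (β - α) * Cg ^ 2 / (2 * μ) - (μ / (2 * (β - α))) * E ^ 2 := by
      have : (β - α) * Cg ^ 2 / (2 * μ) - (μ / (2 * (β - α))) * E ^ 2 -
        (- (μ / (β - α)) * E ^ 2 + E * Cg) = (μ * E - (β - α) * Cg) ^ 2 / (2 * μ * (β - α)) := by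
        field_simp; ring
      have h2 : 0 ≤ (μ * E - (β - α) * Cg) ^ 2 / (2 * μ * (β - α)) := by positivity
      linarith
    linarith

lemma traj_bdd (S : Sol q μ u g) {s T : ℝ} (hs : 0 < s) (x : ℝ) :
    ∃ M, ∀ r ∈ Set.Icc s T, |u r x| ≤ M := by
  obtain ⟨M, hM⟩ := (isCompact_Icc (a := s) (b := T)).exists_bound_of_continuousOn
    ((S.c1 x).continuousOn.mono fun r hr => hs.trans_le hr.1)
  exact ⟨M, hM⟩

lemma sg_nonneg (s r : ℝ) : 0 ≤ sg u α β s r := Real.iSup_nonneg fun _ => abs_nonneg _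

lemma lemB (S : Sol q μ u g) (hq : 1 < q) (hμ : 0 < μ) (hab : α < β) {s T : ℝ} (hs : 0 < s)
    (hsT : s ≤ T) : IntegrableOn (fun r => (sg u α β s r) ^ 2) (Set.Icc s T) := by
  obtain ⟨M1, hM1⟩ := traj_bdd S hs (T := T) α
  obtain ⟨M2, hM2⟩ := traj_bdd S hs (T := T) β
  obtain ⟨Cg, hCg0, hCg⟩ := S.gb s T hs
  set M := max 0 (max M1 M2) with hMdef
  have hM : 0 ≤ M := le_max_left _ _
  have hα : ∀ r ∈ Set.Icc s T, |u r α| ≤ M := fun r hr =>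
    (hM1 r hr).trans ((le_max_left _ _).trans (le_max_right _ _))
  have hβ : ∀ r ∈ Set.Icc s T, |u r β| ≤ M := fun r hr =>
    (hM2 r hr).trans ((le_max_right _ _).trans (le_max_right _ _))
  have hl : 0 < β - α := by linarith
  have key := fun n : ℕ => lemB_unif S hq hμ hab hs hsT hM hα hβ hCg0 hCg
    (N := (n : ℝ) + 1) (by positivity)
  set R := (β - α) * Cg ^ 2 / (2 * μ) * (T - s) + ∫ x in Set.Icc α β, (u s x) ^ 2 with hR
  set c := μ / (2 * (β - α)) with hc
  have hc0 : 0 < c := by positivity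
  have hmk : Measurable fun r => kth M (sg u α β s r) :=
    (kth_mono M).measurable.comp (sg_meas S hs)
  have hk : IntegrableOn (fun r => (kth M (sg u α β s r)) ^ 2) (Set.Icc s T) := by
    refine ⟨(hmk.pow_const 2).aestronglyMeasurable, ?_⟩
    rw [hasFiniteIntegral_iff_ofReal (Eventually.of_forall fun r => sq_nonneg _)]
    have hlim : ∀ r, ENNReal.ofReal ((kth M (sg u α β s r)) ^ 2) =
        liminf (fun n : ℕ => ENNReal.ofReal ((eN ((n : ℝ) + 1) M (sg u α β s r)) ^ 2)) atTop := by
      intro r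
      symm
      apply Tendsto.liminf_eq
      exact (ENNReal.continuous_ofReal.tendsto _).comp ((eN_tendsto M _).pow 2)
    simp_rw [hlim]
    refine (lintegral_liminf_le fun n => ?_).trans_lt ?_
    · exact (((eN_cont (by positivity) M).measurable.comp (sg_meas S hs)).pow_const 2).ennreal_ofReal
    · refine lt_of_le_of_lt (b := ENNReal.ofReal (R / c)) ?_ ENNReal.ofReal_lt_top
      refine liminf_le_of_le (by isBoundedDefault) ?_
      intro b hb
      obtain ⟨n, hn⟩ := hb.exists
      refine hn.trans ?_
      rw [← ofReal_integral_eq_lintegral_ofReal (key n).1 (Eventually.of_forall fun r => sq_nonneg _)]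
      apply ENNReal.ofReal_le_ofReal
      rw [le_div_iff₀ hc0, mul_comm]
      exact (key n).2
  refine Integrable.mono' (g := fun r => 2 * (kth M (sg u α β s r)) ^ 2 + 2 * (M + 1) ^ 2)
    ((hk.const_mul 2).add (integrableOn_const (by simp)))
    ((sg_meas S hs).pow_const 2).aestronglyMeasurable (Eventually.of_forall fun r => ?_)
  rw [Real.norm_of_nonneg (sq_nonneg _)]
  have h0 := sg_nonneg (u := u) (α := α) (β := β) s r
  have h1 := kth_ge hM h0
  have h2 : 0 ≤ kth M (sg u α β s r) := by
    rw [← kth_zero (by simpa using hM : |(0:ℝ)| ≤ M)]; exact kth_mono M h0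
  nlinarith [sq_nonneg (kth M (sg u α β s r) - (M + 1))]
end

noncomputable def Ps (ε z y x : ℝ) : ℝ := pp ((x - z) / ε) - pp ((x - y) / ε)
noncomputable def Ps1 (ε z y x : ℝ) : ℝ := kk ((x - z) / ε) / ε - kk ((x - y) / ε) / ε
noncomputable def Ps2 (ε z y x : ℝ) : ℝ :=
  deriv kk ((x - z) / ε) / ε / ε - deriv kk ((x - y) / ε) / ε / ε

lemma kk_deriv (x : ℝ) : HasDerivAt kk (deriv kk x) x :=
  (((kk_contDiff 1).differentiable (by norm_num)) x).hasDerivAt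
lemma kk_deriv_cont : Continuous (deriv kk) := (kk_contDiff 1).continuous_deriv (by norm_num)

section
variable {ε z y : ℝ}

lemma scal_deriv (ε z x : ℝ) : HasDerivAt (fun x => (x - z) / ε) (1 / ε) x :=
  ((hasDerivAt_id x).sub_const z).div_const ε
lemma Ps_d (x : ℝ) : HasDerivAt (Ps ε z y) (Ps1 ε z y x) x := by
  have h1 := (pp_deriv ((x - z) / ε)).comp x (scal_deriv ε z x)
  have h2 := (pp_deriv ((x - y) / ε)).comp x (scal_deriv ε y x)
  exact (h1.sub h2).congr_deriv (by simp only [Ps1]; ring)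
lemma Ps1_d (x : ℝ) : HasDerivAt (Ps1 ε z y) (Ps2 ε z y x) x := by
  have h1 := ((kk_deriv ((x - z) / ε)).comp x (scal_deriv ε z x)).div_const ε
  have h2 := ((kk_deriv ((x - y) / ε)).comp x (scal_deriv ε y x)).div_const ε
  exact (h1.sub h2).congr_deriv (by simp only [Ps2]; ring)
lemma Ps2_c : Continuous (Ps2 ε z y) := by
  have := kk_deriv_cont
  unfold Ps2; fun_prop
lemma Ps_c : Continuous (Ps ε z y) := continuous_iff_continuousAt.2 fun x => (Ps_d x).continuousAt
lemma Ps1_c : Continuous (Ps1 ε z y) := continuous_iff_continuousAt.2 fun x => (Ps1_d x).continuousAt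
lemma Ps_nonneg (hε : 0 < ε) (hzy : z ≤ y) (x : ℝ) : 0 ≤ Ps ε z y x := by
  unfold Ps
  have := pp_mono (by gcongr : (x - y) / ε ≤ (x - z) / ε)
  linarith
lemma Ps_abs (x : ℝ) : |Ps ε z y x| ≤ 1 := by
  unfold Ps
  rw [abs_le]
  constructor <;> linarith [pp_nonneg ((x - z) / ε), pp_nonneg ((x - y) / ε),
    pp_le_one ((x - z) / ε), pp_le_one ((x - y) / ε)]
lemma Ps_left (hε : 0 < ε) (hzy : z ≤ y) {x : ℝ} (hx : x ≤ z) : Ps ε z y x = 0 := by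
  unfold Ps
  rw [pp_zero, pp_zero, sub_zero]
  · exact div_nonpos_of_nonpos_of_nonneg (by linarith) hε.le
  · exact div_nonpos_of_nonpos_of_nonneg (by linarith) hε.le
lemma Ps_right (hε : 0 < ε) (hzy : z ≤ y) {x : ℝ} (hx : y + ε ≤ x) : Ps ε z y x = 0 := by
  unfold Ps
  rw [pp_one, pp_one, sub_self]
  · rw [le_div_iff₀ hε]; linarith
  · rw [le_div_iff₀ hε]; linarith
lemma Ps1_left (hε : 0 < ε) (hzy : z ≤ y) {x : ℝ} (hx : x ≤ z) : Ps1 ε z y x = 0 := by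
  unfold Ps1
  rw [kk_zero_left, kk_zero_left]; · simp
  · exact div_nonpos_of_nonpos_of_nonneg (by linarith) hε.le
  · exact div_nonpos_of_nonpos_of_nonneg (by linarith) hε.le
lemma Ps1_right (hε : 0 < ε) (hzy : z ≤ y) {x : ℝ} (hx : y + ε ≤ x) : Ps1 ε z y x = 0 := by
  unfold Ps1
  rw [kk_zero_right, kk_zero_right]; · simp
  · rw [le_div_iff₀ hε]; linarith
  · rw [le_div_iff₀ hε]; linarith
lemma deriv_kk_left {x : ℝ} (h : x ≤ 0) : deriv kk x = 0 := by
  by_contra hne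
  rcases h.lt_or_eq with h | h
  · apply hne
    have : kk =ᶠ[𝓝 x] fun _ => 0 := by
      filter_upwards [Iio_mem_nhds h] with y hy using kk_zero_left (le_of_lt hy)
    rw [this.deriv_eq]; simp
  · apply hne
    have hm : IsLocalMin kk x := by
      apply Eventually.of_forall; intro y; rw [kk_zero_left h.le]; exact kk_nonneg y
    exact hm.deriv_eq_zero
lemma deriv_kk_right {x : ℝ} (h : 1 ≤ x) : deriv kk x = 0 := by
  have hm : IsLocalMin kk x := by
    apply Eventually.of_forall; intro y; rw [kk_zero_right h]; exact kk_nonneg y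
  exact hm.deriv_eq_zero
lemma Ps2_left (hε : 0 < ε) (hzy : z ≤ y) {x : ℝ} (hx : x ≤ z) : Ps2 ε z y x = 0 := by
  unfold Ps2
  rw [deriv_kk_left, deriv_kk_left]; · simp
  · exact div_nonpos_of_nonpos_of_nonneg (by linarith) hε.le
  · exact div_nonpos_of_nonpos_of_nonneg (by linarith) hε.le
lemma Ps2_right (hε : 0 < ε) (hzy : z ≤ y) {x : ℝ} (hx : y + ε ≤ x) : Ps2 ε z y x = 0 := by
  unfold Ps2
  rw [deriv_kk_right, deriv_kk_right]; · simp
  · rw [le_div_iff₀ hε]; linarith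
  · rw [le_div_iff₀ hε]; linarith
lemma Ps2_bdd (ε : ℝ) (hε : 0 < ε) : ∃ C, 0 < C ∧ ∀ z y x, |Ps2 ε z y x| ≤ C := by
  obtain ⟨C, hC, _, h2⟩ := kk_bound
  refine ⟨2 * (C / ε / ε), by positivity, fun z y x => ?_⟩
  unfold Ps2
  refine (abs_sub _ _).trans ?_
  have : ∀ w, |deriv kk w / ε / ε| ≤ C / ε / ε := fun w => by
    rw [abs_div, abs_div, abs_of_pos hε]; gcongr; exact h2 w
  linarith [this ((x - z) / ε), this ((x - y) / ε)]
end

/-- regularised sign -/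
noncomputable def ed (δ v : ℝ) : ℝ := pp (v / δ) - pp (-v / δ)
noncomputable def hd (δ v : ℝ) : ℝ := δ * HH (v / δ) + δ * HH (-v / δ)
noncomputable def jd (δ v : ℝ) : ℝ := kk (v / δ) / δ + kk (-v / δ) / δ

section
variable {δ : ℝ}
lemma hd_d (hδ : 0 < δ) (v : ℝ) : HasDerivAt (hd δ) (ed δ v) v := by
  have h1 := ((HH_deriv (v / δ)).comp v ((hasDerivAt_id v).div_const δ)).const_mul δ
  have h2 := ((HH_deriv (-v / δ)).comp v ((hasDerivAt_id v).neg.div_const δ)).const_mul δ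
  refine (h1.add h2).congr_deriv ?_
  simp only [ed]; field_simp; ring
lemma ed_d (v : ℝ) : HasDerivAt (ed δ) (jd δ v) v := by
  have h1 := ((pp_deriv (v / δ)).comp v ((hasDerivAt_id v).div_const δ))
  have h2 := ((pp_deriv (-v / δ)).comp v ((hasDerivAt_id v).neg.div_const δ))
  refine (h1.sub h2).congr_deriv ?_
  simp only [jd]; ring
lemma jd_c : Continuous (jd δ) := by
  have := kk_cont
  unfold jd; fun_prop
lemma ed_c : Continuous (ed δ) := continuous_iff_continuousAt.2 fun x => (ed_d x).continuousAt
lemma jd_0 (hδ : 0 < δ) (v : ℝ) : 0 ≤ jd δ v :=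
  add_nonneg (div_nonneg (kk_nonneg _) hδ.le) (div_nonneg (kk_nonneg _) hδ.le)
lemma ed_abs (v : ℝ) : |ed δ v| ≤ 1 := by
  unfold ed
  rw [abs_le]
  constructor <;> linarith [pp_nonneg (v / δ), pp_nonneg (-v / δ),
    pp_le_one (v / δ), pp_le_one (-v / δ)]
lemma ed_pos (hδ : 0 < δ) {v : ℝ} (hv : 0 ≤ v) : 0 ≤ ed δ v := by
  unfold ed
  rw [pp_zero (x := -v / δ)]
  · simpa using pp_nonneg _
  · exact div_nonpos_of_nonpos_of_nonneg (by linarith) hδ.le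
lemma ed_odd (v : ℝ) : ed δ (-v) = - ed δ v := by unfold ed; rw [neg_neg]; ring
lemma hd_even (v : ℝ) : hd δ (-v) = hd δ v := by unfold hd; rw [neg_neg]; ring
lemma hd_bd0 (hδ : 0 < δ) {v : ℝ} (hv : 0 ≤ v) : v - δ ≤ hd δ v ∧ hd δ v ≤ v := by
  unfold hd
  rw [HH_zero (x := -v / δ) (div_nonpos_of_nonpos_of_nonneg (by linarith) hδ.le)]
  have h1 := HH_ge (v / δ)
  have h2 := HH_le (x := v / δ) (by positivity)
  have h3 : δ * (v / δ) = v := by field_simp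
  constructor <;> nlinarith
lemma hd_bd (hδ : 0 < δ) (v : ℝ) : |v| - δ ≤ hd δ v ∧ hd δ v ≤ |v| := by
  rcases le_total 0 v with h | h
  · rw [abs_of_nonneg h]; exact hd_bd0 hδ h
  · rw [abs_of_nonpos h, ← hd_even]; exact hd_bd0 hδ (by linarith)
lemma ed_mul0 (hδ : 0 < δ) {v : ℝ} (hv : 0 ≤ v) : v - δ ≤ ed δ v * v := by
  rcases le_total v δ with h | h
  · have := mul_nonneg (ed_pos hδ hv) hv; linarith
  · have : ed δ v = 1 := by
      unfold ed
      rw [pp_zero (x := -v / δ) (div_nonpos_of_nonpos_of_nonneg (by linarith) hδ.le), pp_one, sub_zero]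
      rw [le_div_iff₀ hδ]; linarith
    rw [this]; linarith
lemma ed_mul (hδ : 0 < δ) (v : ℝ) : |v| - δ ≤ ed δ v * v := by
  rcases le_total 0 v with h | h
  · rw [abs_of_nonneg h]; exact ed_mul0 hδ h
  · have := ed_mul0 hδ (v := -v) (by linarith)
    rw [abs_of_nonpos h]; rw [ed_odd] at this; linarith

lemma Qd_bd {q : ℝ} (hq : 1 < q) (hδ : 0 < δ) (v : ℝ) :
    0 ≤ prim (fun s => ed δ s * |s| ^ (q - 1)) v ∧
    prim (fun s => ed δ s * |s| ^ (q - 1)) v ≤ |v| ^ q := by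
  have hc : Continuous fun s => ed δ s * |s| ^ (q - 1) := ed_c.mul (absrpow_cont (by linarith))
  constructor
  · unfold prim
    rcases le_total 0 v with h | h
    · exact intervalIntegral.integral_nonneg h fun x hx =>
        mul_nonneg (ed_pos hδ hx.1) (by positivity)
    · rw [intervalIntegral.integral_symm, ← intervalIntegral.integral_neg]
      refine intervalIntegral.integral_nonneg h fun x hx => ?_
      have := ed_pos hδ (v := -x) (by linarith [hx.2])
      rw [ed_odd] at this
      have h2 : 0 ≤ |x| ^ (q - 1) := by positivity
      nlinarith
  · have := prim_sub_le hc (N := |v|) (A := |v| ^ (q - 1)) (x := v) (y := 0) (fun s hs => by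
      rw [abs_mul]
      have h1 := rpow_abs_le (by linarith : 0 < q - 1) hs
      rw [abs_of_nonneg (by positivity : 0 ≤ |s| ^ (q - 1))]
      calc _ ≤ 1 * |s| ^ (q - 1) := by gcongr; exact ed_abs s
        _ ≤ _ := by linarith) le_rfl (by simp)
    have h0 : prim (fun s => ed δ s * |s| ^ (q - 1)) 0 = 0 := by simp [prim]
    rw [h0, sub_zero, sub_zero] at this
    refine (le_abs_self _).trans (this.trans (le_of_eq ?_))
    rcases eq_or_ne v 0 with h | h
    · subst h; simp; rw [Real.zero_rpow (by linarith)]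
    · rw [← Real.rpow_add_one (by simpa using h)]; congr 1; ring
end

/-! nonlocal part -/
section
variable {k : ℝ → ℝ} {v Ψ : ℝ → ℝ}

/-- shifted mass -/
noncomputable def nm (v Ψ : ℝ → ℝ) (c : ℝ) : ℝ := ∫ x, |v x| * Ψ (x - c)

lemma conv_int (hk : Integrable k) (hv : Integrable v) :
    Integrable (fun p : ℝ × ℝ => k p.2 * v (p.1 - p.2)) (volume.prod volume) :=
  Integrable.convolution_integrand (ContinuousLinearMap.mul ℝ ℝ) hk hv

lemma conv_eq (k v : ℝ → ℝ) (x : ℝ) : ∫ y, k (x - y) * v y = ∫ c, k c * v (x - c) := by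
  rw [← integral_sub_left_eq_self _ volume x]
  simp

lemma conv_int1 (hk : Integrable k) (hv : Integrable v) :
    Integrable (fun x => ∫ y, k (x - y) * v y) := by
  simp_rw [conv_eq k v]
  exact (conv_int hk hv).integral_prod_left

lemma nm_fubini (hk : Integrable k) (hke : ∀ x, k (-x) = k x) (hv : Integrable v)
    (hΨc : Continuous Ψ) (hΨ : ∀ x, |Ψ x| ≤ 1) :
    ∫ x, Ψ x * ∫ y, k (x - y) * |v y| = ∫ c, k c * nm v Ψ c := by
  simp_rw [conv_eq k (fun y => |v y|)]
  have h1 : Integrable (fun p : ℝ × ℝ => Ψ p.1 * (k p.2 * |v (p.1 - p.2)|))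
      (volume.prod volume) := by
    refine (conv_int hk hv.abs).bdd_mul (c := 1) ?_ ?_
    · exact (hΨc.comp continuous_fst).aestronglyMeasurable
    · exact Eventually.of_forall fun p => hΨ p.1
  calc ∫ x, Ψ x * ∫ c, k c * |v (x - c)| = ∫ x, ∫ c, Ψ x * (k c * |v (x - c)|) := by
        congr 1; ext x; rw [integral_const_mul]
    _ = ∫ c, ∫ x, Ψ x * (k c * |v (x - c)|) := integral_integral_swap h1
    _ = ∫ c, k c * nm v Ψ (-c) := by
        congr 1; ext c
        have : ∀ x, Ψ x * (k c * |v (x - c)|) = k c * (|v (x - c)| * Ψ ((x - c) - (-c))) := by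
          intro x; rw [sub_neg_eq_add, sub_add_cancel]; ring
        simp_rw [this]
        rw [integral_const_mul]
        congr 1
        unfold nm
        exact integral_sub_right_eq_self (fun x => |v x| * Ψ (x - -c)) c
    _ = ∫ c, k c * nm v Ψ c := by
        rw [← integral_neg_eq_self]
        congr 1; ext c; rw [hke, neg_neg]

lemma nm_int (hv : Integrable v) (hΨc : Continuous Ψ) {B : ℝ} (hΨ : ∀ x, |Ψ x| ≤ B) (c : ℝ) :
    Integrable (fun x => |v x| * Ψ (x - c)) := by
  refine hv.abs.mul_bdd (c := B) ?_ ?_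
  · exact (hΨc.comp (continuous_id.sub continuous_const)).aestronglyMeasurable
  · exact Eventually.of_forall fun x => hΨ _

lemma nm_diff {w : ℝ → ℝ} (hv : Integrable v) (hw : Integrable w) (hΨc : Continuous Ψ) {B : ℝ}
    (hΨ : ∀ x, |Ψ x| ≤ B) (c : ℝ) : |nm v Ψ c - nm w Ψ c| ≤ B * ∫ x, |v x - w x| := by
  unfold nm
  rw [← integral_sub (nm_int hv hΨc hΨ c) (nm_int hw hΨc hΨ c), ← integral_const_mul]
  refine abs_integral_le_integral_abs.trans (integral_mono ?_ ((hv.sub hw).abs.const_mul B) ?_)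
  · exact ((nm_int hv hΨc hΨ c).sub (nm_int hw hΨc hΨ c)).abs
  · intro x
    show |(|v x| * Ψ (x - c)) - |w x| * Ψ (x - c)| ≤ B * |v x - w x|
    rw [← sub_mul, abs_mul, mul_comm]
    exact mul_le_mul (hΨ _) (abs_abs_sub_abs_le _ _) (abs_nonneg _) ((abs_nonneg _).trans (hΨ 0))

lemma nm_cont (hv : Integrable v) (hΨc : Continuous Ψ) {B : ℝ} (hΨ : ∀ x, |Ψ x| ≤ B) :
    Continuous (nm v Ψ) := by
  unfold nm
  apply continuous_of_dominated (bound := fun x => |v x| * B)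
  · exact fun c => (nm_int hv hΨc hΨ c).aestronglyMeasurable
  · intro c; refine Eventually.of_forall fun x => ?_
    rw [norm_mul, Real.norm_eq_abs, abs_abs]
    exact mul_le_mul_of_nonneg_left (hΨ _) (abs_nonneg _)
  · exact hv.abs.mul_const B
  · exact Eventually.of_forall fun x => by fun_prop

lemma nm_bdd (hv : Integrable v) (hΨc : Continuous Ψ) {B : ℝ} (hΨ : ∀ x, |Ψ x| ≤ B) (c : ℝ) :
    |nm v Ψ c| ≤ B * ∫ x, |v x| := by
  have := nm_diff hv (integrable_zero ℝ ℝ volume) hΨc hΨ c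
  simpa [nm] using this

lemma knm_int (hk : Integrable k) (hv : Integrable v) (hΨc : Continuous Ψ) {B : ℝ}
    (hΨ : ∀ x, |Ψ x| ≤ B) : Integrable fun c => k c * nm v Ψ c := by
  refine hk.mul_bdd (c := B * ∫ x, |v x|) (nm_cont hv hΨc hΨ).aestronglyMeasurable ?_
  exact Eventually.of_forall fun c => nm_bdd hv hΨc hΨ c
end

/-- nonlocal source -/
noncomputable def gn (k : ℝ → ℝ) (ρ : ℝ) (u : ℝ → ℝ → ℝ) (r x : ℝ) : ℝ :=
  ρ * ((∫ y, k (x - y) * u r y) - u r x)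

/-- dual linear part -/
noncomputable def LL (μ ρ : ℝ) (k v : ℝ → ℝ) (ε z y : ℝ) : ℝ :=
  μ * nm v (Ps2 ε z y) 0 + ρ * ((∫ c, k c * nm v (Ps ε z y) c) - nm v (Ps ε z y) 0)

/-- the flux into the window at the left end -/
noncomputable def Fl (q ε z y : ℝ) (v : ℝ → ℝ) : ℝ :=
  ∫ x in Set.Icc z (y + ε), |v x| ^ q * (kk ((x - z) / ε) / ε)

lemma Icc_add_const {a b : ℝ} (hab : a ≤ b) {f : ℝ → ℝ} (hf : IntegrableOn f (Set.Icc a b)) (c : ℝ) :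
    ∫ x in Set.Icc a b, (f x + c) = (∫ x in Set.Icc a b, f x) + c * (b - a) := by
  rw [integral_add hf (continuous_const.integrableOn_Icc)]
  simp [hab, mul_comm]

lemma nm_Icc {v Ψ : ℝ → ℝ} {α β : ℝ} (hl : ∀ x, x ≤ α → Ψ x = 0) (hr : ∀ x, β ≤ x → Ψ x = 0) :
    nm v Ψ 0 = ∫ x in Set.Icc α β, |v x| * Ψ x := by
  unfold nm
  simp only [sub_zero]
  rw [setIntegral_eq_integral_of_forall_compl_eq_zero]
  intro x hx
  rw [Set.mem_Icc, not_and_or] at hx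
  rcases hx with h | h
  · rw [hl x (not_le.1 h).le, mul_zero]
  · rw [hr x (not_le.1 h).le, mul_zero]

lemma lemC_loc {q μ ε z y δ C2 : ℝ} (hq : 1 < q) (hμ : 0 < μ) (hε : 0 < ε) (hzy : z ≤ y)
    (hδ : 0 < δ) (hC2 : ∀ x, |Ps2 ε z y x| ≤ C2) {v v1 v2 : ℝ → ℝ}
    (hv : ∀ x, HasDerivAt v (v1 x) x) (hv1 : ∀ x, HasDerivAt v1 (v2 x) x) (hv2c : Continuous v2) :
    (∫ x in z..(y + ε), ed δ (v x) * Ps ε z y x * (μ * v2 x - |v x| ^ (q - 1) * v1 x)) ≤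
      μ * nm v (Ps2 ε z y) 0 + Fl q ε z y v + δ * (μ * C2 * (y + ε - z)) := by
  have hab : z ≤ y + ε := by linarith
  have h1 := lemCfix hq hμ hab (hd_d hδ) ed_d jd_c (jd_0 hδ) hv hv1 hv2c (Ps_d (ε := ε) (z := z)
    (y := y)) Ps1_d Ps2_c (Ps_nonneg hε hzy) (Ps_left hε hzy le_rfl) (Ps_right hε hzy le_rfl)
    (Ps1_left hε hzy le_rfl) (Ps1_right hε hzy le_rfl)
  refine h1.trans ?_
  have hvc : Continuous v := continuous_iff_continuousAt.2 fun x => (hv x).continuousAt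
  have hhc : Continuous (hd δ) := continuous_iff_continuousAt.2 fun x => (hd_d hδ x).continuousAt
  have hQc : Continuous (prim fun s => ed δ s * |s| ^ (q - 1)) :=
    prim_cont (ed_c.mul (absrpow_cont (by linarith)))
  have hkc : Continuous fun x => kk ((x - z) / ε) / ε := by have := kk_cont; fun_prop
  have hvq : Continuous fun x => |v x| ^ q := (absrpow_cont (by linarith : 0 < q)).comp hvc
  have hP2 : Continuous (Ps2 ε z y) := Ps2_c
  have hP1 : Continuous (Ps1 ε z y) := Ps1_c
  have hQvc := hQc.comp hvc
  have hhvc := hhc.comp hvc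
  rw [← int_Icc_eq hab]
  have c1 : Continuous fun x => μ * (|v x| * Ps2 ε z y x) := by fun_prop
  have c2 : Continuous fun x => |v x| ^ q * (kk ((x - z) / ε) / ε) := hvq.mul hkc
  calc _ ≤ ∫ x in Set.Icc z (y + ε), ((μ * (|v x| * Ps2 ε z y x) +
          |v x| ^ q * (kk ((x - z) / ε) / ε)) + δ * (μ * C2)) := by
        apply setIntegral_mono
        · exact (((continuous_const.mul (hhvc.mul hP2)).add (hQvc.mul hP1))).integrableOn_Icc
        · exact ((c1.add c2).add continuous_const).integrableOn_Icc
        · intro x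
          show μ * (hd δ (v x) * Ps2 ε z y x) + prim (fun s => ed δ s * |s| ^ (q - 1)) (v x) *
            Ps1 ε z y x ≤ _
          have a1 := hd_bd hδ (v x)
          obtain ⟨a2, a3⟩ := Qd_bd hq hδ (v x)
          have a4 : hd δ (v x) * Ps2 ε z y x ≤ |v x| * Ps2 ε z y x + δ * C2 := by
            have : (hd δ (v x) - |v x|) * Ps2 ε z y x ≤ δ * C2 := by
              refine (le_abs_self _).trans ?_
              rw [abs_mul]
              exact mul_le_mul (by rw [abs_le]; constructor <;> linarith) (hC2 x) (abs_nonneg _) hδ.le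
            linarith
          have b1 : 0 ≤ kk ((x - z) / ε) / ε := div_nonneg (kk_nonneg _) hε.le
          have b2 : 0 ≤ kk ((x - y) / ε) / ε := div_nonneg (kk_nonneg _) hε.le
          have a5 : prim (fun s => ed δ s * |s| ^ (q - 1)) (v x) * Ps1 ε z y x ≤
              |v x| ^ q * (kk ((x - z) / ε) / ε) := by
            unfold Ps1
            nlinarith [mul_nonneg a2 b2]
          nlinarith
    _ = _ := by
        rw [Icc_add_const hab (f := fun x => μ * (|v x| * Ps2 ε z y x) +
          |v x| ^ q * (kk ((x - z) / ε) / ε)) (c1.add c2).integrableOn_Icc,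
          integral_add c1.integrableOn_Icc c2.integrableOn_Icc, integral_const_mul,
          nm_Icc (fun x => Ps2_left hε hzy) (fun x => Ps2_right hε hzy)]
        simp only [Fl]; ring

lemma lemC_nl {ρ ε z y δ : ℝ} {k : ℝ → ℝ} (hk : Integrable k) (hk0 : ∀ x, 0 ≤ k x)
    (hke : ∀ x, k (-x) = k x) (hρ : 0 ≤ ρ) (hε : 0 < ε) (hzy : z ≤ y)
    (hδ : 0 < δ) {v : ℝ → ℝ} (hvc : Continuous v) (hvi : Integrable v) :
    (∫ x in Set.Icc z (y + ε), ed δ (v x) * Ps ε z y x * (ρ * ((∫ y, k (x - y) * v y) - v x))) ≤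
      ρ * ((∫ c, k c * nm v (Ps ε z y) c) - nm v (Ps ε z y) 0) + δ * (ρ * (y + ε - z)) := by
  have hab : z ≤ y + ε := by linarith
  have hPc : Continuous (Ps ε z y) := Ps_c
  have i1 : IntegrableOn (fun x => Ps ε z y x * ∫ y, k (x - y) * |v y|) (Set.Icc z (y + ε)) :=
    IntegrableOn.continuousOn_mul hPc.continuousOn (conv_int1 hk hvi.abs).integrableOn isCompact_Icc
  have i2 : IntegrableOn (fun x => |v x| * Ps ε z y x) (Set.Icc z (y + ε)) :=
    (hvc.abs.mul hPc).integrableOn_Icc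
  calc _ ≤ ∫ x in Set.Icc z (y + ε), (ρ * ((Ps ε z y x * ∫ y, k (x - y) * |v y|) -
          |v x| * Ps ε z y x) + δ * ρ) := by
        apply setIntegral_mono
        · refine IntegrableOn.continuousOn_mul ((ed_c.comp hvc).mul hPc).continuousOn ?_ isCompact_Icc
          exact (((conv_int1 hk hvi).sub hvi).const_mul ρ).integrableOn
        · exact ((i1.sub i2).const_mul ρ).add continuous_const.integrableOn_Icc
        · intro x
          show ed δ (v x) * Ps ε z y x * (ρ * ((∫ y, k (x - y) * v y) - v x)) ≤ _
          have a0 := Ps_nonneg hε hzy x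
          have a1 := ed_mul hδ (v x)
          have a1' : Ps ε z y x ≤ 1 := (le_abs_self _).trans (Ps_abs x)
          have a2 : ed δ (v x) * ∫ y, k (x - y) * v y ≤ ∫ y, k (x - y) * |v y| := by
            refine (le_abs_self _).trans ?_
            rw [abs_mul]
            have : |∫ y, k (x - y) * v y| ≤ ∫ y, k (x - y) * |v y| := by
              refine abs_integral_le_integral_abs.trans (le_of_eq ?_)
              congr 1; ext y; rw [abs_mul, abs_of_nonneg (hk0 _)]
            calc _ ≤ 1 * ∫ y, k (x - y) * |v y| :=
                  mul_le_mul (ed_abs _) this (abs_nonneg _) zero_le_one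
              _ = _ := one_mul _
          have a3 : ed δ (v x) * ((∫ y, k (x - y) * v y) - v x) ≤
              (∫ y, k (x - y) * |v y|) - |v x| + δ := by linarith
          have a4 := mul_le_mul_of_nonneg_left a3 (mul_nonneg hρ a0)
          have a5 : ρ * Ps ε z y x * δ ≤ δ * ρ := by
            have := mul_nonneg hρ hδ.le
            nlinarith
          linarith
    _ = _ := by
        rw [Icc_add_const hab (f := fun x => ρ * ((Ps ε z y x * ∫ y, k (x - y) * |v y|) -
          |v x| * Ps ε z y x)) ((i1.sub i2).const_mul ρ),
          integral_const_mul, integral_sub i1 i2, ← nm_fubini hk hke hvi hPc Ps_abs,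
          nm_Icc (fun x => Ps_left hε hzy) (fun x => Ps_right hε hzy)]
        rw [setIntegral_eq_integral_of_forall_compl_eq_zero (f := fun x => Ps ε z y x * ∫ y, k (x - y) * |v y|)]
        · ring
        · intro x hx
          rw [Set.mem_Icc, not_and_or] at hx
          rcases hx with h | h
          · rw [Ps_left hε hzy (not_le.1 h).le, zero_mul]
          · rw [Ps_right hε hzy (not_le.1 h).le, zero_mul]

section
variable {q μ ρ : ℝ} {k : ℝ → ℝ} {u : ℝ → ℝ → ℝ}

lemma Sol.nm_cont (S : Sol q μ u (gn k ρ u)) {Ψ : ℝ → ℝ} (hΨc : Continuous Ψ) {B : ℝ}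
    (hΨ : ∀ x, |Ψ x| ≤ B) (c : ℝ) {r : ℝ} (hr : 0 < r) :
    ContinuousAt (fun r => nm (u r) Ψ c) r := by
  unfold ContinuousAt
  rw [tendsto_iff_norm_sub_tendsto_zero]
  have lim := (S.l1 r hr).const_mul B
  rw [mul_zero] at lim
  refine squeeze_zero' (Eventually.of_forall fun _ => norm_nonneg _) ?_ lim
  filter_upwards [Ioi_mem_nhds hr] with r' hr'
  exact nm_diff (S.int r' hr') (S.int r hr) hΨc hΨ c

lemma Sol.knm_cont (S : Sol q μ u (gn k ρ u)) (hk : Integrable k) {Ψ : ℝ → ℝ}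
    (hΨc : Continuous Ψ) {B : ℝ}
    (hΨ : ∀ x, |Ψ x| ≤ B) {r : ℝ} (hr : 0 < r) :
    ContinuousAt (fun r => ∫ c, k c * nm (u r) Ψ c) r := by
  unfold ContinuousAt
  rw [tendsto_iff_norm_sub_tendsto_zero]
  have lim := (S.l1 r hr).const_mul ((∫ c, |k c|) * B)
  rw [mul_zero] at lim
  refine squeeze_zero' (Eventually.of_forall fun _ => norm_nonneg _) ?_ lim
  filter_upwards [Ioi_mem_nhds hr] with r' hr'
  have i1 := knm_int hk (S.int r' hr') hΨc hΨ
  have i2 := knm_int hk (S.int r hr) hΨc hΨ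
  rw [← integral_sub i1 i2, Real.norm_eq_abs, mul_assoc, ← integral_mul_const]
  refine abs_integral_le_integral_abs.trans (integral_mono (i1.sub i2).abs (hk.abs.mul_const _) ?_)
  intro c
  show |k c * nm (u r') Ψ c - k c * nm (u r) Ψ c| ≤ |k c| * (B * ∫ x, |u r' x - u r x|)
  rw [← mul_sub, abs_mul]
  exact mul_le_mul_of_nonneg_left (nm_diff (S.int r' hr') (S.int r hr) hΨc hΨ c) (abs_nonneg _)

lemma Sol.LL_cont (S : Sol q μ u (gn k ρ u)) (hk : Integrable k) {ε : ℝ} (hε : 0 < ε) (z y : ℝ)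
    {r : ℝ} (hr : 0 < r) : ContinuousAt (fun r => LL μ ρ k (u r) ε z y) r := by
  obtain ⟨C2, _, hC2⟩ := Ps2_bdd ε hε
  unfold LL
  exact ((S.nm_cont Ps2_c (hC2 z y) 0 hr).const_mul μ).add
    (((S.knm_cont hk Ps_c Ps_abs hr).sub (S.nm_cont Ps_c Ps_abs 0 hr)).const_mul ρ)

/-- Lemma C -/
lemma lemC (S : Sol q μ u (gn k ρ u)) (hq : 1 < q) (hμ : 0 < μ) (hk : Integrable k)
    (hk0 : ∀ x, 0 ≤ k x) (hke : ∀ x, k (-x) = k x) (hρ : 0 ≤ ρ) {ε z y s t : ℝ} (hε : 0 < ε)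
    (hzy : z ≤ y) (hs : 0 < s) (hst : s ≤ t) {P : ℝ → ℝ} (hP : IntegrableOn P (Set.Icc s t))
    (hPb : ∀ r ∈ Set.Icc s t, Fl q ε z y (u r) ≤ P r) :
    nm (u t) (Ps ε z y) 0 - nm (u s) (Ps ε z y) 0 ≤
      ∫ r in s..t, (P r + LL μ ρ k (u r) ε z y) := by
  have hab : z ≤ y + ε := by linarith
  obtain ⟨C2, hC20, hC2⟩ := Ps2_bdd ε hε
  have hLc : ContinuousOn (fun r => LL μ ρ k (u r) ε z y) (Set.Icc s t) := fun r hr =>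
    (S.LL_cont hk hε z y (hs.trans_le hr.1)).continuousWithinAt
  have hLi : IntegrableOn (fun r => LL μ ρ k (u r) ε z y) (Set.Icc s t) := hLc.integrableOn_Icc
  set Cc := (μ * C2 * (y + ε - z)) + (ρ * (y + ε - z)) with hCc
  have hPc : Continuous (Ps ε z y) := Ps_c
  have ht : 0 < t := hs.trans_le hst
  have key : ∀ δ, 0 < δ → nm (u t) (Ps ε z y) 0 - nm (u s) (Ps ε z y) 0 ≤
      (∫ r in s..t, (P r + LL μ ρ k (u r) ε z y)) + δ * (Cc * (t - s) + (y + ε - z)) := by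
    intro δ hδ
    have h1 := cl_comp S hq hμ hab hs hst (η := hd δ) (e := ed δ) (Ψ := Ps ε z y) (A := 1)
      zero_le_one (hd_d hδ) ed_c ed_abs hPc Ps_abs
      (G := fun r => (P r + LL μ ρ k (u r) ε z y) + δ * Cc)
      ((hP.add hLi).add continuous_const.integrableOn_Icc) (by
        intro r hr
        have hr0 := hs.trans_le hr.1
        have a1 := lemC_loc hq hμ hε hzy hδ (hC2 z y) (S.d1 hr0) (S.d2 hr0) (S.d2c hr0)
        have a2 := lemC_nl hk hk0 hke hρ hε hzy hδ (S.cont hr0) (S.int r hr0)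
        have a3 := hPb r hr
        refine (add_le_add a1 a2).trans ?_
        simp only [LL, hCc]
        linarith)
    rw [← int_Icc_eq hst, Icc_add_const hst (f := fun r => P r + LL μ ρ k (u r) ε z y) (hP.add hLi),
      int_Icc_eq hst] at h1
    have hhc : Continuous (hd δ) := continuous_iff_continuousAt.2 fun x => (hd_d hδ x).continuousAt
    have h2 : nm (u t) (Ps ε z y) 0 - δ * (y + ε - z) ≤
        ∫ x in Set.Icc z (y + ε), hd δ (u t x) * Ps ε z y x := by
      rw [nm_Icc (fun x => Ps_left hε hzy) (fun x => Ps_right hε hzy)]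
      have : ∫ x in Set.Icc z (y + ε), (|u t x| * Ps ε z y x - δ) ≤
          ∫ x in Set.Icc z (y + ε), hd δ (u t x) * Ps ε z y x := by
        apply setIntegral_mono
        · exact (((S.cont ht).abs.mul hPc).sub continuous_const).integrableOn_Icc
        · exact ((hhc.comp (S.cont ht)).mul hPc).integrableOn_Icc
        · intro x
          have a1 := (hd_bd hδ (u t x)).1
          have a0 := Ps_nonneg hε hzy x
          have a1' : Ps ε z y x ≤ 1 := (le_abs_self _).trans (Ps_abs x)
          show |u t x| * Ps ε z y x - δ ≤ hd δ (u t x) * Ps ε z y x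
          nlinarith
      simp only [sub_eq_add_neg] at this
      rw [Icc_add_const hab (f := fun x => |u t x| * Ps ε z y x)
        ((S.cont ht).abs.mul hPc).integrableOn_Icc] at this
      linarith
    have h3 : ∫ x in Set.Icc z (y + ε), hd δ (u s x) * Ps ε z y x ≤ nm (u s) (Ps ε z y) 0 := by
      rw [nm_Icc (fun x => Ps_left hε hzy) (fun x => Ps_right hε hzy)]
      apply setIntegral_mono
      · exact ((hhc.comp (S.cont hs)).mul hPc).integrableOn_Icc
      · exact ((S.cont hs).abs.mul hPc).integrableOn_Icc
      · intro x
        exact mul_le_mul_of_nonneg_right (hd_bd hδ (u s x)).2 (Ps_nonneg hε hzy x)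
    linarith
  set D := Cc * (t - s) + (y + ε - z) with hD
  have hlim : Tendsto (fun δ : ℝ => (∫ r in s..t, (P r + LL μ ρ k (u r) ε z y)) + δ * D)
      (𝓝[>] 0) (𝓝 (∫ r in s..t, (P r + LL μ ρ k (u r) ε z y))) := by
    have : Continuous fun δ : ℝ => (∫ r in s..t, (P r + LL μ ρ k (u r) ε z y)) + δ * D := by fun_prop
    have h2 := (this.tendsto 0).mono_left (nhdsWithin_le_nhds (s := Set.Ioi 0))
    simpa using h2
  exact ge_of_tendsto hlim (by filter_upwards [self_mem_nhdsWithin] with δ hδ using key δ hδ)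
end

noncomputable def hh (v : ℝ → ℝ) (ε z : ℝ) : ℝ := nm v (fun x => pp (x / ε)) z
noncomputable def AA (v : ℝ → ℝ) (ε z : ℝ) : ℝ := nm v (fun x => kk (x / ε) / ε) z
noncomputable def BB (v : ℝ → ℝ) (ε z : ℝ) : ℝ := nm v (fun x => deriv kk (x / ε) / ε / ε) z

section
variable {v : ℝ → ℝ} {ε : ℝ}

lemma nm_deriv (hv : Integrable v) {Φ Φ1 : ℝ → ℝ} (hΦ : ∀ x, HasDerivAt Φ (Φ1 x) x)
    (hΦ1 : Continuous Φ1) {B B1 : ℝ} (hB : ∀ x, |Φ x| ≤ B) (hB1 : ∀ x, |Φ1 x| ≤ B1) (c : ℝ) :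
    HasDerivAt (nm v Φ) (- nm v Φ1 c) c := by
  have hΦc : Continuous Φ := continuous_iff_continuousAt.2 fun x => (hΦ x).continuousAt
  have h := hasDerivAt_integral_of_dominated_loc_of_deriv_le (μ := volume)
    (F := fun c x => |v x| * Φ (x - c)) (F' := fun c x => - (|v x| * Φ1 (x - c)))
    (bound := fun x => |v x| * B1) (x₀ := c) (s := Set.univ) univ_mem
    (Eventually.of_forall fun c => (nm_int hv hΦc hB c).aestronglyMeasurable)
    (nm_int hv hΦc hB c) (nm_int hv hΦ1 hB1 c).neg.aestronglyMeasurable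
    (Eventually.of_forall fun x c _ => by
      rw [norm_neg, norm_mul, Real.norm_eq_abs, abs_abs]
      exact mul_le_mul_of_nonneg_left (hB1 _) (abs_nonneg _))
    (hv.abs.mul_const B1)
    (Eventually.of_forall fun x c _ => by
      have h1 := ((hΦ (x - c)).comp c ((hasDerivAt_id c).const_sub x)).const_mul |v x|
      exact h1.congr_deriv (by ring))
  refine h.2.congr_deriv ?_
  rw [integral_neg]; rfl

lemma ppe_c : Continuous fun x => pp (x / ε) := by have := pp_cont; fun_prop
lemma ppe_b (x : ℝ) : |pp (x / ε)| ≤ 1 := by rw [abs_of_nonneg (pp_nonneg _)]; exact pp_le_one _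
lemma kke_c : Continuous fun x => kk (x / ε) / ε := by have := kk_cont; fun_prop
lemma dke_c : Continuous fun x => deriv kk (x / ε) / ε / ε := by have := kk_deriv_cont; fun_prop
lemma kke_b (hε : 0 < ε) : ∃ B, ∀ x, |kk (x / ε) / ε| ≤ B := by
  obtain ⟨C, hC, h1, _⟩ := kk_bound
  refine ⟨C / ε, fun x => ?_⟩
  rw [abs_of_nonneg (div_nonneg (kk_nonneg _) hε.le)]; gcongr; exact h1 _
lemma dke_b (hε : 0 < ε) : ∃ B, ∀ x, |deriv kk (x / ε) / ε / ε| ≤ B := by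
  obtain ⟨C, hC, _, h1⟩ := kk_bound
  refine ⟨C / ε / ε, fun x => ?_⟩
  rw [abs_div, abs_div, abs_of_pos hε]; gcongr; exact h1 _

lemma hh_d (hv : Integrable v) (hε : 0 < ε) (z : ℝ) : HasDerivAt (hh v ε) (- AA v ε z) z := by
  obtain ⟨B1, hB1⟩ := kke_b hε
  refine nm_deriv hv (Φ1 := fun x => kk (x / ε) / ε) (fun x => ?_) kke_c ppe_b hB1 z
  have h := (pp_deriv (x / ε)).comp x ((hasDerivAt_id x).div_const ε)
  have e : kk (x / ε) * (1 / ε) = kk (x / ε) / ε := by ring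
  rw [e] at h; exact h

lemma AA_d (hv : Integrable v) (hε : 0 < ε) (z : ℝ) : HasDerivAt (AA v ε) (- BB v ε z) z := by
  obtain ⟨B, hB⟩ := kke_b hε
  obtain ⟨B1, hB1⟩ := dke_b hε
  refine nm_deriv hv (Φ1 := fun x => deriv kk (x / ε) / ε / ε) (fun x => ?_) dke_c hB hB1 z
  exact (((kk_deriv (x / ε)).comp x ((hasDerivAt_id x).div_const ε)).div_const ε).congr_deriv (by ring)

lemma nm_Ps (hv : Integrable v) (z y c : ℝ) :
    nm v (Ps ε z y) c = hh v ε (z + c) - hh v ε (y + c) := by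
  unfold hh nm
  rw [← integral_sub (nm_int hv ppe_c ppe_b (z + c)) (nm_int hv ppe_c ppe_b (y + c))]
  congr 1; ext x
  simp only [Ps]
  rw [show x - c - z = x - (z + c) by ring, show x - c - y = x - (y + c) by ring]; ring

lemma nm_Ps2 (hv : Integrable v) (hε : 0 < ε) (z y : ℝ) :
    nm v (Ps2 ε z y) 0 = BB v ε z - BB v ε y := by
  obtain ⟨B1, hB1⟩ := dke_b hε
  unfold BB nm
  rw [← integral_sub (nm_int hv dke_c hB1 z) (nm_int hv dke_c hB1 y)]
  congr 1; ext x
  simp only [Ps2, sub_zero]; ring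

lemma second_diff {f f1 : ℝ → ℝ} {f2 D : ℝ} (hf : ∀ c, HasDerivAt f (f1 c) c)
    (hf1 : HasDerivAt f1 f2 0) (h : ∀ c, f c + f (-c) - 2 * f 0 ≤ D * c ^ 2) : f2 ≤ D := by
  by_contra hlt
  push Not at hlt
  set m : ℝ → ℝ := fun c => f c + f (-c) - 2 * f 0 - D * c ^ 2 with hm
  have hmd : ∀ c, HasDerivAt m (f1 c - f1 (-c) - 2 * D * c) c := fun c => by
    have a1 := (hf (-c)).comp c (hasDerivAt_neg c)
    have a2 := (((hf c).add a1).sub_const (2 * f 0)).sub ((hasDerivAt_pow 2 c).const_mul D)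
    exact a2.congr_deriv (by simp; ring)
  have hmd1 : deriv m = fun c => f1 c - f1 (-c) - 2 * D * c := funext fun c => (hmd c).deriv
  have hm2 : HasDerivAt (fun c => f1 c - f1 (-c) - 2 * D * c) (2 * f2 - 2 * D) 0 := by
    have hf1' : HasDerivAt f1 f2 (-0) := by simpa using hf1
    have a1 := hf1'.comp (0:ℝ) (hasDerivAt_neg 0)
    have a2 := (hf1.sub a1).sub ((hasDerivAt_id (0:ℝ)).const_mul (2 * D))
    exact a2.congr_deriv (by ring)
  have hmin : IsLocalMin m 0 := by
    apply isLocalMin_of_deriv_deriv_pos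
    · rw [hmd1, hm2.deriv]; linarith
    · rw [hmd1]; simp
    · exact (hmd 0).continuousAt
  have h0 : m 0 = 0 := by simp [hm]; ring
  have hz : m =ᶠ[𝓝 0] fun _ => 0 := by
    filter_upwards [hmin] with c hc
    rw [h0] at hc
    refine le_antisymm ?_ hc
    simp only [hm]; linarith [h c]
  have hz2 : deriv m =ᶠ[𝓝 0] deriv (fun _ => (0:ℝ)) := hz.deriv
  have : deriv (deriv m) 0 = 0 := by
    rw [hz2.deriv_eq]; simp
  rw [hmd1, hm2.deriv] at this
  linarith

lemma LL_bound {μ ρ D z y : ℝ} {k : ℝ → ℝ} (hv : Integrable v) (hε : 0 < ε) (hμ : 0 < μ)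
    (hρ : 0 ≤ ρ) (hk : Integrable k) (hk0 : ∀ x, 0 ≤ k x) (hke : ∀ x, k (-x) = k x)
    (hk1 : ∫ x, k x = 1) (hk2 : Integrable fun c => c ^ 2 * k c)
    (h : ∀ c, nm v (Ps ε z y) c + nm v (Ps ε z y) (-c) - 2 * nm v (Ps ε z y) 0 ≤ 2 * D * c ^ 2) :
    LL μ ρ k v ε z y ≤ μ * (2 * D) + ρ * (D * ∫ c, c ^ 2 * k c) := by
  unfold LL
  have h1 : nm v (Ps2 ε z y) 0 ≤ 2 * D := by
    rw [nm_Ps2 hv hε]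
    refine second_diff (f := nm v (Ps ε z y)) (f1 := fun c => - AA v ε (z + c) + AA v ε (y + c))
      (fun c => ?_) ?_ h
    · have e : nm v (Ps ε z y) = fun c => hh v ε (z + c) - hh v ε (y + c) :=
        funext fun c => nm_Ps hv z y c
      rw [e]
      have a1 := (hh_d hv hε (z + c)).comp c ((hasDerivAt_id c).const_add z)
      have a2 := (hh_d hv hε (y + c)).comp c ((hasDerivAt_id c).const_add y)
      exact (a1.sub a2).congr_deriv (by ring)
    · have a1 := (AA_d hv hε (z + 0)).comp (0:ℝ) ((hasDerivAt_id (0:ℝ)).const_add z)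
      have a2 := (AA_d hv hε (y + 0)).comp (0:ℝ) ((hasDerivAt_id (0:ℝ)).const_add y)
      exact (a1.neg.add a2).congr_deriv (by simp only [add_zero]; ring)
  have h2 : (∫ c, k c * nm v (Ps ε z y) c) - nm v (Ps ε z y) 0 ≤ D * ∫ c, c ^ 2 * k c := by
    set n := nm v (Ps ε z y) with hn
    have i1 : Integrable fun c => k c * n c := knm_int hk hv Ps_c Ps_abs
    have i2 : Integrable fun c => k c * n (-c) := by
      have := i1.comp_neg
      simpa only [hke] using this
    have e1 : ∫ c, k c * n (-c) = ∫ c, k c * n c := by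
      rw [← integral_neg_eq_self (fun c => k c * n c)]
      simp only [hke]
    have h3 : ∫ c, (k c * n c + k c * n (-c)) ≤ ∫ c, (2 * n 0 * k c + 2 * D * (c ^ 2 * k c)) := by
      apply integral_mono (i1.add i2) ((hk.const_mul _).add (hk2.const_mul _))
      intro c
      show k c * n c + k c * n (-c) ≤ 2 * n 0 * k c + 2 * D * (c ^ 2 * k c)
      have := mul_le_mul_of_nonneg_left (h c) (hk0 c)
      linarith
    rw [integral_add i1 i2, integral_add (hk.const_mul _) (hk2.const_mul _), integral_const_mul,
      integral_const_mul, hk1, e1] at h3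
    linarith
  exact add_le_add (mul_le_mul_of_nonneg_left h1 hμ.le) (mul_le_mul_of_nonneg_left h2 hρ)

lemma kke_int (hε : 0 < ε) (z : ℝ) : Integrable (fun x => kk ((x - z) / ε) / ε) ∧
    ∫ x, kk ((x - z) / ε) / ε = 1 := by
  have hi : Integrable kk := kk_cont.integrable_of_hasCompactSupport kk_hasCompactSupport
  have h1 : Integrable (fun x => kk (x / ε) / ε) := (hi.comp_div hε.ne').div_const ε
  refine ⟨h1.comp_sub_right z, ?_⟩
  rw [integral_sub_right_eq_self (fun x => kk (x / ε) / ε) z, integral_div,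
    Measure.integral_comp_div, abs_of_pos hε]
  have : ∫ x, kk x = 1 := by
    rw [← kk_integral, intervalIntegral.integral_of_le zero_le_one,
      setIntegral_eq_integral_of_forall_compl_eq_zero]
    intro x hx
    rw [Set.mem_Ioc, not_and_or] at hx
    rcases hx with h | h
    · exact kk_zero_left (not_lt.1 h)
    · exact kk_zero_right (not_le.1 h).le
  rw [this]; simp [hε.ne']

lemma kke_supp (hε : 0 < ε) {z x : ℝ} (hx : x ∉ Set.Icc z (z + ε)) : kk ((x - z) / ε) / ε = 0 := by
  rw [Set.mem_Icc, not_and_or] at hx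
  rcases hx with h | h
  · rw [kk_zero_left, zero_div]
    exact div_nonpos_of_nonpos_of_nonneg (by linarith) hε.le
  · rw [kk_zero_right, zero_div]
    rw [le_div_iff₀ hε]; linarith

lemma Fl_bound {q z y w : ℝ} (hq : 1 < q) (hv : Integrable v) (hε : 0 < ε) (hvc : Continuous v)
    (hw : ∀ x ∈ Set.Icc z (z + ε), ∀ x' ∈ Set.Icc z (z + ε), |v x| ≤ |v x'| + w) :
    Fl q ε z y v ≤ (AA v ε z + w) ^ q := by
  obtain ⟨ki, k1⟩ := kke_int hε z
  obtain ⟨B, hB⟩ := kke_b hε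
  have kn : ∀ x, 0 ≤ kk ((x - z) / ε) / ε := fun x => div_nonneg (kk_nonneg _) hε.le
  have hA : ∀ x ∈ Set.Icc z (z + ε), |v x| ≤ AA v ε z + w := by
    intro x hx
    have i1 := nm_int hv kke_c hB z
    have h1 : ∫ x', |v x| * (kk ((x' - z) / ε) / ε) ≤
        ∫ x', (|v x'| * (kk ((x' - z) / ε) / ε) + w * (kk ((x' - z) / ε) / ε)) := by
      apply integral_mono (ki.const_mul _) (i1.add (ki.const_mul _))
      intro x'
      show |v x| * (kk ((x' - z) / ε) / ε) ≤
        |v x'| * (kk ((x' - z) / ε) / ε) + w * (kk ((x' - z) / ε) / ε)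
      by_cases hx' : x' ∈ Set.Icc z (z + ε)
      · rw [← add_mul]
        exact mul_le_mul_of_nonneg_right (hw x hx x' hx') (kn x')
      · rw [kke_supp hε hx']; simp
    rw [integral_add i1 (ki.const_mul _), integral_const_mul, integral_const_mul, k1] at h1
    unfold AA nm
    linarith
  have hAw : 0 ≤ AA v ε z + w := (abs_nonneg _).trans (hA z ⟨le_rfl, by linarith⟩)
  unfold Fl
  have hkc : Continuous fun x => kk ((x - z) / ε) / ε := by have := kk_cont; fun_prop
  have hvq : Continuous fun x => |v x| ^ q := (absrpow_cont (by linarith : 0 < q)).comp hvc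
  calc _ ≤ ∫ x in Set.Icc z (y + ε), (AA v ε z + w) ^ q * (kk ((x - z) / ε) / ε) := by
        apply setIntegral_mono (hvq.mul hkc).integrableOn_Icc (ki.const_mul _).integrableOn
        intro x
        show |v x| ^ q * (kk ((x - z) / ε) / ε) ≤ (AA v ε z + w) ^ q * (kk ((x - z) / ε) / ε)
        by_cases hx : x ∈ Set.Icc z (z + ε)
        · exact mul_le_mul_of_nonneg_right
            (Real.rpow_le_rpow (abs_nonneg _) (hA x hx) (by linarith)) (kn x)
        · rw [kke_supp hε hx]; simp
    _ ≤ ∫ x, (AA v ε z + w) ^ q * (kk ((x - z) / ε) / ε) :=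
        setIntegral_le_integral (ki.const_mul _)
          (Eventually.of_forall fun x => mul_nonneg (by positivity) (kn x))
    _ = _ := by rw [integral_const_mul, k1, mul_one]
end

/-- spatial oscillation, with time clamp -/
noncomputable def om (u : ℝ → ℝ → ℝ) (α β s ε r : ℝ) : ℝ :=
  ⨆ p : {p : ℝ × ℝ // p.1 ∈ Set.Icc α β ∧ p.2 ∈ Set.Icc α β ∧ |p.1 - p.2| ≤ ε},
    |(|u (max r s) p.1.1|) - (|u (max r s) p.1.2|)|

section
variable {q μ : ℝ} {u g : ℝ → ℝ → ℝ} {α β : ℝ}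

lemma om_pt (S : Sol q μ u g) {s : ℝ} (hs : 0 < s) (ε r : ℝ)
    (p : {p : ℝ × ℝ // p.1 ∈ Set.Icc α β ∧ p.2 ∈ Set.Icc α β ∧ |p.1 - p.2| ≤ ε}) :
    |(|u (max r s) p.1.1|) - (|u (max r s) p.1.2|)| ≤ sg u α β s r := by
  have h1 := le_ciSup (sg_bdd (α := α) (β := β) S hs r) ⟨p.1.1, p.2.1⟩
  have h2 := le_ciSup (sg_bdd (α := α) (β := β) S hs r) ⟨p.1.2, p.2.2.1⟩
  have h1' : |u (max r s) p.1.1| ≤ sg u α β s r := h1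
  have h2' : |u (max r s) p.1.2| ≤ sg u α β s r := h2
  rw [abs_le]
  constructor <;> linarith [abs_nonneg (u (max r s) p.1.1), abs_nonneg (u (max r s) p.1.2)]

lemma om_bdd (S : Sol q μ u g) {s : ℝ} (hs : 0 < s) (ε r : ℝ) :
    BddAbove (Set.range fun p : {p : ℝ × ℝ // p.1 ∈ Set.Icc α β ∧ p.2 ∈ Set.Icc α β ∧
      |p.1 - p.2| ≤ ε} => |(|u (max r s) p.1.1|) - (|u (max r s) p.1.2|)|) :=
  ⟨sg u α β s r, by rintro _ ⟨p, rfl⟩; exact om_pt S hs ε r p⟩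

lemma om_meas (S : Sol q μ u g) {s : ℝ} (hs : 0 < s) (ε : ℝ) : Measurable (om u α β s ε) := by
  apply LowerSemicontinuous.measurable
  exact lowerSemicontinuous_ciSup (fun r => om_bdd S hs ε r)
    (fun p => ((clamp_cont S hs p.1.1).abs.sub (clamp_cont S hs p.1.2).abs).abs.lowerSemicontinuous)

lemma om_nonneg (s ε r : ℝ) : 0 ≤ om u α β s ε r := Real.iSup_nonneg fun _ => abs_nonneg _

lemma om_le_sg (S : Sol q μ u g) {s : ℝ} (hs : 0 < s) (ε r : ℝ) :
    om u α β s ε r ≤ sg u α β s r :=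
  Real.iSup_le (fun p => om_pt S hs ε r p) (sg_nonneg s r)

lemma le_om (S : Sol q μ u g) {s : ℝ} (hs : 0 < s) {ε r : ℝ} (hr : s ≤ r) {x x' : ℝ}
    (hx : x ∈ Set.Icc α β) (hx' : x' ∈ Set.Icc α β) (h : |x - x'| ≤ ε) :
    |u r x| ≤ |u r x'| + om u α β s ε r := by
  have := le_ciSup (om_bdd (α := α) (β := β) S hs ε r) ⟨(x, x'), hx, hx', h⟩
  have h2 : |(|u (max r s) x|) - (|u (max r s) x'|)| ≤ om u α β s ε r := this
  rw [max_eq_left hr] at h2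
  linarith [le_abs_self (|u r x| - |u r x'|)]

lemma om_tendsto (S : Sol q μ u g) {s : ℝ} (hs : 0 < s) (r : ℝ) :
    Tendsto (fun ε => om u α β s ε r) (𝓝[>] 0) (𝓝 0) := by
  rw [Metric.tendsto_nhdsWithin_nhds]
  intro η hη
  have hc : ContinuousOn (fun x => |u (max r s) x|) (Set.Icc α β) :=
    (S.cont (hs.trans_le (le_max_right r s))).abs.continuousOn
  have huc := isCompact_Icc.uniformContinuousOn_of_continuous hc
  rw [Metric.uniformContinuousOn_iff] at huc
  obtain ⟨δ, hδ, h⟩ := huc (η / 2) (by positivity)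
  refine ⟨δ, hδ, fun ε hε hd => ?_⟩
  rw [Real.dist_eq, sub_zero, abs_of_pos hε] at hd
  rw [Real.dist_eq, sub_zero, abs_of_nonneg (om_nonneg _ _ _)]
  refine lt_of_le_of_lt (Real.iSup_le (a := η / 2) (fun p => ?_) (by positivity)) (by linarith)
  have := h p.1.1 p.2.1 p.1.2 p.2.2.1 (by rw [Real.dist_eq]; exact p.2.2.2.trans_lt hd)
  rw [Real.dist_eq] at this
  exact this.le

lemma e_small (S : Sol q μ u g) (hq : 1 < q) (hq2 : q < 2) (hμ : 0 < μ) (hab : α < β) {s t : ℝ}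
    (hs : 0 < s) (hst : s ≤ t) {Lc : ℝ} (hL : 0 ≤ Lc) {η ε0 : ℝ} (hη : 0 < η) (hε0 : 0 < ε0) :
    ∃ ε, 0 < ε ∧ ε ≤ ε0 ∧
      IntegrableOn (fun r => (Lc + om u α β s ε r) ^ q - Lc ^ q) (Set.Icc s t) ∧
      ∫ r in s..t, ((Lc + om u α β s ε r) ^ q - Lc ^ q) ≤ η := by
  have hB := lemB S hq hμ hab hs hst
  set bd : ℝ → ℝ := fun r => 2 * (1 + Lc) ^ 2 + 2 * (sg u α β s r) ^ 2 with hbd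
  have hbdi : IntegrableOn bd (Set.Icc s t) := continuous_const.integrableOn_Icc.add (hB.const_mul 2)
  have hm : ∀ ε, Measurable fun r => (Lc + om u α β s ε r) ^ q - Lc ^ q := fun ε =>
    ((measurable_const.add (om_meas S hs ε)).pow_const q).sub_const _
  have hdom : ∀ ε r, ‖(Lc + om u α β s ε r) ^ q - Lc ^ q‖ ≤ bd r := by
    intro ε r
    have h0 := om_nonneg (u := u) (α := α) (β := β) s ε r
    have h1 := om_le_sg (α := α) (β := β) S hs ε r
    have h2 : Lc ^ q ≤ (Lc + om u α β s ε r) ^ q := by gcongr; linarith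
    have h3 : 0 ≤ Lc ^ q := by positivity
    rw [Real.norm_of_nonneg (by linarith)]
    have h4 : (Lc + om u α β s ε r) ^ q ≤ (1 + Lc + sg u α β s r) ^ q :=
      Real.rpow_le_rpow (by linarith) (by linarith) (by linarith)
    have h5 : (1 + Lc + sg u α β s r) ^ q ≤ (1 + Lc + sg u α β s r) ^ (2 : ℝ) :=
      Real.rpow_le_rpow_of_exponent_le (by linarith) hq2.le
    rw [Real.rpow_two] at h5
    simp only [hbd]
    nlinarith [sq_nonneg (1 + Lc - sg u α β s r)]
  have hint : ∀ ε, IntegrableOn (fun r => (Lc + om u α β s ε r) ^ q - Lc ^ q) (Set.Icc s t) :=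
    fun ε => hbdi.mono' (hm ε).aestronglyMeasurable (Eventually.of_forall (hdom ε))
  have hlim : Tendsto (fun ε => ∫ r in Set.Icc s t, ((Lc + om u α β s ε r) ^ q - Lc ^ q))
      (𝓝[>] 0) (𝓝 (∫ r in Set.Icc s t, (0:ℝ))) := by
    apply tendsto_integral_filter_of_dominated_convergence bd
    · exact Eventually.of_forall fun ε => (hm ε).aestronglyMeasurable
    · exact Eventually.of_forall fun ε => Eventually.of_forall (hdom ε)
    · exact hbdi
    · refine Eventually.of_forall fun r => ?_
      have h1 := (om_tendsto (α := α) (β := β) S hs r).const_add Lc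
      have h2 := (h1.rpow_const (p := q) (Or.inr (by linarith))).sub_const (Lc ^ q)
      simpa using h2
  rw [integral_zero] at hlim
  have hev := (hlim.eventually (Iio_mem_nhds hη)).and (Ioc_mem_nhdsGT hε0)
  obtain ⟨ε, h1, h2⟩ := hev.exists
  refine ⟨ε, h2.1, h2.2, hint ε, ?_⟩
  rw [← int_Icc_eq hst]
  exact le_of_lt h1
end

structure Ker (k : ℝ → ℝ) (ρ m : ℝ) : Prop where
  int : Integrable k
  pos : ∀ x, 0 ≤ k x
  even : ∀ x, k (-x) = k x
  one : ∫ x, k x = 1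
  int2 : Integrable fun c => c ^ 2 * k c
  rho : 0 ≤ ρ
  m0 : 0 ≤ m
  mb : ρ * ∫ c, c ^ 2 * k c ≤ m

structure Bar (W1 W2 W1' : ℝ → ℝ) (Λ B : ℝ) : Prop where
  L0 : 0 ≤ Λ
  B0 : 0 ≤ B
  d : ∀ x, HasDerivAt W1 (W1' x) x
  db : ∀ x, |W1' x| ≤ Λ
  c2 : Continuous W2
  s1 : ∀ x c, W1 (x + c) + W1 (x - c) - 2 * W1 x ≤ B * c ^ 2
  s2 : ∀ x c, W2 (x + c) + W2 (x - c) - 2 * W2 x ≤ B * c ^ 2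

noncomputable def sq1 (x : ℝ) : ℝ := √(1 + x ^ 2)

lemma sq1_ge (x : ℝ) : 1 ≤ sq1 x := by
  unfold sq1
  rw [Real.one_le_sqrt]; nlinarith [sq_nonneg x]
lemma sq1_abs (x : ℝ) : |x| ≤ sq1 x := by
  unfold sq1
  rw [← Real.sqrt_sq_eq_abs]
  exact Real.sqrt_le_sqrt (by linarith)
lemma sq1_sq (x : ℝ) : sq1 x ^ 2 = 1 + x ^ 2 := Real.sq_sqrt (by positivity)
lemma sq1_d (x : ℝ) : HasDerivAt sq1 (x / sq1 x) x := by
  have h1 : HasDerivAt (fun x : ℝ => 1 + x ^ 2) (2 * x) x := by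
    have := (hasDerivAt_pow 2 x).const_add 1
    exact this.congr_deriv (by simp)
  have h := h1.sqrt (by positivity)
  refine h.congr_deriv ?_
  show 2 * x / (2 * sq1 x) = _
  rw [mul_div_mul_left _ _ (by norm_num)]
lemma sq1_db (x : ℝ) : |x / sq1 x| ≤ 1 := by
  have := sq1_ge x
  rw [abs_div, abs_of_pos (by linarith : 0 < sq1 x), div_le_one (by linarith)]
  exact sq1_abs x
lemma sq1_c : Continuous sq1 := continuous_iff_continuousAt.2 fun x => (sq1_d x).continuousAt
lemma sq1_s (x c : ℝ) : sq1 (x + c) + sq1 (x - c) - 2 * sq1 x ≤ 1 * c ^ 2 := by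
  have h1 := sq1_ge (x + c)
  have h2 := sq1_ge (x - c)
  have h3 := sq1_ge x
  have e1 := sq1_sq (x + c)
  have e2 := sq1_sq (x - c)
  have e3 := sq1_sq x
  have h4 : sq1 (x + c) + sq1 (x - c) ≤ 2 * sq1 x + c ^ 2 := by
    apply le_of_sq_le_sq _ (by positivity)
    nlinarith [sq_nonneg (sq1 (x + c) - sq1 (x - c)), sq_nonneg (c ^ 2), sq_nonneg c,
      mul_nonneg (sq_nonneg c) (sub_nonneg.2 h3)]
  linarith

/-- the barrier -/
noncomputable def What (W1 W2 : ℝ → ℝ) (θ b s r z y : ℝ) : ℝ :=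
  W1 z + W2 y + θ * (sq1 z + sq1 y) + b * (r - s)

section
variable {q μ ρ m : ℝ} {k : ℝ → ℝ} {u : ℝ → ℝ → ℝ} {W1 W2 W1' : ℝ → ℝ} {Λ B : ℝ}

lemma d_step (S : Sol q μ u (gn k ρ u)) (Kr : Ker k ρ m) (Br : Bar W1 W2 W1' Λ B)
    (hq : 1 < q) (hμ : 0 < μ) (hμ1 : μ ≤ 1) {s t θ ε Z : ℝ} (hs : 0 < s) (hθ : 0 < θ)
    (hε : 0 < ε) (hε1 : ε ≤ 1) {e : ℝ → ℝ}
    (he : e = fun r => (Λ + 2 * θ + om u (-Z - 1) (Z + 1) s ε r) ^ q - (Λ + 2 * θ) ^ q)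
    (hei : IntegrableOn e (Set.Icc s t)) {b : ℝ}
    (hb : b = (Λ + 2 * θ) ^ q + (B + θ) * (2 + m) + θ)
    {F : ℝ → ℝ → ℝ → ℝ}
    (hF : ∀ r z y, F r z y = nm (u r) (Ps ε z y) 0 - (∫ τ in s..r, e τ) - What W1 W2 θ b s r z y)
    {r1 z1 y1 : ℝ} (hr1 : s < r1) (hr1t : r1 ≤ t) (hzy : z1 < y1) (hzZ : |z1| ≤ Z)
    (hmt : ∀ r ∈ Set.Icc s r1, F r z1 y1 ≤ F r1 z1 y1)
    (hmx : ∀ z y, z ≤ y → F r1 z y ≤ F r1 z1 y1) : False := by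
  have hr0 : 0 < r1 := hs.trans hr1
  have hv := S.int r1 hr0
  have hL0 := Br.L0
  have hB0 := Br.B0
  -- first derivative
  have hA : AA (u r1) ε z1 ≤ Λ + θ := by
    have hd : HasDerivAt (fun z => F r1 z y1)
        (- AA (u r1) ε z1 - (W1' z1 + θ * (z1 / sq1 z1))) z1 := by
      have e1 : (fun z => F r1 z y1) = fun z => hh (u r1) ε z - (W1 z + θ * sq1 z) +
          (- hh (u r1) ε y1 - (∫ τ in s..r1, e τ) - W2 y1 - θ * sq1 y1 - b * (r1 - s)) := by
        ext z
        rw [hF, nm_Ps hv]; simp only [What, add_zero]; ring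
      rw [e1]
      exact ((hh_d hv hε z1).sub ((Br.d z1).add ((sq1_d z1).const_mul θ))).add_const _
    have hmax : IsLocalMax (fun z => F r1 z y1) z1 := by
      filter_upwards [Iio_mem_nhds hzy] with z hz using hmx z y1 (le_of_lt hz)
    have h0 := hmax.hasDerivAt_eq_zero hd
    have h1 := (abs_le.1 (Br.db z1)).1
    have h2 := (abs_le.1 (sq1_db z1)).1
    nlinarith
  -- second differences
  have hLL : LL μ ρ k (u r1) ε z1 y1 ≤ (B + θ) * (2 + m) := by
    have h1 := LL_bound (μ := μ) (ρ := ρ) (D := B + θ) (z := z1) (y := y1) hv hε hμ Kr.rho Kr.int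
      Kr.pos Kr.even Kr.one Kr.int2 (by
        intro c
        have es : ∀ c, nm (u r1) (Ps ε z1 y1) c = nm (u r1) (Ps ε (z1 + c) (y1 + c)) 0 := by
          intro c; rw [nm_Ps hv, nm_Ps hv, add_zero, add_zero]
        have a1 := hmx (z1 + c) (y1 + c) (by linarith)
        have a2 := hmx (z1 + -c) (y1 + -c) (by linarith)
        rw [hF, hF, ← es] at a1 a2
        simp only [What] at a1 a2
        have b1 := Br.s1 z1 c
        have b2 := Br.s2 y1 c
        have b3 := mul_le_mul_of_nonneg_left (sq1_s z1 c) hθ.le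
        have b4 := mul_le_mul_of_nonneg_left (sq1_s y1 c) hθ.le
        simp only [← sub_eq_add_neg] at a2
        linarith)
    have h2 := mul_le_mul_of_nonneg_left Kr.mb (by linarith : 0 ≤ B + θ)
    have h3 : μ * (2 * (B + θ)) ≤ 2 * (B + θ) := by nlinarith
    nlinarith
  -- nearby times
  obtain ⟨Bk, hBk⟩ := kke_b hε
  have c1 : ContinuousAt (fun r => AA (u r) ε z1) r1 := S.nm_cont kke_c hBk z1 hr0
  have c2 : ContinuousAt (fun r => LL μ ρ k (u r) ε z1 y1) r1 := S.LL_cont Kr.int hε z1 y1 hr0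
  have ev := (c1.eventually (Iio_mem_nhds (by linarith : AA (u r1) ε z1 < Λ + 2 * θ))).and
    (c2.eventually (Iio_mem_nhds (by linarith :
      LL μ ρ k (u r1) ε z1 y1 < (B + θ) * (2 + m) + θ / 2)))
  rw [Metric.eventually_nhds_iff] at ev
  obtain ⟨d, hd, hev⟩ := ev
  set r2 := max s (r1 - d / 2) with hr2
  have hr2s : s ≤ r2 := le_max_left _ _
  have hr21 : r2 < r1 := max_lt hr1 (by linarith)
  have hnear : ∀ r ∈ Set.Icc r2 r1, AA (u r) ε z1 < Λ + 2 * θ ∧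
      LL μ ρ k (u r) ε z1 y1 < (B + θ) * (2 + m) + θ / 2 := by
    intro r hr
    have : r1 - d / 2 ≤ r := (le_max_right _ _).trans hr.1
    exact hev (by rw [Real.dist_eq, abs_lt]; constructor <;> linarith [hr.2])
  have hei2 : IntegrableOn e (Set.Icc r2 r1) := hei.mono_set (Set.Icc_subset_Icc hr2s hr1t)
  have hLi : IntegrableOn (fun r => LL μ ρ k (u r) ε z1 y1) (Set.Icc r2 r1) :=
    ContinuousOn.integrableOn_Icc fun r hr =>
    (S.LL_cont Kr.int hε z1 y1 ((hs.trans_le hr2s).trans_le hr.1)).continuousWithinAt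
  have hPi : IntegrableOn (fun r => e r + (Λ + 2 * θ) ^ q) (Set.Icc r2 r1) :=
    hei2.add continuous_const.integrableOn_Icc
  have hC := lemC S hq hμ Kr.int Kr.pos Kr.even Kr.rho hε hzy.le (hs.trans_le hr2s) hr21.le
    (P := fun r => e r + (Λ + 2 * θ) ^ q) hPi (by
      intro r hr
      have hr00 : 0 < r := (hs.trans_le hr2s).trans_le hr.1
      have hw : ∀ x ∈ Set.Icc z1 (z1 + ε), ∀ x' ∈ Set.Icc z1 (z1 + ε),
          |u r x| ≤ |u r x'| + om u (-Z - 1) (Z + 1) s ε r := by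
        intro x hx x' hx'
        rw [abs_le] at hzZ
        refine le_om S hs (hr2s.trans hr.1) ⟨by linarith [hx.1], by linarith [hx.2]⟩
          ⟨by linarith [hx'.1], by linarith [hx'.2]⟩ ?_
        rw [abs_le]; constructor <;> linarith [hx.1, hx.2, hx'.1, hx'.2]
      have h1 := Fl_bound (y := y1) hq (S.int r hr00) hε (S.cont hr00) hw
      refine h1.trans ?_
      have hA0 : 0 ≤ AA (u r) ε z1 := integral_nonneg fun x =>
        mul_nonneg (abs_nonneg _) (div_nonneg (kk_nonneg _) hε.le)
      have hom := om_nonneg (u := u) (α := -Z - 1) (β := Z + 1) s ε r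
      rw [he]
      simp only [sub_add_cancel]
      exact Real.rpow_le_rpow (by linarith) (by linarith [(hnear r hr).1]) (by linarith))
  have hup : ∫ r in r2..r1, (e r + (Λ + 2 * θ) ^ q + LL μ ρ k (u r) ε z1 y1) ≤
      (∫ r in r2..r1, e r) + ((Λ + 2 * θ) ^ q + (B + θ) * (2 + m) + θ / 2) * (r1 - r2) := by
    rw [← int_Icc_eq hr21.le, ← int_Icc_eq hr21.le, ← Icc_add_const hr21.le hei2]
    apply setIntegral_mono_on (hPi.add hLi) (hei2.add continuous_const.integrableOn_Icc)
      measurableSet_Icc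
    intro r hr
    have := (hnear r hr).2
    show e r + (Λ + 2 * θ) ^ q + LL μ ρ k (u r) ε z1 y1 ≤
      e r + ((Λ + 2 * θ) ^ q + (B + θ) * (2 + m) + θ / 2)
    linarith
  have hT := hmt r2 ⟨hr2s, hr21.le⟩
  rw [hF, hF] at hT
  simp only [What] at hT
  have hsplit : (∫ τ in s..r1, e τ) = (∫ τ in s..r2, e τ) + ∫ τ in r2..r1, e τ := by
    rw [intervalIntegral.integral_add_adjacent_intervals]
    · rw [intervalIntegrable_iff_integrableOn_Icc_of_le hr2s]
      exact hei.mono_set (Set.Icc_subset_Icc le_rfl (hr21.le.trans hr1t))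
    · rw [intervalIntegrable_iff_integrableOn_Icc_of_le hr21.le]; exact hei2
  rw [hsplit] at hT
  have h3 : nm (u r1) (Ps ε z1 y1) 0 - nm (u r2) (Ps ε z1 y1) 0 ≥
      (∫ τ in r2..r1, e τ) + b * (r1 - r2) := by linarith
  have h4 := hC.trans hup
  have h5 : b * (r1 - r2) ≤ ((Λ + 2 * θ) ^ q + (B + θ) * (2 + m) + θ / 2) * (r1 - r2) := by linarith
  rw [hb] at h5
  have h6 : 0 < r1 - r2 := by linarith
  nlinarith
end

section
variable {q μ ρ m : ℝ} {u : ℝ → ℝ → ℝ} {k : ℝ → ℝ} {W1 W2 W1' : ℝ → ℝ} {Λ B : ℝ}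

lemma hh_joint (S : Sol q μ u (gn k ρ u)) {ε : ℝ} (hε : 0 < ε) {r0 : ℝ} (hr : 0 < r0) (z0 : ℝ) :
    ContinuousAt (fun p : ℝ × ℝ => hh (u p.1) ε p.2) (r0, z0) := by
  have h1 : Tendsto (fun p : ℝ × ℝ => (∫ x, |u p.1 x - u r0 x|) + |hh (u r0) ε p.2 - hh (u r0) ε z0|)
      (𝓝 (r0, z0)) (𝓝 (0 + 0)) := by
    refine Tendsto.add ((S.l1 r0 hr).comp (continuous_fst.tendsto (r0, z0))) ?_
    have hc : Continuous (hh (u r0) ε) :=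
      continuous_iff_continuousAt.2 fun z => (hh_d (S.int r0 hr) hε z).continuousAt
    have : Continuous fun p : ℝ × ℝ => |hh (u r0) ε p.2 - hh (u r0) ε z0| := by fun_prop
    have h2 := this.tendsto (r0, z0)
    simpa using h2
  rw [add_zero] at h1
  refine tendsto_iff_norm_sub_tendsto_zero.2 (squeeze_zero' (Eventually.of_forall fun p => norm_nonneg _) ?_ h1)
  have : ∀ᶠ p : ℝ × ℝ in 𝓝 (r0, z0), 0 < p.1 :=
    (continuous_fst.tendsto (r0, z0)).eventually (lt_mem_nhds hr)
  filter_upwards [this] with p hp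
  have h3 := nm_diff (S.int p.1 hp) (S.int r0 hr) ppe_c (ppe_b (ε := ε)) p.2
  rw [one_mul] at h3
  have h4 := abs_sub_le (hh (u p.1) ε p.2) (hh (u r0) ε p.2) (hh (u r0) ε z0)
  rw [Real.norm_eq_abs]
  exact h4.trans (add_le_add h3 le_rfl)

lemma mass_bd (S : Sol q μ u (gn k ρ u)) {s t : ℝ} (hs : 0 < s) :
    ∃ M, 0 ≤ M ∧ ∀ r ∈ Set.Icc s t, ∫ x, |u r x| ≤ M := by
  have hc : ContinuousOn (fun r => nm (u r) (fun _ => 1) 0) (Set.Icc s t) := fun r hr =>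
    (S.nm_cont continuous_const (B := 1) (by simp) 0 (hs.trans_le hr.1)).continuousWithinAt
  obtain ⟨M, hM⟩ := isCompact_Icc.exists_bound_of_continuousOn hc
  refine ⟨max M 0, le_max_right _ _, fun r hr => ?_⟩
  have := hM r hr
  simp only [nm, mul_one] at this
  exact (le_abs_self _).trans (this.trans (le_max_left _ _))

lemma nm_le_mass {v : ℝ → ℝ} {ε z y : ℝ} (hv : Integrable v) (hε : 0 < ε) (hzy : z ≤ y) :
    nm v (Ps ε z y) 0 ≤ ∫ x in Set.Ioo z (y + ε), |v x| := by
  rw [← integral_indicator measurableSet_Ioo]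
  refine integral_mono (nm_int hv Ps_c Ps_abs 0) (hv.abs.indicator measurableSet_Ioo) fun x => ?_
  simp only [sub_zero]
  by_cases hx : x ∈ Set.Ioo z (y + ε)
  · rw [Set.indicator_of_mem hx]
    exact mul_le_of_le_one_right (abs_nonneg _) ((le_abs_self _).trans (Ps_abs x))
  · rw [Set.indicator_of_notMem hx]
    rcases le_or_gt x z with h | h
    · rw [Ps_left hε hzy h, mul_zero]
    · rw [Ps_right hε hzy (not_lt.1 fun h' => hx ⟨h, h'⟩), mul_zero]

lemma nm_ge_mass {v : ℝ → ℝ} {ε z y a : ℝ} (hv : Integrable v) (hε : 0 < ε) (hzy : z ≤ y)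
    (ha : z + ε ≤ a) : ∫ x in Set.Icc a y, |v x| ≤ nm v (Ps ε z y) 0 := by
  rw [← integral_indicator measurableSet_Icc]
  refine integral_mono (hv.abs.indicator measurableSet_Icc) (nm_int hv Ps_c Ps_abs 0) fun x => ?_
  simp only [sub_zero]
  by_cases hx : x ∈ Set.Icc a y
  · rw [Set.indicator_of_mem hx]
    have h1 : Ps ε z y x = 1 := by
      unfold Ps
      rw [pp_one (by rw [le_div_iff₀ hε]; linarith [hx.1]),
        pp_zero (div_nonpos_of_nonpos_of_nonneg (by linarith [hx.2]) hε.le)]; ring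
    rw [h1, mul_one]
  · rw [Set.indicator_of_notMem hx]
    exact mul_nonneg (abs_nonneg _) (Ps_nonneg hε hzy x)

lemma d_core (S : Sol q μ u (gn k ρ u)) (Kr : Ker k ρ m) (Br : Bar W1 W2 W1' Λ B)
    (hq : 1 < q) (hq2 : q < 2) (hμ : 0 < μ) (hμ1 : μ ≤ 1) {s t θ ε0 : ℝ} (hs : 0 < s)
    (hst : s ≤ t) (hθ : 0 < θ) (hε0 : 0 < ε0) (hpos : ∀ z y, z ≤ y → 0 ≤ W1 z + W2 y)
    (hinit : ∀ z y, z ≤ y → ∫ x in Set.Ioo z (y + ε0), |u s x| ≤ W1 z + W2 y + θ / 2)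
    {z y a : ℝ} (hzy : z ≤ y) (hza : z < a) :
    ∫ x in Set.Icc a y, |u t x| ≤ W1 z + W2 y + θ * (sq1 z + sq1 y) +
      ((Λ + 2 * θ) ^ q + (B + θ) * (2 + m) + θ) * (t - s) + θ := by
  obtain ⟨M, hM0, hM⟩ := mass_bd S (t := t) hs
  have hL0 := Br.L0
  have hB0 := Br.B0
  have hm0 := Kr.m0
  set Z : ℝ := M / θ + 1 with hZ
  have hZ0 : 0 < Z := by positivity
  have hθZ : θ * Z = M + θ := by rw [hZ]; field_simp
  have hLc : 0 ≤ Λ + 2 * θ := by positivity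
  obtain ⟨ε, hε, hεm, hei, hes⟩ := e_small (α := -Z - 1) (β := Z + 1) S hq hq2 hμ (by linarith) hs hst
    hLc hθ (ε0 := min ε0 (min 1 (a - z))) (lt_min hε0 (lt_min one_pos (by linarith)))
  have hε1 : ε ≤ 1 := hεm.trans ((min_le_right _ _).trans (min_le_left _ _))
  have hε2 : ε ≤ ε0 := hεm.trans (min_le_left _ _)
  have hε3 : ε ≤ a - z := hεm.trans ((min_le_right _ _).trans (min_le_right _ _))
  obtain ⟨e, he⟩ : ∃ e : ℝ → ℝ, e = fun r => (Λ + 2 * θ + om u (-Z - 1) (Z + 1) s ε r) ^ q - (Λ + 2 * θ) ^ q := ⟨_, rfl⟩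
  obtain ⟨b, hb⟩ : ∃ b, b = (Λ + 2 * θ) ^ q + (B + θ) * (2 + m) + θ := ⟨_, rfl⟩
  rw [← he] at hei
  have hb0 : 0 ≤ b := by rw [hb]; positivity
  have he0 : ∀ r, 0 ≤ e r := fun r => by
    rw [he]
    have := om_nonneg (u := u) (α := -Z - 1) (β := Z + 1) s ε r
    exact sub_nonneg.2 (Real.rpow_le_rpow hLc (by linarith) (by linarith))
  obtain ⟨F, hF⟩ : ∃ F : ℝ → ℝ → ℝ → ℝ, ∀ r z y, F r z y =
    nm (u r) (Ps ε z y) 0 - (∫ τ in s..r, e τ) - What W1 W2 θ b s r z y := ⟨_, fun _ _ _ => rfl⟩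
  have hE0 : ∀ r, s ≤ r → 0 ≤ ∫ τ in s..r, e τ := fun r hr =>
    intervalIntegral.integral_nonneg hr fun τ _ => he0 τ
  have hout : ∀ r ∈ Set.Icc s t, ∀ z y, z ≤ y → 0 < F r z y → |z| ≤ Z ∧ |y| ≤ Z := by
    intro r hr z y hzy hFp
    rw [hF, What] at hFp
    have hv := S.int r (hs.trans_le hr.1)
    have h1 := nm_le_mass hv hε hzy
    have h2 : ∫ x in Set.Ioo z (y + ε), |u r x| ≤ ∫ x, |u r x| :=
      setIntegral_le_integral hv.abs (Eventually.of_forall fun x => abs_nonneg _)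
    have h3 := hM r hr
    have h4 := hE0 r hr.1
    have h5 := hpos z y hzy
    have h6 : 0 ≤ b * (r - s) := mul_nonneg hb0 (by linarith [hr.1])
    have h7 := sq1_ge z
    have h8 := sq1_ge y
    have h9 : θ * (sq1 z + sq1 y) < M := by linarith
    have h10 := sq1_abs z
    have h11 := sq1_abs y
    have h12 : sq1 z + sq1 y ≤ Z := by
      by_contra hc
      push Not at hc
      have := mul_lt_mul_of_pos_left hc hθ
      linarith
    constructor <;> linarith
  have hcl : ∀ r ∈ Set.Icc s t, ∀ z y, z ≤ y → F r z y ≤ 0 := by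
    intro r hr z y hzy
    by_contra hcon
    push Not at hcon
    set K : Set (ℝ × ℝ × ℝ) := (Set.Icc s t ×ˢ Set.Icc (-Z) Z ×ˢ Set.Icc (-Z) Z) ∩ {p | p.2.1 ≤ p.2.2} with hK
    have hKc : IsCompact K := (isCompact_Icc.prod (isCompact_Icc.prod isCompact_Icc)).inter_right
      (isClosed_le (by fun_prop) (by fun_prop))
    have hmem : ∀ r ∈ Set.Icc s t, ∀ z y, z ≤ y → 0 < F r z y → ((r, z, y) : ℝ × ℝ × ℝ) ∈ K := by
      intro r hr z y hzy hp
      obtain ⟨h1, h2⟩ := hout r hr z y hzy hp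
      exact ⟨⟨hr, abs_le.1 h1, abs_le.1 h2⟩, hzy⟩
    have hW1c : Continuous W1 := continuous_iff_continuousAt.2 fun x => (Br.d x).continuousAt
    have hW2c := Br.c2
    have hsqc := sq1_c
    have hFc : ContinuousOn (fun p : ℝ × ℝ × ℝ => F p.1 p.2.1 p.2.2) K := by
      have h0 : ContinuousOn (fun p : ℝ × ℝ × ℝ => hh (u p.1) ε p.2.1 - hh (u p.1) ε p.2.2 -
          (∫ τ in s..p.1, e τ) - What W1 W2 θ b s p.1 p.2.1 p.2.2) K := by
        refine ContinuousOn.sub (ContinuousOn.sub (ContinuousOn.sub ?_ ?_) ?_) ?_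
        · intro p hp
          exact (ContinuousAt.comp (g := fun p : ℝ × ℝ => hh (u p.1) ε p.2)
            (f := fun p : ℝ × ℝ × ℝ => (p.1, p.2.1))
            (hh_joint S hε (hs.trans_le hp.1.1.1) _) (by fun_prop)).continuousWithinAt
        · intro p hp
          exact (ContinuousAt.comp (g := fun p : ℝ × ℝ => hh (u p.1) ε p.2)
            (f := fun p : ℝ × ℝ × ℝ => (p.1, p.2.2))
            (hh_joint S hε (hs.trans_le hp.1.1.1) _) (by fun_prop)).continuousWithinAt
        · exact (prim_contOn hst hei).comp continuous_fst.continuousOn fun p hp => hp.1.1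
        · unfold What
          fun_prop
      refine h0.congr fun p hp => ?_
      simp only [hF]
      rw [nm_Ps (S.int _ (hs.trans_le hp.1.1.1))]; simp
    obtain ⟨⟨r1, z1, y1⟩, hp1, hmax⟩ := hKc.exists_isMaxOn ⟨_, hmem r hr z y hzy hcon⟩ hFc
    have hP : 0 < F r1 z1 y1 := hcon.trans_le (hmax (hmem r hr z y hzy hcon))
    have hr1 : r1 ∈ Set.Icc s t := hp1.1.1
    have hzy1 : z1 ≤ y1 := hp1.2
    have hall : ∀ r ∈ Set.Icc s t, ∀ z y, z ≤ y → F r z y ≤ F r1 z1 y1 := by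
      intro r hr z y hzy
      rcases le_or_gt (F r z y) 0 with h | h
      · linarith
      · exact hmax (hmem r hr z y hzy h)
    have hlt : z1 < y1 := by
      refine lt_of_le_of_ne hzy1 fun h => ?_
      subst h
      have h0 : nm (u r1) (Ps ε z1 z1) 0 = 0 := by
        unfold nm Ps; simp
      rw [hF, h0, What] at hP
      have h4 := hE0 r1 hr1.1
      have h5 := hpos z1 z1 le_rfl
      have h6 : 0 ≤ b * (r1 - s) := mul_nonneg hb0 (by linarith [hr1.1])
      have h7 := sq1_ge z1
      have h8 : 0 ≤ θ * (sq1 z1 + sq1 z1) := by positivity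
      linarith
    have hsr : s < r1 := by
      refine lt_of_le_of_ne hr1.1 fun h => ?_
      subst h
      have hv := S.int s hs
      rw [hF, What] at hP
      have h1 := nm_le_mass hv hε hzy1
      have h2 : ∫ x in Set.Ioo z1 (y1 + ε), |u s x| ≤ ∫ x in Set.Ioo z1 (y1 + ε0), |u s x| :=
        setIntegral_mono_set hv.abs.integrableOn (Eventually.of_forall fun x => abs_nonneg _)
          (LE.le.eventuallyLE (Set.Ioo_subset_Ioo le_rfl (by linarith)))
      have h3 := hinit z1 y1 hzy1
      have h7 := sq1_ge z1
      have h8 := sq1_ge y1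
      rw [intervalIntegral.integral_same] at hP
      nlinarith
    exact d_step S Kr Br hq hμ hμ1 hs hθ hε hε1 he hei hb hF hsr hr1.2 hlt
      (abs_le.2 hp1.1.2.1) (fun r hr => hall r ⟨hr.1, hr.2.trans hr1.2⟩ _ _ hzy1)
      (fun z y h => hall r1 hr1 z y h)
  have h1 := hcl t ⟨hst, le_rfl⟩ z y hzy
  rw [hF, What] at h1
  have h2 := nm_ge_mass (S.int t (hs.trans_le hst)) hε hzy (a := a) (by linarith)
  rw [← he] at hes
  rw [← hb]
  linarith

/-- barrier bound with zero initial time -/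
lemma d_main (S : Sol q μ u (gn k ρ u)) (Kr : Ker k ρ m) (Br : Bar W1 W2 W1' Λ B)
    (hq : 1 < q) (hq2 : q < 2) (hμ : 0 < μ) (hμ1 : μ ≤ 1) {t ε0 : ℝ} (ht : 0 < t)
    (hi0 : Integrable (u 0)) (hl0 : Tendsto (fun t => ∫ x, |u t x - u 0 x|) (𝓝[>] 0) (𝓝 0))
    (hε0 : 0 < ε0) (hpos : ∀ z y, z ≤ y → 0 ≤ W1 z + W2 y)
    (hinit : ∀ z y, z ≤ y → ∫ x in Set.Ioo z (y + ε0), |u 0 x| ≤ W1 z + W2 y)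
    {z y a : ℝ} (hzy : z ≤ y) (hza : z < a) :
    ∫ x in Set.Icc a y, |u t x| ≤ W1 z + W2 y + t * (Λ ^ q + B * (2 + m)) := by
  have hL0 := Br.L0
  have hB0 := Br.B0
  have hm0 := Kr.m0
  have key : ∀ θ, 0 < θ → ∫ x in Set.Icc a y, |u t x| ≤ W1 z + W2 y + θ * (sq1 z + sq1 y) +
      ((Λ + 2 * θ) ^ q + (B + θ) * (2 + m) + θ) * t + θ := by
    intro θ hθ
    have h1 : ∀ᶠ s in 𝓝[>] (0:ℝ), ∫ x, |u s x - u 0 x| < θ / 2 :=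
      hl0.eventually (gt_mem_nhds (by positivity))
    have h2 : ∀ᶠ s in 𝓝[>] (0:ℝ), s ∈ Set.Ioo 0 t := Ioo_mem_nhdsGT ht
    obtain ⟨s, hs1, hs2⟩ := (h1.and h2).exists
    have hvs := S.int s hs2.1
    have h3 := d_core S Kr Br hq hq2 hμ hμ1 hs2.1 hs2.2.le hθ hε0 hpos (fun z y hzy => by
      have h4 : ∫ x in Set.Ioo z (y + ε0), |u s x| ≤ ∫ x in Set.Ioo z (y + ε0), (|u 0 x| + |u s x - u 0 x|) := by
        refine integral_mono hvs.abs.integrableOn (hi0.abs.add (hvs.sub hi0).abs).integrableOn fun x => ?_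
        have := abs_add_le (u 0 x) (u s x - u 0 x)
        simpa using this
      have hd : Integrable fun x => |u s x - u 0 x| := (hvs.sub hi0).abs
      rw [integral_add hi0.abs.integrableOn hd.integrableOn] at h4
      have h5 : ∫ x in Set.Ioo z (y + ε0), |u s x - u 0 x| ≤ ∫ x, |u s x - u 0 x| :=
        setIntegral_le_integral (hvs.sub hi0).abs (Eventually.of_forall fun x => abs_nonneg _)
      linarith [hinit z y hzy]) hzy hza
    have h6 : ((Λ + 2 * θ) ^ q + (B + θ) * (2 + m) + θ) * (t - s) ≤
      ((Λ + 2 * θ) ^ q + (B + θ) * (2 + m) + θ) * t :=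
      mul_le_mul_of_nonneg_left (by linarith [hs2.1]) (by positivity)
    linarith
  have hc : Continuous fun θ : ℝ => W1 z + W2 y + θ * (sq1 z + sq1 y) +
      ((Λ + 2 * θ) ^ q + (B + θ) * (2 + m) + θ) * t + θ := by
    have : Continuous fun θ : ℝ => (Λ + 2 * θ) ^ q :=
      Continuous.rpow_const (by fun_prop) fun _ => Or.inr (by linarith)
    fun_prop
  have h := (hc.tendsto 0).mono_left (nhdsWithin_le_nhds (s := Set.Ioi 0))
  have h2 := ge_of_tendsto h (eventually_nhdsWithin_of_forall fun θ hθ => key θ hθ)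
  simp only [mul_zero, add_zero, zero_mul] at h2
  linarith
end

section
variable {q μ ρ m : ℝ} {u : ℝ → ℝ → ℝ} {k : ℝ → ℝ}

lemma pp_s0 {C : ℝ} (hC : ∀ x, |deriv kk x| ≤ C) (x : ℝ) {c : ℝ} (hc : 0 ≤ c) :
    pp (x + c) + pp (x - c) - 2 * pp x ≤ C * c ^ 2 := by
  set g : ℝ → ℝ := fun c => pp (x + c) + pp (x - c) - 2 * pp x - C * c ^ 2 with hg
  have hlip : ∀ a b, |kk a - kk b| ≤ C * |a - b| := fun a b => by
    have := Convex.norm_image_sub_le_of_norm_deriv_le (f := kk) (s := Set.univ) (C := C)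
      (fun x _ => (kk_deriv x).differentiableAt) (fun x _ => hC x) convex_univ (Set.mem_univ b) (Set.mem_univ a)
    exact this
  have hd : ∀ c, HasDerivAt g (kk (x + c) - kk (x - c) - C * (2 * c)) c := by
    intro c
    have h1 := (pp_deriv (x + c)).comp c ((hasDerivAt_id c).const_add x)
    have h2 := (pp_deriv (x - c)).comp c ((hasDerivAt_id c).const_sub x)
    have h3 := ((hasDerivAt_pow 2 c).const_mul C)
    have h4 := ((h1.add h2).sub_const (2 * pp x)).sub h3
    refine (h4.congr_deriv ?_)
    simp; ring
  have ha : AntitoneOn g (Set.Ici 0) := by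
    refine antitoneOn_of_deriv_nonpos (convex_Ici 0)
      (fun c _ => (hd c).continuousAt.continuousWithinAt)
      (fun c _ => (hd c).differentiableAt.differentiableWithinAt) fun c hc => ?_
    rw [interior_Ici] at hc
    have hc0 : 0 < c := hc
    rw [(hd c).deriv]
    have h5 := (le_abs_self _).trans (hlip (x + c) (x - c))
    rw [show x + c - (x - c) = 2 * c by ring, abs_of_pos (by linarith : 0 < 2 * c)] at h5
    linarith
  have := ha (Set.mem_Ici.2 le_rfl) (Set.mem_Ici.2 hc) hc
  simp only [hg] at this
  simp at this
  linarith

lemma pp_s {C : ℝ} (hC : ∀ x, |deriv kk x| ≤ C) (x c : ℝ) :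
    pp (x + c) + pp (x - c) - 2 * pp x ≤ C * c ^ 2 := by
  rcases le_total 0 c with h | h
  · exact pp_s0 hC x h
  · have := pp_s0 hC x (c := -c) (by linarith)
    rw [neg_sq, sub_neg_eq_add, ← sub_eq_add_neg] at this
    linarith

/-- a smooth step -/
noncomputable def stp (A K α β : ℝ) (x : ℝ) : ℝ := A + K * pp (α * x + β)

lemma stp_d (A K α β x : ℝ) : HasDerivAt (stp A K α β) (K * (kk (α * x + β) * α)) x := by
  have h1 : HasDerivAt (fun x => α * x + β) α x :=
    (((hasDerivAt_id x).const_mul α).add_const β).congr_deriv (by simp)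
  exact (((pp_deriv _).comp x h1).const_mul K).const_add A

lemma stp_s {A K α β C : ℝ} (hK : 0 ≤ K) (hC : ∀ x, |deriv kk x| ≤ C) (x c : ℝ) :
    stp A K α β (x + c) + stp A K α β (x - c) - 2 * stp A K α β x ≤ K * C * α ^ 2 * c ^ 2 := by
  unfold stp
  have h := mul_le_mul_of_nonneg_left (pp_s hC (α * x + β) (α * c)) hK
  have e1 : α * (x + c) + β = α * x + β + α * c := by ring
  have e2 : α * (x - c) + β = α * x + β - α * c := by ring
  rw [e1, e2]
  nlinarith

lemma stp_bar {A1 A2 K1 K2 K α1 α2 β1 β2 α C : ℝ} (hK1 : 0 ≤ K1) (hK2 : 0 ≤ K2)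
    (hK1' : K1 ≤ K) (hK2' : K2 ≤ K) (hC : 0 ≤ C) (hα : 0 ≤ α)
    (h1 : |α1| ≤ α) (h2 : |α2| ≤ α)
    (hk : ∀ x, kk x ≤ C) (hdk : ∀ x, |deriv kk x| ≤ C) :
    Bar (stp A1 K1 α1 β1) (stp A2 K2 α2 β2) (fun x => K1 * (kk (α1 * x + β1) * α1))
      (K * C * α) (K * C * α ^ 2) := by
  have hK : 0 ≤ K := hK1.trans hK1'
  have hs1 : α1 ^ 2 ≤ α ^ 2 := sq_le_sq.2 (h1.trans (le_abs_self _))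
  have hs2 : α2 ^ 2 ≤ α ^ 2 := sq_le_sq.2 (h2.trans (le_abs_self _))
  refine ⟨by positivity, by positivity, fun x => stp_d _ _ _ _ x, fun x => ?_, ?_, fun x c => ?_, fun x c => ?_⟩
  · rw [abs_mul, abs_mul, abs_of_nonneg hK1, abs_of_nonneg (kk_nonneg _), mul_assoc]
    have := kk_nonneg (α1 * x + β1)
    have := hk (α1 * x + β1)
    gcongr
  · exact continuous_iff_continuousAt.2 fun x => (stp_d _ _ _ _ x).continuousAt
  · refine (stp_s hK1 hdk x c).trans ?_
    gcongr
  · refine (stp_s hK2 hdk x c).trans ?_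
    gcongr

lemma gn_l1 (hk : Integrable k) (hke : ∀ x, k (-x) = k x) (hk0 : ∀ x, 0 ≤ k x) (hk1 : ∫ x, k x = 1)
    (hρ : 0 ≤ ρ) {r : ℝ} (hv : Integrable (u r)) :
    Integrable (gn k ρ u r) ∧ ∫ x, |gn k ρ u r x| ≤ ρ * (2 * ∫ x, |u r x|) := by
  have hi := conv_int1 hk hv
  have hia := conv_int1 hk hv.abs
  have hint : Integrable (gn k ρ u r) := (hi.sub hv).const_mul ρ
  refine ⟨hint, ?_⟩
  have hf := nm_fubini hk hke hv (Ψ := fun _ => 1) continuous_const (by simp)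
  simp only [one_mul, nm, mul_one] at hf
  rw [integral_mul_const, hk1, one_mul] at hf
  have h1 : ∫ x, |gn k ρ u r x| ≤ ∫ x, ρ * ((∫ y, k (x - y) * |u r y|) + |u r x|) := by
    refine integral_mono hint.abs ((hia.add hv.abs).const_mul ρ) fun x => ?_
    simp only [gn]
    rw [abs_mul, abs_of_nonneg hρ]
    refine mul_le_mul_of_nonneg_left ((abs_sub _ _).trans (add_le_add ?_ le_rfl)) hρ
    refine abs_integral_le_integral_abs.trans (le_of_eq ?_)
    congr 1; ext y; rw [abs_mul, abs_of_nonneg (hk0 _)]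
  refine h1.trans (le_of_eq ?_)
  rw [integral_const_mul, integral_add hia hv.abs, hf]; ring

lemma sol_of {J φ : ℝ → ℝ} {lam : ℝ} (hlam : 0 < lam) (h : IsRescaledSol J q lam μ φ u)
    (hk : Integrable fun c => lam * J (lam * c)) (hJe : ∀ x, J (-x) = J x) (hJ0 : ∀ x, 0 ≤ J x)
    (hk1 : ∫ c, lam * J (lam * c) = 1) :
    Sol q μ u (gn (fun c => lam * J (lam * c)) (lam ^ q) u) := by
  obtain ⟨hi, hl, hc2, hc1, hpde, h0⟩ := h
  have hl' : ∀ t₀, 0 < t₀ → Tendsto (fun t => ∫ x, |u t x - u t₀ x|) (𝓝 t₀) (𝓝 0) := fun t₀ ht => by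
    have := hl t₀ ht.le
    rwa [nhdsWithin_eq_nhds.2 (Ici_mem_nhds ht)] at this
  have hg : ∀ r : ℝ, 0 < r → _ := fun r hr => gn_l1 (u := u) (ρ := lam ^ q) hk
    (fun x => by rw [mul_neg, hJe]) (fun x => mul_nonneg hlam.le (hJ0 _)) hk1 (by positivity) (hi r hr.le)
  refine ⟨fun t ht => hi t ht.le, hl', hc2, hc1, fun t ht x => ?_, fun t ht => (hg t ht).1, fun s t hs => ?_⟩
  · have := hpde t ht x
    simp only [gn]
    linarith
  · have hc : ContinuousOn (fun r => nm (u r) (fun _ => 1) 0) (Set.Icc s t) := fun r hr => by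
      have hr0 := hs.trans_le hr.1
      refine ContinuousAt.continuousWithinAt ?_
      refine tendsto_iff_norm_sub_tendsto_zero.2
        (squeeze_zero' (Eventually.of_forall fun p => norm_nonneg _) ?_ (hl' r hr0))
      filter_upwards [lt_mem_nhds hr0] with p hp
      have := nm_diff (hi p hp.le) (hi r hr0.le) (Ψ := fun _ => 1) continuous_const (B := 1) (by simp) 0
      simpa using this
    obtain ⟨M, hM⟩ := isCompact_Icc.exists_bound_of_continuousOn hc
    refine ⟨lam ^ q * (2 * |M|), by positivity, fun r hr => ?_⟩
    refine (hg r (hs.trans_le hr.1)).2.trans ?_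
    have h1 := hM r hr
    simp only [nm, mul_one] at h1
    have h2 := (le_abs_self _).trans (h1.trans (le_abs_self M))
    gcongr

lemma ker_of {J : ℝ → ℝ} {lam : ℝ} (hlam : 1 ≤ lam) (hq2 : q < 2) (hJ0 : ∀ x, 0 ≤ J x)
    (hJe : ∀ x, J (-x) = J x) (hJint : Integrable J) (hJ1 : ∫ x, J x = 1)
    (hJ2 : Integrable fun x => x ^ 2 * J x) :
    Ker (fun c => lam * J (lam * c)) (lam ^ q) (∫ x, x ^ 2 * J x) := by
  have hl0 : 0 < lam := by linarith
  have hm : 0 ≤ ∫ x, x ^ 2 * J x := integral_nonneg fun x => mul_nonneg (sq_nonneg x) (hJ0 x)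
  have e : (fun c => c ^ 2 * (lam * J (lam * c))) =
      fun c => (lam⁻¹) * ((lam * c) ^ 2 * J (lam * c)) := by
    ext c; field_simp
  refine ⟨(hJint.comp_mul_left' hl0.ne').const_mul lam, fun x => mul_nonneg hl0.le (hJ0 _),
    fun x => by rw [mul_neg, hJe], ?_, ?_, by positivity, hm, ?_⟩
  · rw [integral_const_mul, Measure.integral_comp_mul_left, hJ1, abs_of_pos (inv_pos.2 hl0)]
    simp [hl0.ne']
  · rw [e]
    exact (hJ2.comp_mul_left' hl0.ne').const_mul _
  · rw [e, integral_const_mul, Measure.integral_comp_mul_left (fun x => x ^ 2 * J x),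
      abs_of_pos (inv_pos.2 hl0), smul_eq_mul, ← mul_assoc, ← mul_assoc]
    refine mul_le_of_le_one_left hm ?_
    have : lam ^ q ≤ lam ^ 2 := by
      rw [← Real.rpow_two]; exact Real.rpow_le_rpow_of_exponent_le hlam hq2.le
    rw [mul_assoc, ← mul_inv, ← div_eq_mul_inv, div_le_one (by positivity)]
    linarith [sq lam]

lemma init_scale {v φ : ℝ → ℝ} {lam : ℝ} (hl0 : 0 < lam) (h0 : v =ᵐ[volume] fun x => lam * φ (lam * x))
    (R : ℝ) :
    ∫ x in {x : ℝ | R < |x|}, |v x| = ∫ x in {x : ℝ | lam * R < |x|}, |φ x| := by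
  have hm : ∀ R : ℝ, MeasurableSet {x : ℝ | R < |x|} := fun R =>
    (isOpen_lt continuous_const continuous_abs).measurableSet
  have h1 : ∫ x in {x : ℝ | R < |x|}, |v x| = ∫ x in {x : ℝ | R < |x|}, lam * |φ (lam * x)| := by
    refine integral_congr_ae (ae_restrict_of_ae ?_)
    filter_upwards [h0] with x hx
    rw [hx, abs_mul, abs_of_pos hl0]
  rw [h1, ← integral_indicator (hm _), ← integral_indicator (hm _)]
  have e : (Set.indicator {x : ℝ | R < |x|} fun x => lam * |φ (lam * x)|) =
      fun x => lam * (Set.indicator {x : ℝ | lam * R < |x|} fun x => |φ x|) (lam * x) := by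
    ext x
    have : (lam * x ∈ {x : ℝ | lam * R < |x|}) ↔ x ∈ {x : ℝ | R < |x|} := by
      simp only [Set.mem_ofPred_eq]
      rw [abs_mul, abs_of_pos hl0]
      exact mul_lt_mul_iff_right₀ hl0
    by_cases hx : x ∈ {x : ℝ | R < |x|}
    · rw [Set.indicator_of_mem hx, Set.indicator_of_mem (this.2 hx)]
    · rw [Set.indicator_of_notMem hx, Set.indicator_of_notMem (fun h => hx (this.1 h)), mul_zero]
  rw [e, integral_const_mul, Measure.integral_comp_mul_left, abs_of_pos (inv_pos.2 hl0), smul_eq_mul,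
    ← mul_assoc, mul_inv_cancel₀ hl0.ne', one_mul]
end

section
variable {q μ ρ m : ℝ} {u : ℝ → ℝ → ℝ} {k : ℝ → ℝ}

lemma tail_bounds (S : Sol q μ u (gn k ρ u)) (Kr : Ker k ρ m)
    (hq : 1 < q) (hq2 : q < 2) (hμ : 0 < μ) (hμ1 : μ ≤ 1) {t K C R : ℝ} (ht : 0 < t) (hR : 0 < R)
    (hi0 : Integrable (u 0)) (hl0 : Tendsto (fun t => ∫ x, |u t x - u 0 x|) (𝓝[>] 0) (𝓝 0))
    (hK : ∫ x, |u 0 x| = K) (hC : 0 ≤ C) (hk : ∀ x, kk x ≤ C) (hdk : ∀ x, |deriv kk x| ≤ C) :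
    (∫ x, |u t x| ≤ K) ∧
    (∫ x in Set.Ioi (2 * R), |u t x| ≤ (∫ x in Set.Ioi R, |u 0 x|) +
      t * ((K * C * (2 / R)) ^ q + K * C * (2 / R) ^ 2 * (2 + m))) ∧
    (∫ x in Set.Iic (-(2 * R)), |u t x| ≤ (∫ x in Set.Iio (-R), |u 0 x|) +
      t * ((K * C * (2 / R)) ^ q + K * C * (2 / R) ^ 2 * (2 + m))) := by
  have hK0 : 0 ≤ K := hK ▸ integral_nonneg fun x => abs_nonneg _
  have hvt := (S.int t ht).abs
  have hr0 : 0 ≤ ∫ x in Set.Ioi R, |u 0 x| := integral_nonneg fun x => abs_nonneg _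
  have hl0' : 0 ≤ ∫ x in Set.Iio (-R), |u 0 x| := integral_nonneg fun x => abs_nonneg _
  have hle : ∀ s : Set ℝ, ∫ x in s, |u 0 x| ≤ K := fun s => by
    rw [← hK]; exact setIntegral_le_integral hi0.abs (Eventually.of_forall fun x => abs_nonneg _)
  have hmono : ∀ s s' : Set ℝ, s ⊆ s' → ∫ x in s, |u 0 x| ≤ ∫ x in s', |u 0 x| := fun s s' h =>
    setIntegral_mono_set hi0.abs.integrableOn (Eventually.of_forall fun x => abs_nonneg _)
      (LE.le.eventuallyLE h)
  have hα : (0:ℝ) ≤ 2 / R := by positivity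
  refine ⟨?_, ?_, ?_⟩
  · have Br := stp_bar (A1 := K) (A2 := 0) (K1 := 0) (K2 := 0) (K := 0) (α1 := 0) (α2 := 0)
      (β1 := 0) (β2 := 0) (α := 0) le_rfl le_rfl le_rfl le_rfl hC le_rfl (by simp) (by simp) hk hdk
    have h1 : ∀ n : ℕ, ∫ x in (-(n:ℝ))..n, |u t x| ≤ K := fun n => by
      have hn : (0:ℝ) ≤ n := Nat.cast_nonneg n
      have := d_main S Kr Br hq hq2 hμ hμ1 ht hi0 hl0 (ε0 := 1) one_pos
        (fun z y _ => by simp [stp, hK0]) (fun z y _ => by simpa [stp] using hle _)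
        (z := -n - 1) (y := n) (a := -n) (by linarith) (by linarith)
      rw [int_Icc_eq (by linarith)] at this
      simpa [stp, Real.zero_rpow (by linarith : q ≠ 0)] using this
    refine le_of_tendsto (intervalIntegral_tendsto_integral hvt
      (tendsto_neg_atTop_atBot.comp tendsto_natCast_atTop_atTop) tendsto_natCast_atTop_atTop)
      (Eventually.of_forall h1)
  · have Br := stp_bar (A1 := ∫ x in Set.Ioi R, |u 0 x|) (A2 := 0) (K1 := K) (K2 := 0) (K := K)
      (α1 := -(2 / R)) (α2 := 0) (β1 := 3) (β2 := 0) (α := 2 / R) hK0 le_rfl le_rfl hK0 hC hα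
      (by rw [abs_neg, abs_of_nonneg hα]) (by simpa using hα) hk hdk
    refine le_of_tendsto (intervalIntegral_tendsto_integral_Ioi (2 * R) hvt.integrableOn tendsto_id) ?_
    filter_upwards [eventually_ge_atTop (2 * R)] with y hy
    have := d_main S Kr Br hq hq2 hμ hμ1 ht hi0 hl0 (ε0 := 1) one_pos
        (fun z y _ => by
          simp only [stp, zero_mul, add_zero]
          have := pp_nonneg (-(2 / R) * z + 3); positivity)
        (fun z y _ => by
          simp only [stp, zero_mul, add_zero]
          rcases le_or_gt R z with h | h
          · have h1 := hmono (Set.Ioo z (y + 1)) (Set.Ioi R) fun x hx => h.trans_lt hx.1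
            have := pp_nonneg (-(2 / R) * z + 3)
            have : 0 ≤ K * pp (-(2 / R) * z + 3) := by positivity
            linarith
          · have h1 : 2 / R * z ≤ 2 := by
              rw [div_mul_eq_mul_div, div_le_iff₀ hR]; linarith
            rw [pp_one (by linarith)]
            linarith [hle (Set.Ioo z (y + 1))])
        (z := 3 * R / 2) (y := y) (a := 2 * R) (by linarith) (by linarith)
    rw [int_Icc_eq hy] at this
    refine this.trans (le_of_eq ?_)
    simp only [stp, zero_mul, add_zero]
    rw [pp_zero (by rw [show -(2 / R) * (3 * R / 2) + 3 = 0 by field_simp; ring]), mul_zero, add_zero]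
  · have Br := stp_bar (A1 := 0) (A2 := ∫ x in Set.Iio (-R), |u 0 x|) (K1 := 0) (K2 := K) (K := K)
      (α1 := 0) (α2 := 2 / R) (β1 := 0) (β2 := 4) (α := 2 / R) le_rfl hK0 hK0 le_rfl hC hα
      (by simpa using hα) (by rw [abs_of_nonneg hα]) hk hdk
    refine le_of_tendsto (intervalIntegral_tendsto_integral_Iic (-(2 * R)) hvt.integrableOn tendsto_id) ?_
    filter_upwards [eventually_le_atBot (-(2 * R))] with a ha
    have := d_main S Kr Br hq hq2 hμ hμ1 ht hi0 hl0 (ε0 := R / 2) (by linarith)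
        (fun z y _ => by
          simp only [stp, zero_mul, add_zero, zero_add]
          have := pp_nonneg (2 / R * y + 4); positivity)
        (fun z y _ => by
          simp only [stp, zero_mul, add_zero, zero_add]
          rcases le_or_gt y (-(3 * R / 2)) with h | h
          · have h1 := hmono (Set.Ioo z (y + R / 2)) (Set.Iio (-R)) fun x hx => by
              have := hx.2
              show x < -R
              linarith
            have := pp_nonneg (2 / R * y + 4)
            have : 0 ≤ K * pp (2 / R * y + 4) := by positivity
            linarith
          · have h1 : -3 ≤ 2 / R * y := by
              rw [div_mul_eq_mul_div, le_div_iff₀ hR]; linarith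
            rw [pp_one (by linarith)]
            linarith [hle (Set.Ioo z (y + R / 2))])
        (z := a - 1) (y := -(2 * R)) (a := a) (by linarith) (by linarith)
    rw [int_Icc_eq ha] at this
    refine this.trans (le_of_eq ?_)
    simp only [stp, zero_mul, add_zero, zero_add]
    rw [pp_zero (by rw [show 2 / R * (-(2 * R)) + 4 = 0 by field_simp; ring]), mul_zero, add_zero]
end

theorem stmt15
    (J : ℝ → ℝ) (hJpos : ∀ x, 0 ≤ J x) (hJeven : ∀ x, J (-x) = J x)
    (hJint : Integrable J) (hJmass : ∫ x, J x = 1)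
    (hJ2 : Integrable (fun x => (1 + |x| ^ 2) * J x))
    (q K : ℝ) (hq1 : 1 < q) (hq2 : q < 2) (hK : 0 ≤ K) :
    -- a constant C(‖φ‖₁, J, q), independent of λ and μ
    ∃ C : ℝ, 0 < C ∧
      ∀ (φ : ℝ → ℝ) (lam μ : ℝ) (u : ℝ → ℝ → ℝ),
        1 ≤ lam → 0 < μ → μ ≤ 1 → Integrable φ → (∫ y, |φ y|) = K →
        IsRescaledSol J q lam μ φ u →
        ∀ t R : ℝ, 0 < t → 0 < R →
          (∫ x in {x : ℝ | 2 * R < |x|}, |u t x|)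
            ≤ (∫ x in {x : ℝ | R < |x|}, |φ x|) + C * (t / R ^ 2 + t ^ (1 / q) / R) := by
  obtain ⟨D, hD, hk, hdk⟩ := kk_bound
  have hJ2' : Integrable fun x => x ^ 2 * J x := by
    have := hJ2.sub hJint
    refine this.congr (Eventually.of_forall fun x => ?_)
    simp only [Pi.sub_apply, sq_abs]; ring
  obtain ⟨m, hm⟩ : ∃ m, m = ∫ x, x ^ 2 * J x := ⟨_, rfl⟩
  have hm0 : 0 ≤ m := by
    rw [hm]; exact integral_nonneg fun x => mul_nonneg (sq_nonneg x) (hJpos x)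
  refine ⟨K + 2 * (K * D * 2) ^ q + 2 * (K * D * 4 * (2 + m)) + 1, by positivity, ?_⟩
  intro φ lam μ u hlam hμ hμ1 hφ hφK hsol t R ht hR
  have hl0 : 0 < lam := by linarith
  have Kr := ker_of (q := q) hlam hq2 hJpos hJeven hJint hJmass hJ2'
  rw [← hm] at Kr
  have S := sol_of hl0 hsol Kr.int hJeven hJpos Kr.one
  obtain ⟨hi, hl, _, _, _, h0⟩ := hsol
  have hi0 := hi 0 le_rfl
  have hlim : Tendsto (fun t => ∫ x, |u t x - u 0 x|) (𝓝[>] 0) (𝓝 0) :=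
    (hl 0 le_rfl).mono_left (nhdsWithin_mono _ Set.Ioi_subset_Ici_self)
  have hK' : ∫ x, |u 0 x| = K := by
    have h1 := init_scale hl0 h0 (-1)
    have e : ∀ c : ℝ, c < 0 → {x : ℝ | c < |x|} = Set.univ := fun c hc =>
      Set.eq_univ_of_forall fun x => hc.trans_le (abs_nonneg x)
    rw [e _ (by norm_num), e _ (by linarith), setIntegral_univ, setIntegral_univ] at h1
    rw [h1, hφK]
  obtain ⟨hA, hB, hE⟩ := tail_bounds S Kr hq1 hq2 hμ hμ1 ht hR hi0 hlim hK' hD.le hk hdk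
  have hvt := (S.int t ht).abs
  have hφpos : 0 ≤ ∫ x in {x : ℝ | R < |x|}, |φ x| := integral_nonneg fun x => abs_nonneg _
  set X : ℝ := t ^ (1 / q) / R with hX
  have hX0 : 0 < X := by positivity
  have hY0 : 0 < t / R ^ 2 := by positivity
  have hP0 : 0 ≤ (K * D * 2) ^ q := by positivity
  have hQ0 : 0 ≤ K * D * 4 * (2 + m) := by positivity
  rcases le_or_gt X 1 with hX1 | hX1
  · have hset : ∀ R : ℝ, 0 < R → {x : ℝ | R < |x|} = Set.Iio (-R) ∪ Set.Ioi R := by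
      intro R hR
      ext x
      simp only [Set.mem_ofPred_eq, Set.mem_union, Set.mem_Iio, Set.mem_Ioi, lt_abs]
      constructor
      · rintro (h | h)
        · exact Or.inr h
        · exact Or.inl (by linarith)
      · rintro (h | h)
        · exact Or.inr (by linarith)
        · exact Or.inl h
    have hsplit : ∀ (R : ℝ) (f : ℝ → ℝ), 0 < R → Integrable f → ∫ x in {x : ℝ | R < |x|}, f x =
        (∫ x in Set.Iio (-R), f x) + ∫ x in Set.Ioi R, f x := by
      intro R f hR hf
      rw [hset R hR]
      refine setIntegral_union ?_ measurableSet_Ioi hf.integrableOn hf.integrableOn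
      refine Set.disjoint_left.2 fun x hx hx' => ?_
      have h1 : x < -R := hx
      have h2 : R < x := hx'
      linarith
    have h1 := init_scale hl0 h0 R
    have h2 : ∫ x in {x : ℝ | lam * R < |x|}, |φ x| ≤ ∫ x in {x : ℝ | R < |x|}, |φ x| := by
      refine setIntegral_mono_set hφ.abs.integrableOn (Eventually.of_forall fun x => abs_nonneg _)
        (LE.le.eventuallyLE fun x hx => ?_)
      have h3 : lam * R < |x| := hx
      show R < |x|
      nlinarith
    rw [hsplit R _ hR hi0.abs] at h1
    rw [hsplit (2 * R) _ (by linarith) hvt, ← integral_Iic_eq_integral_Iio]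
    have h4 : t * (K * D * (2 / R)) ^ q = (K * D * 2) ^ q * X ^ q := by
      rw [← Real.mul_rpow (by positivity) hX0.le, hX]
      have : t = (t ^ (1 / q)) ^ q := by
        rw [← Real.rpow_mul ht.le, one_div, inv_mul_cancel₀ (by linarith), Real.rpow_one]
      conv_lhs => rw [this]
      rw [← Real.mul_rpow (by positivity) (by positivity)]
      congr 1
      ring
    have h5 : X ^ q ≤ X := by
      have := Real.rpow_le_rpow_of_exponent_ge hX0 hX1 hq1.le
      rwa [Real.rpow_one] at this
    have h6 : t * (K * D * (2 / R) ^ 2 * (2 + m)) = K * D * 4 * (2 + m) * (t / R ^ 2) := by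
      field_simp; ring
    have h7 := mul_le_mul_of_nonneg_left h5 hP0
    rw [mul_add, h4, h6] at hB hE
    have h8 : 0 ≤ (K + 2 * (K * D * 2) ^ q + 1) * (t / R ^ 2) := by positivity
    have h9 : 0 ≤ (K + 2 * (K * D * 4 * (2 + m)) + 1) * X := by positivity
    nlinarith
  · have h1 : ∫ x in {x : ℝ | 2 * R < |x|}, |u t x| ≤ ∫ x, |u t x| :=
      setIntegral_le_integral hvt (Eventually.of_forall fun x => abs_nonneg _)
    have h2 : K ≤ K * X := le_mul_of_one_le_right hK hX1.le
    have h3 : 0 ≤ (K + 2 * (K * D * 2) ^ q + 2 * (K * D * 4 * (2 + m)) + 1) * (t / R ^ 2) := by positivity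
    have h4 : 0 ≤ (2 * (K * D * 2) ^ q + 2 * (K * D * 4 * (2 + m)) + 1) * X := by positivity
    nlinarith
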